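/- Let p ∈ ℝ[z] be a polynomial of degree d ≥ 2 in reduced form, and write p(z) = z^m·q(z^n) where m ≥ 0, n ≥ 1, q ∈ ℝ[z], q(0) ≠ 0, and where q, n are chosen so that n is maximal if q ≠ 1. For a,b,c ∈ {0,1} set S_{abc} = ℝ[x,y,z]/(x² + (−1)^a y² + (−1)^b z^m q((−1)^c z^n)). Then every S_{abc} is a real form of B_p = ℂ[x,y,z]/(xy − p(z)), and: (i) if q = 1 and either d = 2 or d ≥ 3 is odd, then S_{000} and S_{110} are non-isomorphic ℝ-algebras and every real form of B_p is isomorphic to one of them (2 classes); (ii) if q = 1 and d ≥ 4 is even, or q ≠ 1 and n is odd, then S_{000}, S_{010}, S_{110} are pairwise non-isomorphic and every real form of B_p is isomorphic to one of them (3 classes); (iii) if q ≠ 1 and either n is even with d odd, or (n,d) = (2,2), then the four algebras S_{abb}, a,b ∈ {0,1}, are pairwise non-isomorphic and every real form of B_p is isomorphic to one of them (4 classes); (iv) if q ≠ 1, n and d are both even and (n,d) ≠ (2,2), then the six algebras S_{00c}, S_{a1c}, a,c ∈ {0,1}, are pairwise non-isomorphic and every real form of B_p is isomorphic to one of them (6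 classes). -/

import Mathlib

open MvPolynomial
open scoped TensorProduct

/-- `A` is a real form of the complex algebra `B` if the complexification `ℂ ⊗[ℝ] A`
is isomorphic to `B` as a `ℂ`-algebra. -/
def IsRealForm (A : Type) [CommRing A] [Algebra ℝ A]
    (B : Type) [CommRing B] [Algebra ℂ B] : Prop :=
  Nonempty ((ℂ ⊗[ℝ] A) ≃ₐ[ℂ] B)

/-- The polynomial `x² + (-1)^a y² + (-1)^b z^m q((-1)^c z^n)` defining `S_{abc}`. -/
noncomputable def sPoly (m n : ℕ) (q : Polynomial ℝ) (a b c : Fin 2) :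
    MvPolynomial (Fin 3) ℝ :=
  X 0 ^ 2 + (-1 : MvPolynomial (Fin 3) ℝ) ^ (a : ℕ) * X 1 ^ 2
    + (-1 : MvPolynomial (Fin 3) ℝ) ^ (b : ℕ)
      * (X 2 ^ m * Polynomial.aeval ((-1 : MvPolynomial (Fin 3) ℝ) ^ (c : ℕ) * X 2 ^ n) q)

/-- The real algebra `S_{abc} = ℝ[x,y,z]/(x² + (-1)^a y² + (-1)^b z^m q((-1)^c z^n))`. -/
noncomputable abbrev SAlg (m n : ℕ) (q : Polynomial ℝ) (i : Fin 2 × Fin 2 × Fin 2) :=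
  MvPolynomial (Fin 3) ℝ ⧸ Ideal.span {sPoly m n q i.1 i.2.1 i.2.2}

/-- The complex algebra `B_p = ℂ[x,y,z]/(xy - p(z))` for a real polynomial `p`. -/
noncomputable abbrev BpC (p : Polynomial ℝ) :=
  MvPolynomial (Fin 3) ℂ ⧸
    Ideal.span {(X 0 * X 1 : MvPolynomial (Fin 3) ℂ) -
      Polynomial.aeval (X 2) (p.map (algebraMap ℝ ℂ))}

/-- The isomorphism classes of real forms of `B_p` are exactly the classes of the
algebras `S_{abc}` for the indices `(a,b,c)` in the list `L`: these are pairwise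
non-isomorphic, and every real form of `B_p` is isomorphic to one of them. -/
def ClassifiedBy (p : Polynomial ℝ) (m n : ℕ) (q : Polynomial ℝ)
    (L : List (Fin 2 × Fin 2 × Fin 2)) : Prop :=
  (∀ i ∈ L, ∀ j ∈ L, i ≠ j → IsEmpty (SAlg m n q i ≃ₐ[ℝ] SAlg m n q j)) ∧
  (∀ (A : Type) [CommRing A] [Algebra ℝ A],
    IsRealForm A (BpC p) → ∃ i ∈ L, Nonempty (A ≃ₐ[ℝ] SAlg m n q i))


open MvPolynomial
open scoped TensorProduct

section P1
set_option linter.all false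
set_option linter.unusedSectionVars false
/-- coordinate systems -/
structure IsCoord (p : Polynomial ℂ) {B : Type} [CommRing B] [Algebra ℂ B] (x y z : B) : Prop where
  rel : x * y = Polynomial.aeval z p
  gen : Algebra.adjoin ℂ {x, y, z} = ⊤
  lift' : ∀ (T : Type) [CommRing T] (f : ℂ →+* T) (x' y' z' : T), x' * y' = p.eval₂ f z' →
    ∃ F : B →+* T, (∀ c, F (algebraMap ℂ B c) = f c) ∧ F x = x' ∧ F y = y' ∧ F z = z'

/-- divided difference -/
noncomputable def dq {T : Type} [CommRing T] [Algebra ℂ T] (p : Polynomial ℂ) (a b : T) : T :=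
  p.sum fun i c => algebraMap ℂ T c * ∑ j ∈ Finset.range i, a ^ j * b ^ (i - 1 - j)

theorem dq_mul {T : Type} [CommRing T] [Algebra ℂ T] (p : Polynomial ℂ) (a b : T) :
    dq p a b * (a - b) = Polynomial.aeval a p - Polynomial.aeval b p := by
  rw [Polynomial.aeval_eq_sum_range, Polynomial.aeval_eq_sum_range, dq,
    Polynomial.sum_over_range p (by simp), Finset.sum_mul, ← Finset.sum_sub_distrib]
  refine Finset.sum_congr rfl fun i _ => ?_
  rw [mul_assoc, geom_sum₂_mul, Algebra.smul_def, Algebra.smul_def]; ring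

theorem dq_symm {T : Type} [CommRing T] [Algebra ℂ T] (p : Polynomial ℂ) (a b : T) :
    dq p a b = dq p b a := by
  unfold dq
  rw [Polynomial.sum_def, Polynomial.sum_def]
  refine Finset.sum_congr rfl fun i _ => ?_
  rw [geom_sum₂_comm]
  

theorem map_dq {T T' : Type} [CommRing T] [Algebra ℂ T] [CommRing T'] [Algebra ℂ T']
    (F : T →ₐ[ℂ] T') (p : Polynomial ℂ) (a b : T) : F (dq p a b) = dq p (F a) (F b) := by
  unfold dq
  rw [Polynomial.sum_def, Polynomial.sum_def, map_sum]
  refine Finset.sum_congr rfl fun i _ => ?_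
  simp

variable {p : Polynomial ℂ} {B : Type} [CommRing B] [Algebra ℂ B] {x y z : B}

namespace IsCoord

theorem lift (h : IsCoord p x y z) (T : Type) [CommRing T] [Algebra ℂ T] (x' y' z' : T)
    (hr : x' * y' = Polynomial.aeval z' p) :
    ∃ F : B →ₐ[ℂ] T, F x = x' ∧ F y = y' ∧ F z = z' := by
  obtain ⟨F, h0, h1⟩ := h.lift' T (algebraMap ℂ T) x' y' z' hr
  exact ⟨{ F with commutes' := h0 }, h1⟩

theorem ind (h : IsCoord p x y z) {P : B → Prop} (hx : P x) (hy : P y) (hz : P z)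
    (hc : ∀ c : ℂ, P (algebraMap ℂ B c)) (ha : ∀ a b, P a → P b → P (a + b))
    (hm : ∀ a b, P a → P b → P (a * b)) (b : B) : P b := by
  have hb : b ∈ Algebra.adjoin ℂ ({x, y, z} : Set B) := by rw [h.gen]; trivial
  induction hb using Algebra.adjoin_induction with
  | mem u hu =>
    simp only [Set.mem_insert_iff, Set.mem_singleton_iff] at hu
    rcases hu with rfl | rfl | rfl <;> assumption
  | algebraMap c => exact hc c
  | add a b _ _ h1 h2 => exact ha a b h1 h2
  | mul a b _ _ h1 h2 => exact hm a b h1 h2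

theorem ext_ring (h : IsCoord p x y z) {T : Type} [CommRing T] {F G : B →+* T}
    (hc : ∀ c : ℂ, F (algebraMap ℂ B c) = G (algebraMap ℂ B c))
    (hx : F x = G x) (hy : F y = G y) (hz : F z = G z) (b : B) : F b = G b := by
  refine h.ind (P := fun b => F b = G b) hx hy hz hc ?_ ?_ b
  · intro a b h1 h2; simp [h1, h2]
  · intro a b h1 h2; simp [h1, h2]

theorem ext_alg (h : IsCoord p x y z) {T : Type} [CommRing T] [Algebra ℂ T] {F G : B →ₐ[ℂ] T}
    (hx : F x = G x) (hy : F y = G y) (hz : F z = G z) (b : B) : F b = G b :=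
  h.ext_ring (F := F.toRingHom) (G := G.toRingHom) (by simp) hx hy hz b

/-- equality of derivations along a hom -/
theorem ext_der (h : IsCoord p x y z) {T : Type} [CommRing T] [Algebra ℂ T] (ι : B →ₐ[ℂ] T)
    {f g : B → T} (fa : ∀ a b, f (a + b) = f a + f b) (ga : ∀ a b, g (a + b) = g a + g b)
    (fm : ∀ a b, f (a * b) = ι a * f b + ι b * f a) (gm : ∀ a b, g (a * b) = ι a * g b + ι b * g a)
    (fc : ∀ c : ℂ, f (algebraMap ℂ B c) = 0) (gc : ∀ c : ℂ, g (algebraMap ℂ B c) = 0)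
    (hx : f x = g x) (hy : f y = g y) (hz : f z = g z) (b : B) : f b = g b := by
  refine h.ind (P := fun b => f b = g b) hx hy hz (fun c => by rw [fc, gc]) ?_ ?_ b
  · intro a b h1 h2; rw [fa, ga, h1, h2]
  · intro a b h1 h2; rw [fm, gm, h1, h2]

theorem swap (h : IsCoord p x y z) : IsCoord p y x z where
  rel := by rw [mul_comm]; exact h.rel
  gen := by rw [← h.gen, Set.insert_comm]
  lift' := by
    intro T _ f x' y' z' hr
    obtain ⟨F, h0, h1, h2, h3⟩ := h.lift' T f y' x' z' (by rw [mul_comm]; exact hr)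
    exact ⟨F, h0, h2, h1, h3⟩

/-- general change of coordinates by hom tricks -/
theorem change (h : IsCoord p x y z) {x₁ y₁ z₁ : B} (F G : B →ₐ[ℂ] B)
    (hx : F x = x₁) (hy : F y = y₁) (hz : F z = z₁)
    (gx : G x₁ = x) (gy : G y₁ = y) (gz : G z₁ = z)
    (hgen : x ∈ Algebra.adjoin ℂ {x₁, y₁, z₁} ∧ y ∈ Algebra.adjoin ℂ {x₁, y₁, z₁}
      ∧ z ∈ Algebra.adjoin ℂ {x₁, y₁, z₁}) : IsCoord p x₁ y₁ z₁ where
  rel := by rw [← hx, ← hy, ← hz, ← map_mul, h.rel, Polynomial.aeval_algHom_apply]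
  gen := by
    rw [eq_top_iff, ← h.gen]
    refine Algebra.adjoin_le ?_
    rintro u (rfl | rfl | rfl)
    exacts [hgen.1, hgen.2.1, hgen.2.2]
  lift' := by
    intro T _ f x' y' z' hr
    obtain ⟨H, h0, h1, h2, h3⟩ := h.lift' T f x' y' z' hr
    refine ⟨H.comp G.toRingHom, ?_, ?_, ?_, ?_⟩
    · intro c; simp [h0]
    · simp [gx, h1]
    · simp [gy, h2]
    · simp [gz, h3]

theorem scale (h : IsCoord p x y z) {μ : ℂ} (hμ : μ ≠ 0) : IsCoord p (μ • x) (μ⁻¹ • y) z := by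
  obtain ⟨F, h1, h2, h3⟩ := h.lift B (μ • x) (μ⁻¹ • y) z (by simp [← h.rel, hμ])
  obtain ⟨G, g1, g2, g3⟩ := h.lift B (μ⁻¹ • x) (μ • y) z (by simp [← h.rel, hμ])
  refine h.change F G h1 h2 h3 (by simp [g1, hμ]) (by simp [g2, hμ]) g3 ⟨?_, ?_, ?_⟩
  · have : x = μ⁻¹ • (μ • x) := by simp [hμ]
    rw [this]
    exact Subalgebra.smul_mem _ (Algebra.subset_adjoin (by simp [hμ])) _
  · have : y = μ • (μ⁻¹ • y) := by simp [hμ]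
    rw [this]
    exact Subalgebra.smul_mem _ (Algebra.subset_adjoin (by simp [hμ])) _
  · exact Algebra.subset_adjoin (by simp)

theorem tri (h : IsCoord p x y z) (g : Polynomial ℂ) :
    ∃ y', IsCoord p x y' (z + x * Polynomial.aeval x g) := by
  set u := Polynomial.aeval x g with hu
  have key : ∀ (T : Type) [CommRing T] [Algebra ℂ T] (a b c v : T), a * b = Polynomial.aeval c p →
      a * (b + v * dq p (c + a * v) c) = Polynomial.aeval (c + a * v) p := by
    intro T _ _ a b c v hr
    have := dq_mul p (c + a * v) c
    rw [← hr] at this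
    linear_combination this
  refine ⟨y + u * dq p (z + x * u) z, ?_⟩
  obtain ⟨F, h1, h2, h3⟩ := h.lift B x (y + u * dq p (z + x * u) z) (z + x * u)
    (key B _ _ _ _ h.rel)
  have h' := key B x y z (-u) h.rel
  obtain ⟨G, g1, g2, g3⟩ := h.lift B _ _ _ h'
  have gu : G u = u := by rw [hu, ← Polynomial.aeval_algHom_apply, g1]
  have gz : G (z + x * u) = z := by rw [map_add, map_mul, g1, gu, g3]; ring
  refine h.change F G h1 h2 h3 g1 ?_ gz ⟨?_, ?_, ?_⟩
  · rw [map_add, map_mul, map_dq, gu, g2, g3, gz, dq_symm]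
    ring
  · exact Algebra.subset_adjoin (by simp)
  all_goals
    set S := Algebra.adjoin ℂ {x, y + u * dq p (z + x * u) z, z + x * u}
    have hx : x ∈ S := Algebra.subset_adjoin (by simp)
    have hus : u ∈ S := Polynomial.aeval_mem_adjoin_singleton ℂ x |> fun h =>
      Algebra.adjoin_mono (by simp) h
    have hzz : z + x * u ∈ S := Algebra.subset_adjoin (by simp)
    have hz : z ∈ S := by
      have := S.sub_mem hzz (S.mul_mem hx hus)
      simpa using this
  · have hy : y + u * dq p (z + x * u) z ∈ S := Algebra.subset_adjoin (by simp)
    have hd : dq p (z + x * u) z ∈ S := by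
      have := map_dq S.val p ⟨_, hzz⟩ ⟨_, hz⟩
      simp only [Subalgebra.coe_val] at this
      rw [← this]; exact Subtype.mem _
    have := S.sub_mem hy (S.mul_mem hus hd)
    simpa using this
  · exact hz

/-- two coordinate systems give an isomorphism -/
theorem exists_equiv (h : IsCoord p x y z) {B' : Type} [CommRing B'] [Algebra ℂ B'] {x' y' z' : B'}
    (h' : IsCoord p x' y' z') : ∃ e : B ≃ₐ[ℂ] B', e x = x' ∧ e y = y' ∧ e z = z' := by
  obtain ⟨F, f1, f2, f3⟩ := h.lift B' x' y' z' h'.rel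
  obtain ⟨G, g1, g2, g3⟩ := h'.lift B x y z h.rel
  refine ⟨AlgEquiv.ofAlgHom F G ?_ ?_, f1, f2, f3⟩
  · ext b
    exact h'.ext_alg (F := F.comp G) (G := AlgHom.id ℂ B') (by simp [*]) (by simp [*]) (by simp [*]) b
  · ext b
    exact h.ext_alg (F := G.comp F) (G := AlgHom.id ℂ B) (by simp [*]) (by simp [*]) (by simp [*]) b

theorem bijective (h : IsCoord p x y z) {B' : Type} [CommRing B'] [Algebra ℂ B'] {x' y' z' : B'}
    (h' : IsCoord p x' y' z') (F : B →ₐ[ℂ] B') (hx : F x = x') (hy : F y = y') (hz : F z = z') :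
    Function.Bijective F := by
  obtain ⟨e, e1, e2, e3⟩ := h.exists_equiv h'
  have : F = e := by
    ext b
    exact h.ext_alg (F := F) (G := e.toAlgHom) (by simp [*]) (by simp [*]) (by simp [*]) b
  rw [this]; exact e.bijective

theorem map_equiv (h : IsCoord p x y z) {B' : Type} [CommRing B'] [Algebra ℂ B'] (e : B ≃ₐ[ℂ] B') :
    IsCoord p (e x) (e y) (e z) where
  rel := by rw [← map_mul, h.rel]; exact (Polynomial.aeval_algHom_apply e.toAlgHom z p).symm
  gen := by
    have := congrArg (Subalgebra.map e.toAlgHom) h.gen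
    rw [AlgHom.map_adjoin, Set.image_insert_eq, Set.image_pair] at this
    rw [Algebra.map_top] at this
    refine Eq.trans this ?_
    rw [AlgHom.range_eq_top]
    exact e.surjective
  lift' := by
    intro T _ f x' y' z' hr
    obtain ⟨F, h0, h1, h2, h3⟩ := h.lift' T f x' y' z' hr
    exact ⟨F.comp e.symm.toAlgHom.toRingHom, by intro c; simp [h0], by simp [h1], by simp [h2], by simp [h3]⟩

/-- images under conjugate-semilinear ring automorphisms -/
theorem semi (h : IsCoord p x y z) (hp : p.map (starRingEnd ℂ) = p) (σ : B ≃+* B)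
    (hσ : ∀ c : ℂ, σ (algebraMap ℂ B c) = algebraMap ℂ B (starRingEnd ℂ c)) :
    IsCoord p (σ x) (σ y) (σ z) where
  rel := by
    have h1 := Polynomial.hom_eval₂ p (algebraMap ℂ B) σ.toRingHom z
    rw [← map_mul, h.rel, Polynomial.aeval_def, Polynomial.aeval_def]
    refine Eq.trans h1 ?_
    nth_rewrite 2 [← hp]
    rw [Polynomial.eval₂_map]
    congr 1
    ext c; simp [hσ]
  gen := by
    rw [eq_top_iff]
    rintro b -
    have : ∀ b, σ b ∈ Algebra.adjoin ℂ {σ x, σ y, σ z} := by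
      intro b
      refine h.ind (P := fun b => σ b ∈ Algebra.adjoin ℂ {σ x, σ y, σ z}) ?_ ?_ ?_ ?_ ?_ ?_ b
      · exact Algebra.subset_adjoin (by simp)
      · exact Algebra.subset_adjoin (by simp)
      · exact Algebra.subset_adjoin (by simp)
      · intro c; rw [hσ]; exact Subalgebra.algebraMap_mem _ _
      · intro a b ha hb; rw [map_add]; exact Subalgebra.add_mem _ ha hb
      · intro a b ha hb; rw [map_mul]; exact Subalgebra.mul_mem _ ha hb
    simpa using this (σ.symm b)
  lift' := by
    intro T _ f x' y' z' hr
    obtain ⟨F, h0, h1, h2, h3⟩ := h.lift' T (f.comp (starRingEnd ℂ)) x' y' z' (by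
      rw [hr, ← Polynomial.eval₂_map, hp])
    refine ⟨F.comp σ.symm.toRingHom, ?_, by simp [h1], by simp [h2], by simp [h3]⟩
    intro c
    have : σ.symm (algebraMap ℂ B c) = algebraMap ℂ B (starRingEnd ℂ c) := by
      rw [RingEquiv.symm_apply_eq, hσ]; simp
    simp [this, h0]

end IsCoord

end P1

open MvPolynomial
open scoped TensorProduct

section P2
set_option linter.all false
set_option linter.unusedSectionVars false

abbrev LR : Type := LaurentPolynomial (Polynomial ℂ)

noncomputable def LEu : LR →+ LR :=
  AddMonoidAlgebra.liftNC (LaurentPolynomial.C : Polynomial ℂ →+* LR).toAddMonoidHom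
    (fun n => (-(Multiplicative.toAdd n) : ℤ) • LaurentPolynomial.T (Multiplicative.toAdd n))

noncomputable def LD : LR →+ LR :=
  AddMonoidAlgebra.liftNC ((LaurentPolynomial.C : Polynomial ℂ →+* LR).toAddMonoidHom.comp
    (Polynomial.derivative : Polynomial ℂ →ₗ[ℂ] Polynomial ℂ).toAddMonoidHom)
    (fun n => LaurentPolynomial.T (Multiplicative.toAdd n))

theorem LEu_CT (φ : Polynomial ℂ) (n : ℤ) :
    LEu (LaurentPolynomial.C φ * LaurentPolynomial.T n) = (-n) • (LaurentPolynomial.C φ * LaurentPolynomial.T n) := by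
  rw [← LaurentPolynomial.single_eq_C_mul_T, LEu, AddMonoidAlgebra.liftNC_single]
  simp [LaurentPolynomial.single_eq_C_mul_T]
  ring

theorem LD_CT (φ : Polynomial ℂ) (n : ℤ) :
    LD (LaurentPolynomial.C φ * LaurentPolynomial.T n) = LaurentPolynomial.C (Polynomial.derivative φ) * LaurentPolynomial.T n := by
  rw [← LaurentPolynomial.single_eq_C_mul_T, LD, AddMonoidAlgebra.liftNC_single]
  simp 

theorem LEu_mul (f g : LR) : LEu (f * g) = f * LEu g + g * LEu f := by
  induction f using LaurentPolynomial.induction_on' with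
  | add f₁ f₂ h1 h2 => rw [add_mul, map_add, map_add, h1, h2]; ring
  | C_mul_T n φ =>
    induction g using LaurentPolynomial.induction_on' with
    | add f₁ f₂ h1 h2 => rw [mul_add, map_add, map_add, h1, h2]; ring
    | C_mul_T m ψ =>
      have : (LaurentPolynomial.C φ * LaurentPolynomial.T n) * (LaurentPolynomial.C ψ * LaurentPolynomial.T m)
        = (LaurentPolynomial.C (φ * ψ) * LaurentPolynomial.T (n + m) : LR) := by
        rw [LaurentPolynomial.T_add, map_mul]; ring
      rw [this, LEu_CT, LEu_CT, LEu_CT, mul_smul_comm, mul_smul_comm, this, mul_comm (_ * _), this, ← add_smul]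
      congr 1; ring

theorem LD_mul (f g : LR) : LD (f * g) = f * LD g + g * LD f := by
  induction f using LaurentPolynomial.induction_on' with
  | add f₁ f₂ h1 h2 => rw [add_mul, map_add, map_add, h1, h2]; ring
  | C_mul_T n φ =>
    induction g using LaurentPolynomial.induction_on' with
    | add f₁ f₂ h1 h2 => rw [mul_add, map_add, map_add, h1, h2]; ring
    | C_mul_T m ψ =>
      have : (LaurentPolynomial.C φ * LaurentPolynomial.T n) * (LaurentPolynomial.C ψ * LaurentPolynomial.T m)
        = (LaurentPolynomial.C (φ * ψ) * LaurentPolynomial.T (n + m) : LR) := by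
        rw [LaurentPolynomial.T_add, map_mul]; ring
      rw [this, LD_CT, LD_CT, LD_CT, LaurentPolynomial.T_add, Polynomial.derivative_mul, map_add, map_mul, map_mul]
      ring

theorem LEu_const (c : ℂ) : LEu (algebraMap ℂ LR c) = 0 := by
  have := LEu_CT (Polynomial.C c) 0
  simpa using this

theorem LD_const (c : ℂ) : LD (algebraMap ℂ LR c) = 0 := by
  have := LD_CT (Polynomial.C c) 0
  simpa using this

def Lead (r : LR) (N : ℤ) (φ : Polynomial ℂ) : Prop :=
  ∃ g : Polynomial (Polynomial ℂ), r = LaurentPolynomial.T (-N) * Polynomial.toLaurent g ∧ g.coeff 0 = φ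

namespace Lead
variable {r r' : LR} {N N' : ℤ} {φ φ' : Polynomial ℂ}

theorem mul (h : Lead r N φ) (h' : Lead r' N' φ') : Lead (r * r') (N + N') (φ * φ') := by
  obtain ⟨g, rfl, rfl⟩ := h
  obtain ⟨g', rfl, rfl⟩ := h'
  refine ⟨g * g', ?_, by rw [Polynomial.mul_coeff_zero]⟩
  rw [neg_add, LaurentPolynomial.T_add, map_mul]; ring

theorem add (h : Lead r N φ) (h' : Lead r' N φ') : Lead (r + r') N (φ + φ') := by
  obtain ⟨g, rfl, rfl⟩ := h
  obtain ⟨g', rfl, rfl⟩ := h'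
  exact ⟨g + g', by rw [map_add]; ring, by simp⟩

theorem neg (h : Lead r N φ) : Lead (-r) N (-φ) := by
  obtain ⟨g, rfl, rfl⟩ := h
  exact ⟨-g, by rw [map_neg]; ring, by simp⟩

theorem sub (h : Lead r N φ) (h' : Lead r' N φ') : Lead (r - r') N (φ - φ') := by
  rw [sub_eq_add_neg, sub_eq_add_neg]; exact h.add h'.neg

theorem zero (N : ℤ) : Lead 0 N 0 := ⟨0, by simp, by simp⟩

theorem const (φ : Polynomial ℂ) (n : ℤ) : Lead (LaurentPolynomial.C φ * LaurentPolynomial.T (-n)) n φ :=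
  ⟨Polynomial.C φ, by rw [Polynomial.toLaurent_C, mul_comm], by simp⟩

theorem one : Lead 1 0 1 := by simpa using const 1 0

theorem calg (c : ℂ) : Lead (algebraMap ℂ LR c) 0 (Polynomial.C c) := by
  simpa using const (Polynomial.C c) 0

theorem smul (c : ℂ) (h : Lead r N φ) : Lead (c • r) N (c • φ) := by
  have := (calg c).mul h
  rwa [zero_add, ← Algebra.smul_def, ← Polynomial.smul_eq_C_mul] at this

theorem pow (h : Lead r N φ) (k : ℕ) : Lead (r ^ k) (k * N) (φ ^ k) := by
  induction k with
  | zero => simpa using one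
  | succ k ih =>
    have := ih.mul h
    rw [pow_succ, pow_succ]
    convert this using 1
    push_cast; ring

theorem sum {ι : Type*} (s : Finset ι) (f : ι → LR) (φ : ι → Polynomial ℂ) (N : ℤ)
    (h : ∀ i ∈ s, Lead (f i) N (φ i)) : Lead (∑ i ∈ s, f i) N (∑ i ∈ s, φ i) := by
  classical
  induction s using Finset.induction_on with
  | empty => simpa using zero N
  | insert a s ha ih =>
    rw [Finset.sum_insert ha, Finset.sum_insert ha]
    exact (h a (by simp)).add (ih fun i hi => h i (by simp [hi]))

theorem of_lt (h : Lead r N φ) (hN : N < N') : Lead r N' 0 := by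
  obtain ⟨g, rfl, rfl⟩ := h
  obtain ⟨k, hk⟩ := Int.eq_ofNat_of_zero_le (by omega : 0 ≤ N' - N)
  refine ⟨Polynomial.X ^ k * g, ?_, ?_⟩
  · rw [map_mul, Polynomial.toLaurent_X_pow, ← mul_assoc, ← LaurentPolynomial.T_add]
    congr 2; omega
  · rw [Polynomial.mul_coeff_zero, Polynomial.coeff_X_pow, if_neg (by omega), zero_mul]

theorem unique (h : Lead r N φ) (h' : Lead r N φ') : φ = φ' := by
  obtain ⟨g, rfl, rfl⟩ := h
  obtain ⟨g', h1, rfl⟩ := h'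
  have := (LaurentPolynomial.isUnit_T (R := Polynomial ℂ) (-N)).mul_left_cancel h1
  rw [Polynomial.toLaurent_injective this]

theorem le_of_ne (h : Lead r N φ) (h' : Lead r N' φ') (h0 : φ ≠ 0) : N ≤ N' := by
  by_contra hc
  exact h0 (h.unique (h'.of_lt (not_le.mp hc)))

theorem eq_of_ne (h : Lead r N φ) (h' : Lead r N' φ') (h0 : φ ≠ 0) (h0' : φ' ≠ 0) : N = N' :=
  le_antisymm (h.le_of_ne h' h0) (h'.le_of_ne h h0')

theorem E (h : Lead r N φ) : Lead (LEu r) N ((N : ℂ) • φ) := by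
  obtain ⟨g, rfl, rfl⟩ := h
  have h1 : ∀ g : Polynomial (Polynomial ℂ), LEu (Polynomial.toLaurent g) =
      Polynomial.toLaurent (- (Polynomial.X * Polynomial.derivative g)) := by
    intro g
    induction g using Polynomial.induction_on' with
    | add p q hp hq => simp only [map_add, hp, hq, mul_add, neg_add]
    | monomial n a =>
      rw [← Polynomial.C_mul_X_pow_eq_monomial, Polynomial.toLaurent_C_mul_X_pow, LEu_CT]
      rcases n with _ | n
      · simp
      · have : (Polynomial.toLaurent (-(Polynomial.X * Polynomial.derivative (Polynomial.C a * Polynomial.X ^ (n + 1)))))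
            = -(((n + 1 : ℕ) : LR) * Polynomial.toLaurent (Polynomial.C a * Polynomial.X ^ (n + 1))) := by
          rw [map_neg, ← map_natCast (Polynomial.toLaurent (R := Polynomial ℂ)), ← map_mul]
          congr 2
          rw [Polynomial.derivative_C_mul_X_pow]
          simp; ring
        rw [this, Polynomial.toLaurent_C_mul_X_pow, zsmul_eq_mul]
        push_cast; ring
  have h2 : LEu (LaurentPolynomial.T (-N)) = (N : ℤ) • LaurentPolynomial.T (-N) := by
    have := LEu_CT 1 (-N)
    simpa using this
  refine ⟨(N : ℤ) • g - Polynomial.X * Polynomial.derivative g, ?_, ?_⟩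
  · rw [LEu_mul, h1, h2, map_sub, map_zsmul, map_neg]
    simp only [zsmul_eq_mul]; ring
  · simp [Polynomial.smul_eq_C_mul]

theorem D (h : Lead r N φ) : Lead (LD r) N (Polynomial.derivative φ) := by
  obtain ⟨g, rfl, rfl⟩ := h
  have h1 : ∀ g : Polynomial (Polynomial ℂ), ∃ g', LD (Polynomial.toLaurent g) =
      Polynomial.toLaurent g' ∧ g'.coeff 0 = Polynomial.derivative (g.coeff 0) := by
    intro g
    induction g using Polynomial.induction_on' with
    | add p q hp hq =>
      obtain ⟨p', hp1, hp2⟩ := hp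
      obtain ⟨q', hq1, hq2⟩ := hq
      exact ⟨p' + q', by simp [hp1, hq1], by simp [hp2, hq2]⟩
    | monomial n a =>
      refine ⟨Polynomial.C (Polynomial.derivative a) * Polynomial.X ^ n, ?_, ?_⟩
      · rw [← Polynomial.C_mul_X_pow_eq_monomial, Polynomial.toLaurent_C_mul_X_pow, LD_CT,
          Polynomial.toLaurent_C_mul_X_pow]
      · rcases n with _ | n <;> simp [Polynomial.coeff_monomial]
  obtain ⟨g', h2, h3⟩ := h1 g
  have h4 : LD (LaurentPolynomial.T (-N)) = 0 := by
    have := LD_CT 1 (-N)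
    simpa using this
  exact ⟨g', by rw [LD_mul, h2, h4]; ring, h3⟩

end Lead

noncomputable def LBr (f g : LR) : LR := LEu f * LD g - LD f * LEu g

theorem Lead.br {r r' : LR} {N N' : ℤ} {φ φ' : Polynomial ℂ} (h : Lead r N φ) (h' : Lead r' N' φ') :
    Lead (LBr r r') (N + N') ((N : ℂ) • (φ * Polynomial.derivative φ') - (N' : ℂ) • (Polynomial.derivative φ * φ')) := by
  have := (h.E.mul h'.D).sub (h.D.mul h'.E)
  rwa [smul_mul_assoc, mul_smul_comm] at this

end P2

open MvPolynomial
open scoped TensorProduct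

section P3
set_option linter.all false
set_option linter.unusedSectionVars false

structure Good (p : Polynomial ℂ) (d : ℕ) : Prop where
  monic : p.Monic
  deg : p.natDegree = d
  two : 2 ≤ d
  red : p.coeff (d - 1) = 0

variable {p : Polynomial ℂ} {d : ℕ} {B : Type} [CommRing B] [Algebra ℂ B] {x y z : B}

theorem IsCoord.exists_iota (h : IsCoord p x y z) (d a b : ℕ) : ∃ F : B →ₐ[ℂ] LR,
    F x = LaurentPolynomial.T (-((d * a : ℕ) : ℤ)) ∧
    F y = LaurentPolynomial.T ((d * a : ℕ) : ℤ) * Polynomial.aeval (LaurentPolynomial.C Polynomial.X * LaurentPolynomial.T (-((a + b : ℕ) : ℤ)) : LR) p ∧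
    F z = LaurentPolynomial.C Polynomial.X * LaurentPolynomial.T (-((a + b : ℕ) : ℤ)) := by
  refine h.lift LR _ _ _ ?_
  rw [← mul_assoc, ← LaurentPolynomial.T_add, neg_add_cancel, LaurentPolynomial.T_zero, one_mul]

noncomputable def IsCoord.iota (h : IsCoord p x y z) (d a b : ℕ) : B →ₐ[ℂ] LR :=
  (h.exists_iota d a b).choose

theorem IsCoord.iota_x (h : IsCoord p x y z) (d a b : ℕ) :
    h.iota d a b x = LaurentPolynomial.T (-((d * a : ℕ) : ℤ)) := (h.exists_iota d a b).choose_spec.1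
theorem IsCoord.iota_y (h : IsCoord p x y z) (d a b : ℕ) :
    h.iota d a b y = LaurentPolynomial.T ((d * a : ℕ) : ℤ) * Polynomial.aeval (LaurentPolynomial.C Polynomial.X * LaurentPolynomial.T (-((a + b : ℕ) : ℤ)) : LR) p :=
  (h.exists_iota d a b).choose_spec.2.1
theorem IsCoord.iota_z (h : IsCoord p x y z) (d a b : ℕ) :
    h.iota d a b z = LaurentPolynomial.C Polynomial.X * LaurentPolynomial.T (-((a + b : ℕ) : ℤ)) :=
  (h.exists_iota d a b).choose_spec.2.2

theorem IsCoord.lead_x (h : IsCoord p x y z) (d a b : ℕ) : Lead (h.iota d a b x) (d * a : ℕ) 1 := by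
  rw [h.iota_x]; simpa using Lead.const 1 ((d * a : ℕ) : ℤ)

theorem IsCoord.lead_z (h : IsCoord p x y z) (d a b : ℕ) :
    Lead (h.iota d a b z) (a + b : ℕ) Polynomial.X := by
  rw [h.iota_z]; exact Lead.const _ _

/-- lead of `g(ζ)` for polynomial `g` of degree ≤ `k` -/
theorem Lead.aeval {r : LR} {N : ℤ} {φ : Polynomial ℂ} (h : Lead r N φ) (hN : 0 < N)
    (g : Polynomial ℂ) : Lead (Polynomial.aeval r g) (g.natDegree * N) (g.leadingCoeff • φ ^ g.natDegree) := by
  rw [Polynomial.aeval_eq_sum_range, Finset.sum_range_succ]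
  have h1 : Lead (∑ i ∈ Finset.range g.natDegree, g.coeff i • r ^ i) (g.natDegree * N) (∑ i ∈ Finset.range g.natDegree, 0) := by
    refine Lead.sum _ _ _ _ fun i hi => ?_
    refine ((h.pow i).smul _).of_lt ?_
    have := Finset.mem_range.mp hi
    have : (i : ℤ) < g.natDegree := by exact_mod_cast this
    nlinarith
  simpa using h1.add ((h.pow g.natDegree).smul g.leadingCoeff)

theorem IsCoord.lead_y (h : IsCoord p x y z) (hp : Good p d) (a b : ℕ) (ha : 1 ≤ a) :
    Lead (h.iota d a b y) (d * b : ℕ) (Polynomial.X ^ d) := by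
  have h1 := (h.lead_z d a b).aeval (by exact_mod_cast (by omega : 0 < a + b)) p
  rw [hp.deg, hp.monic.leadingCoeff, one_smul, h.iota_z] at h1
  rw [h.iota_y]
  have h2 := (Lead.const 1 (-((d * a : ℕ) : ℤ))).mul h1
  simp only [map_one, one_mul, neg_neg] at h2
  convert h2 using 1
  push_cast; ring

/-- standard basis elements -/
noncomputable def cel (d : ℕ) (x y z : B) (u : ℕ × ℕ) : B :=
  x ^ ((u.1 - u.2) / d) * y ^ ((u.2 - u.1) / d) * z ^ (min u.1 u.2)

theorem cel_swap (d : ℕ) (x y z : B) (u : ℕ × ℕ) : cel d y x z u.swap = cel d x y z u := by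
  simp only [cel, Prod.fst_swap, Prod.snd_swap, min_comm]; ring

theorem cel_left (hd : 0 < d) (x y z : B) (t k : ℕ) : cel d x y z (t + d * k, t) = x ^ k * z ^ t := by
  simp [cel, hd]

theorem cel_right (hd : 0 < d) (x y z : B) (t k : ℕ) : cel d x y z (t, t + d * k) = y ^ k * z ^ t := by
  simp [cel, hd]

def lat (d : ℕ) : Set (ℕ × ℕ) := {u | (d : ℤ) ∣ (u.1 : ℤ) - u.2}

theorem lat_cases {u : ℕ × ℕ} (hu : u ∈ lat d) :
    (∃ t k, u = (t + d * k, t)) ∨ (∃ t k, u = (t, t + d * (k + 1))) := by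
  obtain ⟨s, t⟩ := u
  obtain ⟨k, hk⟩ := hu
  simp only at hk
  rcases le_or_gt 0 k with h | h
  · obtain ⟨k, rfl⟩ := Int.eq_ofNat_of_zero_le h
    left; refine ⟨t, k, ?_⟩
    ext
    · zify; linarith
    · rfl
  · right
    obtain ⟨j, hj⟩ := Int.eq_ofNat_of_zero_le (by omega : 0 ≤ -k - 1)
    refine ⟨s, j, ?_⟩
    ext
    · rfl
    · have : k = - (j + 1) := by omega
      subst this
      zify; linarith

theorem lat_left (t k : ℕ) : (t + d * k, t) ∈ lat d := ⟨k, by push_cast; ring⟩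
theorem lat_right (t k : ℕ) : (t, t + d * k) ∈ lat d := ⟨-k, by push_cast; ring⟩
theorem lat_swap {u : ℕ × ℕ} (h : u ∈ lat d) : u.swap ∈ lat d := by
  obtain ⟨k, hk⟩ := h
  exact ⟨-k, by simp only [Prod.fst_swap, Prod.snd_swap]; linarith⟩

theorem IsCoord.x_mul_span (h : IsCoord p x y z) (hd : 0 < d) (hp : p.natDegree = d) (v : B)
    (hv : v ∈ Submodule.span ℂ (cel d x y z '' lat d)) :
    x * v ∈ Submodule.span ℂ (cel d x y z '' lat d) := by
  induction hv using Submodule.span_induction with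
  | zero => simp
  | add a b _ _ h1 h2 => rw [mul_add]; exact Submodule.add_mem _ h1 h2
  | smul c a _ h1 => rw [mul_smul_comm]; exact Submodule.smul_mem _ _ h1
  | mem v hv =>
    obtain ⟨u, hu, rfl⟩ := hv
    rcases lat_cases hu with ⟨t, k, rfl⟩ | ⟨t, k, rfl⟩
    · refine Submodule.subset_span ⟨(t + d * (k + 1), t), lat_left _ _, ?_⟩
      rw [cel_left hd, cel_left hd]; ring
    · rw [cel_right hd]
      have : x * (y ^ (k + 1) * z ^ t) = ∑ j ∈ Finset.range (d + 1), p.coeff j • (y ^ k * z ^ (t + j)) := by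
        have h1 := h.rel
        rw [Polynomial.aeval_eq_sum_range, hp] at h1
        calc x * (y ^ (k + 1) * z ^ t) = (x * y) * (y ^ k * z ^ t) := by ring
          _ = _ := by
            rw [h1, Finset.sum_mul]
            refine Finset.sum_congr rfl fun j _ => ?_
            rw [smul_mul_assoc]; congr 1; ring
      rw [this]
      refine Submodule.sum_mem _ fun j _ => Submodule.smul_mem _ _ ?_
      refine Submodule.subset_span ⟨(t + j, t + j + d * k), lat_right _ _, cel_right hd _ _ _ _ _⟩

def CRep (d : ℕ) (x y z X : B) (c : ℕ × ℕ →₀ ℂ) : Prop :=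
  X = c.sum (fun u a => a • cel d x y z u) ∧ ∀ u ∈ c.support, u ∈ lat d

theorem IsCoord.exists_rep (h : IsCoord p x y z) (hp : Good p d) (X : B) : ∃ c, CRep d x y z X c := by
  have hd : 0 < d := by have := hp.two; omega
  set V := Submodule.span ℂ (cel d x y z '' lat d) with hV
  have hV' : V = Submodule.span ℂ (cel d y x z '' lat d) := by
    rw [hV]; congr 1
    ext b; constructor
    · rintro ⟨u, hu, rfl⟩; exact ⟨u.swap, lat_swap hu, cel_swap _ _ _ _ _⟩
    · rintro ⟨u, hu, rfl⟩; exact ⟨u.swap, lat_swap hu, cel_swap _ _ _ _ _⟩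
  have key : ∀ b : B, ∀ v ∈ V, b * v ∈ V := by
    intro b
    refine h.ind (P := fun b => ∀ v ∈ V, b * v ∈ V) ?_ ?_ ?_ ?_ ?_ ?_ b
    · exact fun v hv => h.x_mul_span hd hp.deg v hv
    · intro v hv
      rw [hV'] at hv ⊢
      exact h.swap.x_mul_span hd hp.deg v hv
    · intro v hv
      induction hv using Submodule.span_induction with
      | zero => simp
      | add a b _ _ h1 h2 => rw [mul_add]; exact Submodule.add_mem _ h1 h2
      | smul c a _ h1 => rw [mul_smul_comm]; exact Submodule.smul_mem _ _ h1
      | mem v hv =>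
        obtain ⟨u, hu, rfl⟩ := hv
        rcases lat_cases hu with ⟨t, k, rfl⟩ | ⟨t, k, rfl⟩
        · refine Submodule.subset_span ⟨((t + 1) + d * k, t + 1), lat_left _ _, ?_⟩
          rw [cel_left hd, cel_left hd]; ring
        · refine Submodule.subset_span ⟨(t + 1, t + 1 + d * (k + 1)), lat_right _ _, ?_⟩
          rw [cel_right hd, cel_right hd]; ring
    · intro c v hv; rw [← Algebra.smul_def]; exact Submodule.smul_mem _ _ hv
    · intro a b ha hb v hv; rw [add_mul]; exact Submodule.add_mem _ (ha v hv) (hb v hv)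
    · intro a b ha hb v hv; rw [mul_assoc]; exact ha _ (hb v hv)
  have h1 : (1 : B) ∈ V := Submodule.subset_span ⟨(0 + d * 0, 0), lat_left _ _, by rw [cel_left hd]; simp⟩
  have hX := key X 1 h1
  rw [mul_one, hV, Finsupp.mem_span_image_iff_linearCombination] at hX
  obtain ⟨c, hc, rfl⟩ := hX
  exact ⟨c, rfl, fun u hu => hc hu⟩

theorem CRep.swap {X : B} {c : ℕ × ℕ →₀ ℂ} (h : CRep d x y z X c) :
    CRep d y x z X (c.equivMapDomain (Equiv.prodComm ℕ ℕ)) := by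
  refine ⟨?_, ?_⟩
  · rw [h.1, Finsupp.equivMapDomain_eq_mapDomain, Finsupp.sum_mapDomain_index (by simp) (by intros; simp [add_smul])]
    refine Finsupp.sum_congr fun u _ => ?_
    congr 1
    exact (cel_swap _ _ _ _ _).symm
  · intro u hu
    have := h.2 u.swap (by simpa using hu)
    simpa using lat_swap this

theorem IsCoord.lead_cel (h : IsCoord p x y z) (hp : Good p d) (a b : ℕ) (ha : 1 ≤ a) (u : ℕ × ℕ)
    (hu : u ∈ lat d) : Lead (h.iota d a b (cel d x y z u)) (a * u.1 + b * u.2 : ℕ) (Polynomial.X ^ u.2) := by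
  have hd : 0 < d := by have := hp.two; omega
  rcases lat_cases hu with ⟨t, k, rfl⟩ | ⟨t, k, rfl⟩
  · rw [cel_left hd, map_mul, map_pow, map_pow]
    convert ((h.lead_x d a b).pow k).mul ((h.lead_z d a b).pow t) using 1
    · push_cast; ring
    · simp
  · rw [cel_right hd, map_mul, map_pow, map_pow]
    convert ((h.lead_y hp a b ha).pow (k+1)).mul ((h.lead_z d a b).pow t) using 1
    · push_cast; ring
    · simp only; ring

noncomputable def edge (c : ℕ × ℕ →₀ ℂ) (a b M : ℕ) : Polynomial ℂ :=
  ∑ u ∈ c.support, if a * u.1 + b * u.2 = M then c u • Polynomial.X ^ u.2 else 0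

theorem edge_coeff {c : ℕ × ℕ →₀ ℂ} {a b M : ℕ} (ha : 1 ≤ a) (u : ℕ × ℕ) (hu : a * u.1 + b * u.2 = M) :
    (edge c a b M).coeff u.2 = c u := by
  rw [edge, Polynomial.finsetSum_coeff, Finset.sum_eq_single u]
  · rw [if_pos hu]; simp
  · intro v hv hvu
    split_ifs with hM
    · rw [Polynomial.coeff_smul, Polynomial.coeff_X_pow, if_neg, smul_zero]
      intro h2
      apply hvu
      have : a * v.1 = a * u.1 := by rw [h2] at hu; omega
      ext
      · exact Nat.eq_of_mul_eq_mul_left ha this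
      · exact h2.symm
    · simp
  · intro hu'
    rw [if_pos hu]; simp [Finsupp.notMem_support_iff.mp hu']

theorem edge_coeff_ne {c : ℕ × ℕ →₀ ℂ} {a b M k : ℕ} (h : (edge c a b M).coeff k ≠ 0) :
    ∃ u ∈ c.support, a * u.1 + b * u.2 = M ∧ u.2 = k := by
  rw [edge, Polynomial.finsetSum_coeff] at h
  obtain ⟨u, hu, h1⟩ := Finset.exists_ne_zero_of_sum_ne_zero h
  split_ifs at h1 with hM
  · refine ⟨u, hu, hM, ?_⟩
    by_contra hk
    rw [Polynomial.coeff_smul, Polynomial.coeff_X_pow, if_neg (Ne.symm hk), smul_zero] at h1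
    exact h1 rfl
  · simp at h1

theorem CRep.lead (h : IsCoord p x y z) (hp : Good p d) {X : B} {c : ℕ × ℕ →₀ ℂ}
    (hX : CRep d x y z X c) (a b : ℕ) (ha : 1 ≤ a) (M : ℕ)
    (hM : ∀ u ∈ c.support, a * u.1 + b * u.2 ≤ M) : Lead (h.iota d a b X) M (edge c a b M) := by
  rw [hX.1, Finsupp.sum, map_sum]
  refine Lead.sum _ _ _ _ fun u hu => ?_
  rw [map_smul]
  have h1 := (h.lead_cel hp a b ha u (hX.2 u hu)).smul (c u)
  split_ifs with h2
  · rwa [h2] at h1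
  · exact h1.of_lt (by have := hM u hu; exact_mod_cast lt_of_le_of_ne this h2)

theorem CRep.exists_max {c : ℕ × ℕ →₀ ℂ} (hc : c ≠ 0) (a b : ℕ) : ∃ u ∈ c.support,
    ∀ v ∈ c.support, a * v.1 + b * v.2 ≤ a * u.1 + b * u.2 :=
  Finset.exists_max_image c.support (fun u => a * u.1 + b * u.2) (Finsupp.support_nonempty_iff.mpr hc)

theorem CRep.of_lead (h : IsCoord p x y z) (hp : Good p d) {X : B} {c : ℕ × ℕ →₀ ℂ}
    (hX : CRep d x y z X c) (a b : ℕ) (ha : 1 ≤ a) {M : ℤ} {φ : Polynomial ℂ}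
    (hM : Lead (h.iota d a b X) M φ) : ∀ u ∈ c.support, (a * u.1 + b * u.2 : ℕ) ≤ M := by
  intro u hu
  have hc : c ≠ 0 := by rintro rfl; simp at hu
  obtain ⟨v, hv, hmax⟩ := CRep.exists_max hc a b
  have h1 := hX.lead h hp a b ha _ hmax
  have h2 : edge c a b (a * v.1 + b * v.2) ≠ 0 := by
    intro h0
    have := edge_coeff (c := c) (b := b) ha v rfl
    rw [h0] at this
    exact (Finsupp.mem_support_iff.mp hv) (by simpa using this.symm)
  have h3 := h1.le_of_ne hM h2
  have := hmax u hu
  exact le_trans (by exact_mod_cast this) h3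

theorem IsCoord.iota_inj (h : IsCoord p x y z) (hp : Good p d) (a b : ℕ) (ha : 1 ≤ a) :
    Function.Injective (h.iota d a b) := by
  rw [injective_iff_map_eq_zero]
  intro X hX
  obtain ⟨c, hc⟩ := h.exists_rep hp X
  have h1 : Lead (h.iota d a b X) (-1) 0 := by rw [hX]; exact Lead.zero _
  have h2 := hc.of_lead h hp a b ha h1
  have : c = 0 := by
    by_contra h0
    obtain ⟨u, hu⟩ := Finsupp.support_nonempty_iff.mpr h0
    have := h2 u hu
    omega
  rw [hc.1, this]; simp

theorem IsCoord.isDomain (h : IsCoord p x y z) (hp : Good p d) : IsDomain B := by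
  have : IsDomain LR := inferInstance
  exact (h.iota_inj hp 1 1 le_rfl).isDomain (h.iota d 1 1).toRingHom

theorem IsCoord.exists_lead (h : IsCoord p x y z) (hp : Good p d) (a b : ℕ) (ha : 1 ≤ a) {X : B} (hX : X ≠ 0) :
    ∃ (M : ℕ) (φ : Polynomial ℂ), φ ≠ 0 ∧ Lead (h.iota d a b X) M φ := by
  obtain ⟨c, hc⟩ := h.exists_rep hp X
  have hc0 : c ≠ 0 := by rintro rfl; exact hX (by rw [hc.1]; simp)
  obtain ⟨v, hv, hmax⟩ := CRep.exists_max hc0 a b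
  refine ⟨_, _, ?_, hc.lead h hp a b ha _ hmax⟩
  intro h0
  have := edge_coeff (c := c) (b := b) ha v rfl
  rw [h0] at this
  exact (Finsupp.mem_support_iff.mp hv) (by simpa using this.symm)

theorem IsCoord.unit_const (h : IsCoord p x y z) (hp : Good p d) {X Y : B} (hXY : X * Y = 1) :
    ∃ c : ℂ, c ≠ 0 ∧ X = algebraMap ℂ B c := by
  have := h.isDomain hp
  have hX : X ≠ 0 := by rintro rfl; simp at hXY
  have hY : Y ≠ 0 := by rintro rfl; simp at hXY
  obtain ⟨M, φ, hφ, hM⟩ := h.exists_lead hp 1 1 le_rfl hX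
  obtain ⟨N, ψ, hψ, hN⟩ := h.exists_lead hp 1 1 le_rfl hY
  have h1 := hM.mul hN
  rw [← map_mul, hXY, map_one] at h1
  have h2 := Lead.one.eq_of_ne h1 one_ne_zero (mul_ne_zero hφ hψ)
  have hM0 : M = 0 := by omega
  obtain ⟨c, hc⟩ := h.exists_rep hp X
  have h3 := hc.of_lead h hp 1 1 le_rfl hM
  have h4 : X = algebraMap ℂ B (c (0, 0)) := by
    rw [hc.1, Finsupp.sum_eq_single (0, 0), Algebra.algebraMap_eq_smul_one]
    · simp [cel]
    · intro u hu hu0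
      exfalso; apply hu0
      have := h3 u (Finsupp.mem_support_iff.mpr hu)
      subst hM0
      have : u.1 = 0 ∧ u.2 = 0 := by omega
      ext <;> simp [this]
    · simp
  refine ⟨_, ?_, h4⟩
  intro h0; rw [h0] at h4; exact hX (by simpa using h4)

theorem IsCoord.x_ne (h : IsCoord p x y z) (hp : Good p d) : x ≠ 0 := by
  have := h.lead_x d 1 1
  rintro rfl
  rw [map_zero] at this
  exact one_ne_zero (this.unique (Lead.zero _))

theorem IsCoord.algebraMap_inj (h : IsCoord p x y z) : Function.Injective (algebraMap ℂ B) := by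
  obtain ⟨F, -⟩ := h.lift ℂ (Polynomial.aeval (0:ℂ) p) 1 0 (by simp)
  intro a b hab
  have := congrArg F hab
  simpa using this

end P3

open MvPolynomial
open scoped TensorProduct

section P4
set_option linter.all false
set_option linter.unusedSectionVars false

variable {p : Polynomial ℂ} {d : ℕ} {B : Type} [CommRing B] [Algebra ℂ B] {x y z : B}

/-- `p'(z)` -/
noncomputable def dz (p : Polynomial ℂ) (z : B) : B := Polynomial.aeval z (Polynomial.derivative p)

theorem IsCoord.exists_der (h : IsCoord p x y z) (vx vy vz : B)
    (hv : y * vx + x * vy = dz p z * vz) :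
    ∃ D : Derivation ℂ B B, D x = vx ∧ D y = vy ∧ D z = vz := by
  have h0 : ((TrivSqZeroExt.inr vz : TrivSqZeroExt B B)) ^ 2 = 0 := by
    rw [pow_two, TrivSqZeroExt.inr_mul_inr]
  have h1 : Polynomial.aeval (TrivSqZeroExt.inl z + TrivSqZeroExt.inr vz : TrivSqZeroExt B B) p =
      TrivSqZeroExt.inl (Polynomial.aeval z p) + TrivSqZeroExt.inr (dz p z * vz) := by
    rw [Polynomial.aeval_add_of_sq_eq_zero _ _ _ h0]
    have e : ∀ g : Polynomial ℂ, Polynomial.aeval (TrivSqZeroExt.inl z : TrivSqZeroExt B B) g =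
        TrivSqZeroExt.inl (Polynomial.aeval z g) := fun g =>
      Polynomial.aeval_algHom_apply (TrivSqZeroExt.inlAlgHom ℂ B B) z g
    rw [e, e, TrivSqZeroExt.inl_mul_inr, smul_eq_mul]; rfl
  obtain ⟨F, f1, f2, f3⟩ := h.lift (TrivSqZeroExt B B) (TrivSqZeroExt.inl x + TrivSqZeroExt.inr vx)
    (TrivSqZeroExt.inl y + TrivSqZeroExt.inr vy) (TrivSqZeroExt.inl z + TrivSqZeroExt.inr vz) (by
      rw [h1, ← h.rel, ← hv]
      ext
      · simp
      · simp; ring)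
  have hF : ∀ b, (F b).fst = b := fun b =>
    h.ext_alg (F := (TrivSqZeroExt.fstHom ℂ B B).comp F) (G := AlgHom.id ℂ B)
      (by simp [f1]) (by simp [f2]) (by simp [f3]) b
  refine ⟨Derivation.mk' ((TrivSqZeroExt.sndHom B B).restrictScalars ℂ ∘ₗ F.toLinearMap) ?_, ?_, ?_, ?_⟩
  · intro a b
    simp [TrivSqZeroExt.snd_mul, hF, mul_comm]
  · simp [f1]
  · simp [f2]
  · simp [f3]

noncomputable def IsCoord.Dx (h : IsCoord p x y z) : Derivation ℂ B B :=
  (h.exists_der 0 (dz p z) x (by ring)).choose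
noncomputable def IsCoord.Dy (h : IsCoord p x y z) : Derivation ℂ B B :=
  (h.exists_der (-dz p z) 0 (-y) (by ring)).choose
noncomputable def IsCoord.Dz (h : IsCoord p x y z) : Derivation ℂ B B :=
  (h.exists_der (-x) y 0 (by ring)).choose

theorem IsCoord.Dx_x (h : IsCoord p x y z) : h.Dx x = 0 := (h.exists_der 0 (dz p z) x (by ring)).choose_spec.1
theorem IsCoord.Dx_y (h : IsCoord p x y z) : h.Dx y = dz p z := (h.exists_der 0 (dz p z) x (by ring)).choose_spec.2.1
theorem IsCoord.Dx_z (h : IsCoord p x y z) : h.Dx z = x := (h.exists_der 0 (dz p z) x (by ring)).choose_spec.2.2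
theorem IsCoord.Dy_x (h : IsCoord p x y z) : h.Dy x = -dz p z := (h.exists_der (-dz p z) 0 (-y) (by ring)).choose_spec.1
theorem IsCoord.Dy_y (h : IsCoord p x y z) : h.Dy y = 0 := (h.exists_der (-dz p z) 0 (-y) (by ring)).choose_spec.2.1
theorem IsCoord.Dy_z (h : IsCoord p x y z) : h.Dy z = -y := (h.exists_der (-dz p z) 0 (-y) (by ring)).choose_spec.2.2
theorem IsCoord.Dz_x (h : IsCoord p x y z) : h.Dz x = -x := (h.exists_der (-x) y 0 (by ring)).choose_spec.1
theorem IsCoord.Dz_y (h : IsCoord p x y z) : h.Dz y = y := (h.exists_der (-x) y 0 (by ring)).choose_spec.2.1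
theorem IsCoord.Dz_z (h : IsCoord p x y z) : h.Dz z = 0 := (h.exists_der (-x) y 0 (by ring)).choose_spec.2.2

theorem IsCoord.der_ext (h : IsCoord p x y z) {D E : Derivation ℂ B B} (hx : D x = E x) (hy : D y = E y)
    (hz : D z = E z) : D = E := by
  ext b
  refine h.ext_der (AlgHom.id ℂ B) (f := D) (g := E) (by simp) (by simp) (by simp) (by simp) (by simp) (by simp) hx hy hz b

theorem IsCoord.Drel (h : IsCoord p x y z) (a : B) : y * h.Dx a + x * h.Dy a = dz p z * h.Dz a := by
  have : y • h.Dx + x • h.Dy = dz p z • h.Dz := by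
    apply h.der_ext <;>
    simp only [Derivation.add_apply, Derivation.smul_apply, smul_eq_mul, h.Dx_x, h.Dx_y, h.Dx_z, h.Dy_x, h.Dy_y, h.Dy_z, h.Dz_x, h.Dz_y, h.Dz_z] <;> ring
  simpa using congrArg (fun D => D a) this

noncomputable def IsCoord.ad (h : IsCoord p x y z) (a : B) : Derivation ℂ B B :=
  (h.exists_der (-h.Dx a) (-h.Dy a) (-h.Dz a) (by linear_combination -h.Drel a)).choose

theorem IsCoord.ad_x (h : IsCoord p x y z) (a : B) : h.ad a x = -h.Dx a :=
  (h.exists_der (-h.Dx a) (-h.Dy a) (-h.Dz a) (by linear_combination -h.Drel a)).choose_spec.1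
theorem IsCoord.ad_y (h : IsCoord p x y z) (a : B) : h.ad a y = -h.Dy a :=
  (h.exists_der (-h.Dx a) (-h.Dy a) (-h.Dz a) (by linear_combination -h.Drel a)).choose_spec.2.1
theorem IsCoord.ad_z (h : IsCoord p x y z) (a : B) : h.ad a z = -h.Dz a :=
  (h.exists_der (-h.Dx a) (-h.Dy a) (-h.Dz a) (by linear_combination -h.Drel a)).choose_spec.2.2

theorem IsCoord.x_mul_ad (h : IsCoord p x y z) (a b : B) :
    x * h.ad a b = h.Dx a * h.Dz b - h.Dz a * h.Dx b := by
  have : x • h.ad a = h.Dx a • h.Dz - h.Dz a • h.Dx := by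
    have := h.Drel a
    apply h.der_ext <;>
    simp only [Derivation.sub_apply, Derivation.smul_apply, smul_eq_mul, h.ad_x, h.ad_y, h.ad_z, h.Dx_x, h.Dx_y, h.Dx_z, h.Dy_x, h.Dy_y, h.Dy_z, h.Dz_x, h.Dz_y, h.Dz_z]
    · ring
    · linear_combination -this
    · ring
  simpa using congrArg (fun D => D b) this

theorem IsCoord.ad_antisymm (h : IsCoord p x y z) (hp : Good p d) (a b : B) : h.ad a b = - h.ad b a := by
  have := h.isDomain hp
  apply mul_left_cancel₀ (h.x_ne hp)
  rw [mul_neg, h.x_mul_ad, h.x_mul_ad]; ring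

theorem IsCoord.ad_self (h : IsCoord p x y z) (hp : Good p d) (a : B) : h.ad a a = 0 := by
  have := h.isDomain hp
  apply mul_left_cancel₀ (h.x_ne hp)
  rw [h.x_mul_ad]; ring

theorem IsCoord.ad_xx (h : IsCoord p x y z) : h.ad x = h.Dx := by
  apply h.der_ext <;> simp only [h.ad_x, h.ad_y, h.ad_z, h.Dx_x, h.Dx_y, h.Dx_z, h.Dy_x, h.Dz_x] <;> ring

theorem der_dz (D : Derivation ℂ B B) (w : B) (g : Polynomial ℂ) :
    D (Polynomial.aeval w g) = Polynomial.aeval w (Polynomial.derivative g) * D w := by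
  rw [Derivation.map_aeval, smul_eq_mul]

/-- `X ∣ b` criterion -/
theorem IsCoord.dvd_x (h : IsCoord p x y z) (hp : Good p d) {b c : B} (hbc : y * b = x * c) : ∃ e, b = x * e := by
  obtain ⟨χ, c1, c2, c3⟩ := h.lift (Polynomial (AdjoinRoot p)) 0 Polynomial.X (Polynomial.C (AdjoinRoot.root p)) (by
    rw [zero_mul]
    have := Polynomial.aeval_algHom_apply (Polynomial.CAlgHom (R := ℂ) (A := AdjoinRoot p)) (AdjoinRoot.root p) p
    simp only [Polynomial.CAlgHom_apply] at this
    rw [this]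
    have h2 : Polynomial.aeval (AdjoinRoot.root p) p = 0 := by
      rw [AdjoinRoot.aeval_eq]; exact AdjoinRoot.mk_self
    rw [h2, map_zero])
  have hb : χ b = 0 := by
    have := congrArg χ hbc
    rw [map_mul, map_mul, c1, c2, zero_mul] at this
    exact (Polynomial.monic_X.mul_right_eq_zero_iff).mp this
  -- every element is x*e + Σ y^k r_k(z) with deg r_k < d
  have key : ∀ b : B, ∃ (e : B) (g : Polynomial (Polynomial ℂ)), b = x * e + Polynomial.eval₂ (Polynomial.aeval z).toRingHom y g := by
    intro b
    refine h.ind (P := fun b => ∃ (e : B) (g : Polynomial (Polynomial ℂ)), b = x * e + Polynomial.eval₂ (Polynomial.aeval z).toRingHom y g) ?_ ?_ ?_ ?_ ?_ ?_ b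
    · exact ⟨1, 0, by simp⟩
    · exact ⟨0, Polynomial.X, by simp⟩
    · exact ⟨0, Polynomial.C Polynomial.X, by simp⟩
    · intro c; exact ⟨0, Polynomial.C (Polynomial.C c), by simp⟩
    · rintro a b ⟨e, g, rfl⟩ ⟨e', g', rfl⟩
      exact ⟨e + e', g + g', by rw [Polynomial.eval₂_add]; ring⟩
    · rintro a b ⟨e, g, rfl⟩ ⟨e', g', rfl⟩
      exact ⟨x * e * e' + e * Polynomial.eval₂ (Polynomial.aeval z).toRingHom y g' + e' * Polynomial.eval₂ (Polynomial.aeval z).toRingHom y g, g * g', by rw [Polynomial.eval₂_mul]; ring⟩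
  obtain ⟨e, g, rfl⟩ := key b
  have h3 : χ (Polynomial.eval₂ (Polynomial.aeval z).toRingHom y g) = g.map (AdjoinRoot.mk p) := by
    refine Eq.trans (Polynomial.hom_eval₂ g _ χ.toRingHom y) ?_
    rw [Polynomial.map]
    have : χ.toRingHom.comp (Polynomial.aeval z).toRingHom = (Polynomial.C).comp (AdjoinRoot.mk p) := by
      apply Polynomial.ringHom_ext
      · intro a
        simp only [AlgHom.toRingHom_eq_coe, RingHom.coe_comp, RingHom.coe_coe, Function.comp_apply, Polynomial.aeval_C, AlgHom.commutes]
        rfl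
      · simp [c3]
    rw [this]
    congr 1
  rw [map_add, map_mul, c1, zero_mul, zero_add, h3] at hb
  have h4 : ∀ n, ∃ q, g.coeff n = p * q := by
    intro n
    have := congrArg (fun f => Polynomial.coeff f n) hb
    simp only [Polynomial.coeff_map, Polynomial.coeff_zero] at this
    exact AdjoinRoot.mk_eq_zero.mp this
  choose q hq using h4
  rw [Polynomial.eval₂_eq_sum_range]
  refine ⟨e + ∑ i ∈ Finset.range (g.natDegree + 1), y * Polynomial.aeval z (q i) * y ^ i, ?_⟩
  rw [mul_add, Finset.mul_sum]
  congr 1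
  refine Finset.sum_congr rfl fun i _ => ?_
  rw [hq]
  simp only [AlgHom.toRingHom_eq_coe, RingHom.coe_coe, map_mul, ← h.rel]
  ring

variable {x' y' z' : B}

theorem IsCoord.jac1 (h : IsCoord p x y z) (h' : IsCoord p x' y' z') (hp : Good p d) :
    ∃ j : B, h.ad x' z' = j * x' ∧ (∀ b, h.ad x' b = j * h'.Dx b) ∧ ∀ a b, h.ad a b = j * h'.ad a b := by
  have := h.isDomain hp
  have e1 := h.ad_antisymm hp
  have hself := h.ad_self hp
  have hl : ∀ a, x' * h.ad a y' + y' * h.ad a x' = dz p z' * h.ad a z' := by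
    intro a
    have := congrArg (h.ad a) h'.rel
    rw [der_dz, Derivation.leibniz] at this
    simpa [dz] using this
  obtain ⟨j, hj⟩ := h'.dvd_x hp (b := h.ad x' z') (c := -h.ad y' z') (by
    have := hl z'
    rw [hself, e1 z' y', e1 z' x'] at this
    linear_combination -this)
  have hx0 := h'.x_ne hp
  have hy0 := h'.swap.x_ne hp
  have hxy : h.ad x' y' = j * dz p z' := by
    apply mul_left_cancel₀ hx0
    have := hl x'
    rw [hself, hj] at this
    linear_combination this
  have hyz : h.ad y' z' = -j * y' := by
    apply mul_left_cancel₀ hx0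
    have := hl z'
    rw [hself, e1 z' y', e1 z' x', hj] at this
    linear_combination -this
  have adx : h.ad x' = j • h'.Dx := by
    apply h'.der_ext <;> simp only [Derivation.smul_apply, smul_eq_mul, h'.Dx_x, h'.Dx_y, h'.Dx_z, hself, hxy, hj] <;> ring
  have ady : h.ad y' = j • h'.Dy := by
    apply h'.der_ext <;> simp only [Derivation.smul_apply, smul_eq_mul, h'.Dy_x, h'.Dy_y, h'.Dy_z, hself, e1 y' x', hxy, hyz] <;> ring
  have adz : h.ad z' = j • h'.Dz := by
    apply h'.der_ext <;> simp only [Derivation.smul_apply, smul_eq_mul, h'.Dz_x, h'.Dz_y, h'.Dz_z, hself, e1 z' x', e1 z' y', hj, hyz] <;> ring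
  refine ⟨j, by rw [hj]; ring, by intro b; rw [adx]; simp, ?_⟩
  intro a b
  have : h.ad a = j • h'.ad a := by
    apply h'.der_ext <;> simp only [Derivation.smul_apply, smul_eq_mul, h'.ad_x, h'.ad_y, h'.ad_z]
    · rw [e1, adx]; simp
    · rw [e1, ady]; simp
    · rw [e1, adz]; simp
  rw [this]; simp

theorem IsCoord.jac (h : IsCoord p x y z) (h' : IsCoord p x' y' z') (hp : Good p d) :
    ∃ j : ℂ, j ≠ 0 ∧ (∀ b, h.ad x' b = j • h'.Dx b) ∧ ∀ a b, h.ad a b = j • h'.ad a b := by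
  have := h.isDomain hp
  obtain ⟨j, h1, h2, h3⟩ := h.jac1 h' hp
  obtain ⟨j', h1', h2', h3'⟩ := h'.jac1 h hp
  have hx0 := h.x_ne hp
  have hu : j * j' = 1 := by
    apply mul_right_cancel₀ hx0
    have := h3 x z
    rw [h1', h.ad_xx, h.Dx_z] at this
    linear_combination -this
  obtain ⟨c, hc, rfl⟩ := h.unit_const hp hu
  exact ⟨c, hc, fun b => by rw [h2, Algebra.smul_def], fun a b => by rw [h3, Algebra.smul_def]⟩

/-- locally nilpotent -/
theorem IsCoord.Dx_ln (h : IsCoord p x y z) (b : B) : ∃ n : ℕ, ∀ k, n ≤ k → (h.Dx)^[k] b = 0 := by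
  have hz0 : ∀ n, (h.Dx)^[n] 0 = 0 := fun n => Function.iterate_fixed (map_zero _) n
  have up : ∀ b n, (h.Dx)^[n] b = 0 → ∀ k, n ≤ k → (h.Dx)^[k] b = 0 := by
    intro b n hn k hk
    obtain ⟨m, rfl⟩ := Nat.exists_eq_add_of_le hk
    rw [add_comm, Function.iterate_add_apply, hn, hz0]
  have padd : ∀ a b, (∃ n : ℕ, ∀ k, n ≤ k → (h.Dx)^[k] a = 0) → (∃ n : ℕ, ∀ k, n ≤ k → (h.Dx)^[k] b = 0) →
    (∃ n : ℕ, ∀ k, n ≤ k → (h.Dx)^[k] (a+b) = 0) := by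
    rintro a b ⟨n, hn⟩ ⟨m, hm⟩
    refine ⟨max n m, fun k hk => ?_⟩
    rw [iterate_map_add, hn k (by omega), hm k (by omega), add_zero]
  have key : ∀ s n m : ℕ, n + m ≤ s → ∀ a b, (h.Dx)^[n] a = 0 → (h.Dx)^[m] b = 0 → (h.Dx)^[s] (a * b) = 0 := by
    intro s
    induction s with
    | zero =>
      intro n m hnm a b ha hb
      have : n = 0 := by omega
      subst this
      simp at ha
      simp [ha]
    | succ s ih =>
      intro n m hnm a b ha hb
      rw [Function.iterate_succ_apply, Derivation.leibniz, iterate_map_add, smul_eq_mul, smul_eq_mul]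
      rcases n with _ | n
      · simp at ha; simp [ha, hz0]
      · rcases m with _ | m
        · simp at hb; simp [hb, hz0]
        · rw [ih (n+1) m (by omega) a (h.Dx b) ha (by rw [← Function.iterate_succ_apply]; exact hb),
            ih (m+1) n (by omega) b (h.Dx a) hb (by rw [← Function.iterate_succ_apply]; exact ha), add_zero]
  have pmul : ∀ a b, (∃ n : ℕ, ∀ k, n ≤ k → (h.Dx)^[k] a = 0) → (∃ n : ℕ, ∀ k, n ≤ k → (h.Dx)^[k] b = 0) →
    (∃ n : ℕ, ∀ k, n ≤ k → (h.Dx)^[k] (a*b) = 0) := by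
    rintro a b ⟨n, hn⟩ ⟨m, hm⟩
    exact ⟨n + m, fun k hk => key k n m hk a b (hn n le_rfl) (hm m le_rfl)⟩
  have pc : ∀ c : ℂ, (∃ n : ℕ, ∀ k, n ≤ k → (h.Dx)^[k] (algebraMap ℂ B c) = 0) := by
    intro c; exact ⟨1, up _ 1 (by simp)⟩
  have px : (∃ n : ℕ, ∀ k, n ≤ k → (h.Dx)^[k] x = 0) := ⟨1, up _ 1 (by simp [h.Dx_x])⟩
  have pz : (∃ n : ℕ, ∀ k, n ≤ k → (h.Dx)^[k] z = 0) := ⟨2, up _ 2 (by simp [h.Dx_x, h.Dx_z])⟩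
  have pp : ∀ g : Polynomial ℂ, (∃ n : ℕ, ∀ k, n ≤ k → (h.Dx)^[k] (Polynomial.aeval z g) = 0) := by
    intro g
    induction g using Polynomial.induction_on with
    | C a => simpa using pc a
    | add f g hf hg => rw [map_add]; exact padd _ _ hf hg
    | monomial n a ih =>
      rw [pow_succ, ← mul_assoc, map_mul, Polynomial.aeval_X]
      exact pmul _ _ ih pz
  have py : (∃ n : ℕ, ∀ k, n ≤ k → (h.Dx)^[k] y = 0) := by
    obtain ⟨n, hn⟩ := pp (Polynomial.derivative p)
    refine ⟨n + 1, up _ _ ?_⟩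
    rw [Function.iterate_succ_apply, h.Dx_y]
    exact hn n le_rfl
  exact h.ind (P := fun b => ∃ n : ℕ, ∀ k, n ≤ k → (h.Dx)^[k] b = 0) px py pz pc padd pmul b

theorem IsCoord.iota_br (h : IsCoord p x y z) (hp : Good p d) (a b : ℕ) (f g : B) :
    ((d * a : ℕ) : ℂ) • h.iota d a b (h.ad f g) = LaurentPolynomial.T ((a + b : ℕ) : ℤ) * LBr (h.iota d a b f) (h.iota d a b g) := by
  set ι := h.iota d a b with hι
  set τ : ℤ → LR := LaurentPolynomial.T with hτ
  have hDT : ∀ n, LD (τ n) = 0 := fun n => by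
    have := LD_CT 1 n
    simpa using this
  have hET : ∀ n : ℤ, LEu (τ n) = (-n) • (τ n) := fun n => by
    have := LEu_CT 1 n
    simpa using this
  set ζ : LR := LaurentPolynomial.C Polynomial.X * τ (-((a + b : ℕ) : ℤ)) with hζ
  have hDz : LD ζ = τ (-((a + b : ℕ) : ℤ)) := by rw [hζ, LD_CT, Polynomial.derivative_X, map_one, one_mul]
  have hEz : LEu ζ = ((a + b : ℕ) : LR) * ζ := by rw [hζ, LEu_CT, neg_neg, zsmul_eq_mul, Int.cast_natCast]
  have ix : ι x = τ (-((d * a : ℕ) : ℤ)) := h.iota_x d a b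
  have iz : ι z = ζ := h.iota_z d a b
  have tt : ∀ n, τ (-n) * τ n = 1 := fun n => by rw [hτ, ← LaurentPolynomial.T_add]; simp
  -- derivation along polynomials
  have chain : ∀ (L : LR →+ LR) (hm : ∀ f g, L (f * g) = f * L g + g * L f) (hc : ∀ c : ℂ, L (algebraMap ℂ LR c) = 0)
     (w : LR) (q : Polynomial ℂ), L (Polynomial.aeval w q) = Polynomial.aeval w (Polynomial.derivative q) * L w := by
    intro L hm hc w q
    have hs : ∀ (c : ℂ) r, L (c • r) = c • L r := by
      intro c r; rw [Algebra.smul_def, hm, hc, Algebra.smul_def]; ring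
    let D : Derivation ℂ LR LR := Derivation.mk' { toFun := L, map_add' := map_add L, map_smul' := hs } hm
    have := Derivation.map_aeval D q w
    rw [smul_eq_mul] at this
    exact this
  have iy : ι y = τ ((d * a : ℕ) : ℤ) * Polynomial.aeval ζ p := h.iota_y d a b
  have idz : ι (dz p z) = Polynomial.aeval ζ (Polynomial.derivative p) := by
    rw [dz, ← Polynomial.aeval_algHom_apply, iz]
  have hDx : ∀ f, ι (h.Dx f) = τ (-((d * a : ℕ) : ℤ) + ((a + b : ℕ) : ℤ)) * LD (ι f) := by
    intro f
    refine h.ext_der ι (f := fun f => ι (h.Dx f)) (g := fun f => τ (-((d * a : ℕ) : ℤ) + ((a + b : ℕ) : ℤ)) * LD (ι f)) ?_ ?_ ?_ ?_ ?_ ?_ ?_ ?_ ?_ f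
    · intros; simp
    · intros; simp only [map_add, mul_add]
    · intros; simp
    · intros; simp only [map_mul, LD_mul]; ring
    · intros; simp
    · intros; simp only [AlgHom.commutes, LD_const, mul_zero]
    · simp only [h.Dx_x, map_zero]; rw [ix, hDT, mul_zero]
    · simp only [h.Dx_y]; rw [idz, iy, LD_mul, hDT, chain LD LD_mul LD_const, hDz, hτ, LaurentPolynomial.T_add]
      have t1 := tt ((d * a : ℕ) : ℤ)
      have t2 := tt ((a + b : ℕ) : ℤ)
      rw [hτ] at t1 t2
      linear_combination (exp := 1) (-(Polynomial.aeval ζ (Polynomial.derivative p) * LaurentPolynomial.T (-((a + b : ℕ) : ℤ)) * LaurentPolynomial.T (((a + b : ℕ) : ℤ)))) * t1 - Polynomial.aeval ζ (Polynomial.derivative p) * t2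
    · simp only [h.Dx_z]; rw [ix, iz, hDz, hτ, ← LaurentPolynomial.T_add]; congr 1; ring
  have hDzz : ∀ f, ((d * a : ℕ) : LR) * ι (h.Dz f) = ((a + b : ℕ) : LR) * LaurentPolynomial.C Polynomial.X * LD (ι f) - LEu (ι f) := by
    intro f
    refine h.ext_der ι (f := fun f => ((d * a : ℕ) : LR) * ι (h.Dz f)) (g := fun f => ((a + b : ℕ) : LR) * LaurentPolynomial.C Polynomial.X * LD (ι f) - LEu (ι f)) ?_ ?_ ?_ ?_ ?_ ?_ ?_ ?_ ?_ f
    · intros; simp only [map_add, mul_add]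
    · intros; simp only [map_add, mul_add]; ring
    · intros; simp only [Derivation.leibniz, map_add, map_mul, smul_eq_mul]; ring
    · intros; simp only [map_mul, LD_mul, LEu_mul]; ring
    · intros; simp
    · intros; simp only [AlgHom.commutes, LD_const, LEu_const, mul_zero, sub_zero]
    · simp only [h.Dz_x, map_neg]; rw [ix, hDT, hET]; simp [-neg_mul, -mul_neg]; ring
    · simp only [h.Dz_y]; rw [iy, LD_mul, LEu_mul, hDT, hET, chain LD LD_mul LD_const, chain LEu LEu_mul LEu_const, hDz, hEz, hζ]
      simp only [zsmul_eq_mul, Int.cast_neg, Int.cast_natCast]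
      ring
    · simp only [h.Dz_z]; rw [iz, hDz, hEz, hζ]; simp; ring
  have hx : ι x * (((d * a : ℕ) : ℂ) • ι (h.ad f g)) = ι x * (τ ((a + b : ℕ) : ℤ) * LBr (ι f) (ι g)) := by
    have e1 := congrArg ι (h.x_mul_ad f g)
    rw [map_mul, map_sub, map_mul, map_mul] at e1
    have e2 : ((d * a : ℕ) : ℂ) • ι (h.ad f g) = ((d * a : ℕ) : LR) * ι (h.ad f g) := by
      rw [Algebra.smul_def]; simp
    rw [e2]
    have e3 := hDzz f
    have e4 := hDzz g
    rw [hDx, hDx] at e1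
    rw [hτ, LaurentPolynomial.T_add] at e1
    rw [LBr]
    rw [ix] at e1 ⊢
    rw [hτ] at e1 ⊢
    linear_combination ((d * a : ℕ) : LR) * e1 + LaurentPolynomial.T (-((d * a : ℕ) : ℤ)) * LaurentPolynomial.T (((a + b : ℕ) : ℤ)) * (LD (ι f) * e4 - LD (ι g) * e3)
  rw [ix] at hx
  exact (LaurentPolynomial.isUnit_T _).mul_left_cancel hx

end P4

open MvPolynomial
open scoped TensorProduct

section P5
set_option linter.all false
set_option linter.unusedSectionVars false

variable {p : Polynomial ℂ} {d : ℕ} {B : Type} [CommRing B] [Algebra ℂ B] {x y z : B}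

def XType (p : Polynomial ℂ) (X : B) : Prop := ∃ Y Z, IsCoord p X Y Z

theorem IsCoord.lead_ad (h : IsCoord p x y z) (hp : Good p d) (a b : ℕ) (ha : 1 ≤ a) {f g : B}
    {M N : ℤ} {φ ψ : Polynomial ℂ} (hf : Lead (h.iota d a b f) M φ) (hg : Lead (h.iota d a b g) N ψ) :
    Lead (h.iota d a b (h.ad f g)) (M + N - (a + b : ℕ)) (((d * a : ℕ) : ℂ)⁻¹ •
      ((M : ℂ) • (φ * Polynomial.derivative ψ) - (N : ℂ) • (Polynomial.derivative φ * ψ))) := by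
  have h0 : ((d * a : ℕ) : ℂ) ≠ 0 := by
    have := hp.two
    have : d * a ≠ 0 := by positivity
    exact_mod_cast this
  have h1 := h.iota_br hp a b f g
  have h2 : h.iota d a b (h.ad f g) = ((d * a : ℕ) : ℂ)⁻¹ • (LaurentPolynomial.T ((a + b : ℕ) : ℤ) * LBr (h.iota d a b f) (h.iota d a b g)) := by
    rw [← h1, inv_smul_smul₀ h0]
  rw [h2]
  refine Lead.smul _ ?_
  have h3 := (Lead.const 1 (-((a + b : ℕ) : ℤ))).mul (hf.br hg)
  simp only [map_one, one_mul, neg_neg] at h3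
  convert h3 using 1
  ring

theorem root_lemma (h : IsCoord p x y z) (hp : Good p d) {X : B} (hX : XType p X) (a b : ℕ) (ha : 1 ≤ a)
    {M : ℤ} {φ φ₁ : Polynomial ℂ} (hM : Lead (h.iota d a b X) M φ) (ρ : ℂ) (n : ℕ) (hn : 1 ≤ n)
    (hφ : φ = (Polynomial.X - Polynomial.C ρ) ^ n * φ₁) (hφ₁ : φ₁.eval ρ ≠ 0) :
    M < n * (a + b : ℕ) := by
  by_contra hcon
  rw [not_lt] at hcon
  obtain ⟨Y, Z, h'⟩ := hX
  obtain ⟨j, hj, hD, -⟩ := h.jac h' hp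
  obtain ⟨n, rfl⟩ : ∃ n', n = n' + 1 := ⟨n - 1, by omega⟩
  have h0 : ((d * a : ℕ) : ℂ) ≠ 0 := by
    have := hp.two
    have : d * a ≠ 0 := by positivity
    exact_mod_cast this
  have key : ∀ k : ℕ, ∃ ψ₁ : Polynomial ℂ, ψ₁.eval ρ ≠ 0 ∧
      Lead (h.iota d a b ((h.ad X)^[k] x)) ((d * a : ℕ) + k * (M - (a + b : ℕ)))
        ((Polynomial.X - Polynomial.C ρ) ^ (k * n) * ψ₁) := by
    intro k
    induction k with
    | zero => exact ⟨1, by simp, by simpa using h.lead_x d a b⟩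
    | succ k ih =>
      obtain ⟨ψ₁, h1, h2⟩ := ih
      rw [Function.iterate_succ_apply']
      have h3 := h.lead_ad hp a b ha hM h2
      set N : ℤ := (d * a : ℕ) + k * (M - (a + b : ℕ)) with hN
      set L := Polynomial.X - Polynomial.C ρ with hL
      have hLd : Polynomial.derivative L = 1 := by simp [hL]
      have hpow : ∀ m : ℕ, L * Polynomial.derivative (L ^ m) = (m : Polynomial ℂ) * L ^ m := by
        intro m
        rcases m with _ | m
        · simp
        · rw [Polynomial.derivative_pow, hLd]; simp; ring
      refine ⟨((d * a : ℕ) : ℂ)⁻¹ • ((((M : ℂ) * (k * n : ℕ) - N * (n + 1 : ℕ)) • (φ₁ * ψ₁)) +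
        L * ((M : ℂ) • (φ₁ * Polynomial.derivative ψ₁) - (N : ℂ) • (Polynomial.derivative φ₁ * ψ₁))), ?_, ?_⟩
      · have hz : M * (k * n : ℕ) - N * (n + 1 : ℕ) < 0 := by
          have e : M * (k * n : ℕ) - N * (n + 1 : ℕ) = -(k * (M - (n + 1 : ℕ) * (a + b : ℕ))) - (n + 1) * (d * a : ℕ) := by
            rw [hN]; push_cast; ring
          rw [e]
          have e1 : (0:ℤ) ≤ k * (M - (n + 1 : ℕ) * (a + b : ℕ)) := by
            apply mul_nonneg (by positivity); linarith
          have e2 : (0 : ℤ) < (n + 1) * (d * a : ℕ) := by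
            have := hp.two
            positivity
          linarith
        have hz' : (M : ℂ) * (k * n : ℕ) - N * (n + 1 : ℕ) ≠ 0 := by
          have := ne_of_lt hz
          exact_mod_cast this
        simp only [hL, Polynomial.eval_smul, Polynomial.eval_add, Polynomial.eval_mul, Polynomial.eval_sub, Polynomial.eval_X, Polynomial.eval_C, sub_self, zero_mul, add_zero, smul_eq_mul]
        exact mul_ne_zero (inv_ne_zero h0) (mul_ne_zero hz' (mul_ne_zero hφ₁ h1))
      · convert h3 using 1
        · rw [hN]; push_cast; ring
        · rw [mul_smul_comm]
          congr 1
          have e1 : L * Polynomial.derivative (L ^ (k * n) * ψ₁) = L ^ (k * n) * ((k * n : ℕ) * ψ₁ + L * Polynomial.derivative ψ₁) := by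
            rw [Polynomial.derivative_mul, mul_add, ← mul_assoc, hpow]; ring
          have e2 : Polynomial.derivative φ = L ^ n * ((n + 1 : ℕ) * φ₁ + L * Polynomial.derivative φ₁) := by
            rw [hφ, Polynomial.derivative_mul, Polynomial.derivative_pow_succ, hLd]; 
            simp; ring
          have e3 : φ * Polynomial.derivative (L ^ (k * n) * ψ₁) = L ^ n * φ₁ * (L ^ (k * n) * ((k * n : ℕ) * ψ₁ + L * Polynomial.derivative ψ₁)) := by
            rw [hφ, ← e1]; ring
          rw [e2, e3]
          simp only [Polynomial.smul_eq_C_mul]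
          simp only [map_sub, map_mul, map_natCast, map_intCast]
          push_cast
          ring
  obtain ⟨m, hm⟩ := h'.Dx_ln x
  have e : ∀ k b, (h.ad X)^[k] b = j ^ k • (h'.Dx)^[k] b := by
    intro k
    induction k with
    | zero => intro b; simp
    | succ k ih =>
      intro b
      rw [Function.iterate_succ_apply', ih, Function.iterate_succ_apply', hD, Derivation.map_smul, smul_smul, pow_succ']
  obtain ⟨ψ₁, h1, h2⟩ := key m
  rw [e, hm m le_rfl, smul_zero, map_zero] at h2
  have h3 := h2.unique (Lead.zero _)
  have hL : (Polynomial.X - Polynomial.C ρ) ^ (m * n) ≠ 0 := pow_ne_zero _ (Polynomial.X_sub_C_ne_zero ρ)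
  rcases mul_eq_zero.mp h3 with h4 | h4
  · exact hL h4
  · rw [h4] at h1; simp at h1

theorem edge_single {c : ℕ × ℕ →₀ ℂ} {a b : ℕ} {u : ℕ × ℕ}
    (hmax : ∀ v ∈ c.support, v ≠ u → a * v.1 + b * v.2 < a * u.1 + b * u.2) :
    edge c a b (a * u.1 + b * u.2) = c u • Polynomial.X ^ u.2 := by
  rw [edge, Finset.sum_eq_single u]
  · simp
  · intro v hv hvu
    rw [if_neg (hmax v hv hvu).ne]
  · intro hu; simp [Finsupp.notMem_support_iff.mp hu]

theorem pure_half (h : IsCoord p x y z) (hp : Good p d) {X : B} (hX : XType p X) {c : ℕ × ℕ →₀ ℂ}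
    (hc : CRep d x y z X c) {a b : ℕ} (ha : 1 ≤ a) {u : ℕ × ℕ} (hu : u ∈ c.support)
    (hmax : ∀ v ∈ c.support, v ≠ u → a * v.1 + b * v.2 < a * u.1 + b * u.2) (ht : 1 ≤ u.2) : u.1 < u.2 := by
  have h1 := hc.lead h hp a b ha (a * u.1 + b * u.2) (by
    intro v hv
    by_cases hvu : v = u
    · rw [hvu]
    · exact (hmax v hv hvu).le)
  rw [edge_single hmax] at h1
  have h2 := root_lemma h hp hX a b ha h1 0 u.2 ht (φ₁ := Polynomial.C (c u)) (by
    rw [Polynomial.smul_eq_C_mul, Polynomial.C_0, sub_zero, mul_comm]) (by simpa using hu)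
  have h3 : a * u.1 + b * u.2 < u.2 * (a + b) := by exact_mod_cast h2
  have : a * u.1 < a * u.2 := by nlinarith
  exact Nat.lt_of_mul_lt_mul_left this

theorem mem_swap_supp {c : ℕ × ℕ →₀ ℂ} {u : ℕ × ℕ} :
    u ∈ (c.equivMapDomain (Equiv.prodComm ℕ ℕ)).support ↔ u.swap ∈ c.support := by simp

theorem pure_lex (h : IsCoord p x y z) (hp : Good p d) {X : B} (hX : XType p X) {c : ℕ × ℕ →₀ ℂ}
    (hc : CRep d x y z X c) {a b α β : ℕ} (ha : 1 ≤ a + α) (hb : 1 ≤ b + β) {u : ℕ × ℕ} (hu : u ∈ c.support)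
    (hmax : ∀ v ∈ c.support, v ≠ u → a * v.1 + b * v.2 < a * u.1 + b * u.2 ∨
      (a * v.1 + b * v.2 = a * u.1 + b * u.2 ∧ α * v.1 + β * v.2 < α * u.1 + β * u.2)) :
    u.1 = 0 ∨ u.2 = 0 := by
  obtain ⟨N, hN⟩ : ∃ N, ∀ v ∈ c.support, α * v.1 + β * v.2 < N :=
    ⟨c.support.sup (fun v => α * v.1 + β * v.2) + 1, fun v hv =>
      Nat.lt_succ_of_le (Finset.le_sup (f := fun v : ℕ × ℕ => α * v.1 + β * v.2) hv)⟩
  have hN1 : 1 ≤ N := by have := hN u hu; omega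
  have key : ∀ v ∈ c.support, v ≠ u → (N * a + α) * v.1 + (N * b + β) * v.2 < (N * a + α) * u.1 + (N * b + β) * u.2 := by
    intro v hv hvu
    have e : ∀ w : ℕ × ℕ, (N * a + α) * w.1 + (N * b + β) * w.2 = N * (a * w.1 + b * w.2) + (α * w.1 + β * w.2) := by
      intro w; ring
    rw [e, e]
    have := hN v hv
    rcases hmax v hv hvu with h1 | ⟨h1, h2⟩
    · have : N * (a * v.1 + b * v.2 + 1) ≤ N * (a * u.1 + b * u.2) := Nat.mul_le_mul_left _ h1
      nlinarith
    · rw [h1]; omega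
  have h1 : 1 ≤ N * a + α := by nlinarith [Nat.zero_le (N * a), mul_le_mul_of_nonneg_right hN1 (Nat.zero_le a)]
  have h2 : 1 ≤ N * b + β := by nlinarith [mul_le_mul_of_nonneg_right hN1 (Nat.zero_le b)]
  by_contra hcon
  push Not at hcon
  have k1 := pure_half h hp hX hc h1 hu key (by omega)
  have k2 := pure_half h.swap hp hX hc.swap h2 (u := u.swap) (b := N * a + α) (by simpa using hu) (by
    intro v hv hvu
    have := key v.swap (mem_swap_supp.mp hv) (by rintro rfl; simp at hvu)
    simp only [Prod.fst_swap, Prod.snd_swap] at this ⊢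
    omega) (by simp; omega)
  simp at k2
  omega

theorem IsCoord.exists_pi (h : IsCoord p x y z) : ∃ F : B →ₐ[ℂ] Polynomial ℂ, F x = 1 ∧ F y = p ∧ F z = Polynomial.X :=
  h.lift _ _ _ _ (by simp)

noncomputable def IsCoord.pi (h : IsCoord p x y z) : B →ₐ[ℂ] Polynomial ℂ := h.exists_pi.choose
theorem IsCoord.pi_x (h : IsCoord p x y z) : h.pi x = 1 := h.exists_pi.choose_spec.1
theorem IsCoord.pi_y (h : IsCoord p x y z) : h.pi y = p := h.exists_pi.choose_spec.2.1
theorem IsCoord.pi_z (h : IsCoord p x y z) : h.pi z = Polynomial.X := h.exists_pi.choose_spec.2.2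

noncomputable def IsCoord.dv (h : IsCoord p x y z) (X : B) : ℕ := (h.pi X).natDegree
noncomputable def IsCoord.du (h : IsCoord p x y z) (X : B) : ℕ := (h.swap.pi X).natDegree

theorem IsCoord.pi_cel (h : IsCoord p x y z) (hp : Good p d) {u : ℕ × ℕ} (hu : u ∈ lat d) :
    (h.pi (cel d x y z u)).Monic ∧ (h.pi (cel d x y z u)).natDegree = u.2 := by
  have hd : 0 < d := by have := hp.two; omega
  rcases lat_cases hu with ⟨t, k, rfl⟩ | ⟨t, k, rfl⟩
  · rw [cel_left hd, map_mul, map_pow, map_pow, h.pi_x, h.pi_z]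
    simp [Polynomial.monic_X_pow]
  · rw [cel_right hd, map_mul, map_pow, map_pow, h.pi_y, h.pi_z]
    refine ⟨(hp.monic.pow _).mul (Polynomial.monic_X_pow _), ?_⟩
    rw [(hp.monic.pow _).natDegree_mul (Polynomial.monic_X_pow _), hp.monic.natDegree_pow, hp.deg]
    simp; ring

theorem XType.ne_zero {X : B} (hX : XType p X) (hp : Good p d) : X ≠ 0 := by
  obtain ⟨Y, Z, h⟩ := hX; exact h.x_ne hp

theorem tmax (h : IsCoord p x y z) (hp : Good p d) {X : B} (hX : XType p X) {c : ℕ × ℕ →₀ ℂ}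
    (hc : CRep d x y z X c) : (∀ u ∈ c.support, u.2 ≤ h.dv X) ∧
      (1 ≤ h.dv X → (0, h.dv X) ∈ c.support ∧ ∀ u ∈ c.support, u.2 = h.dv X → u = (0, h.dv X)) := by
  have hc0 : c ≠ 0 := by rintro rfl; exact hX.ne_zero hp (by rw [hc.1]; simp)
  have hpi : h.pi X = ∑ u ∈ c.support, c u • h.pi (cel d x y z u) := by
    nth_rewrite 1 [hc.1]; rw [Finsupp.sum, map_sum]; simp
  -- lexicographic maximum
  obtain ⟨N, hN⟩ : ∃ N, ∀ v ∈ c.support, v.1 < N :=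
    ⟨c.support.sup (fun v => v.1) + 1, fun v hv =>
      Nat.lt_succ_of_le (Finset.le_sup (f := fun v : ℕ × ℕ => v.1) hv)⟩
  obtain ⟨u, hu, hmax⟩ := CRep.exists_max hc0 1 N
  have hlt : ∀ v ∈ c.support, v.2 ≤ u.2 := by
    intro v hv
    have h1 := hmax v hv
    have h2 := hN u hu
    by_contra hcon
    have : N * (u.2 + 1) ≤ N * v.2 := Nat.mul_le_mul_left _ (by omega)
    nlinarith
  have hpure := pure_lex h hp hX hc (a := 0) (b := 1) (α := 1) (β := 0) (by omega) (by omega) hu (by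
    intro v hv hvu
    have h1 := hmax v hv
    have h2 := hlt v hv
    rcases lt_or_eq_of_le h2 with h3 | h3
    · left; omega
    · right
      rw [h3] at h1
      refine ⟨by omega, ?_⟩
      have : v.1 ≠ u.1 := fun h4 => hvu (Prod.ext h4 h3)
      omega)
  rcases Nat.eq_zero_or_pos u.2 with h0 | h0
  · have : h.dv X = 0 := by
      rw [IsCoord.dv, hpi]
      apply Nat.le_zero.mp
      refine Polynomial.natDegree_sum_le_of_forall_le _ _ fun v hv => ?_
      refine (Polynomial.natDegree_smul_le _ _).trans ?_
      rw [(h.pi_cel hp (hc.2 v hv)).2]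
      have := hlt v hv; omega
    rw [this]
    exact ⟨fun v hv => by have := hlt v hv; omega, by omega⟩
  · have hu1 : u.1 = 0 := by omega
    have huniq : ∀ v ∈ c.support, v.2 = u.2 → v = u := by
      intro v hv h2
      have := hmax v hv
      rw [h2] at this
      exact Prod.ext (by omega) h2
    have hcoef : (h.pi X).coeff u.2 = c u := by
      rw [hpi, Polynomial.finsetSum_coeff, Finset.sum_eq_single u]
      · have h1 := h.pi_cel hp (hc.2 u hu)
        have h2 : (h.pi (cel d x y z u)).coeff u.2 = 1 := by
          rw [← h1.2]; exact h1.1.coeff_natDegree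
        rw [Polynomial.coeff_smul, h2]; simp
      · intro v hv hvu
        rw [Polynomial.coeff_smul, Polynomial.coeff_eq_zero_of_natDegree_lt, smul_zero]
        rw [(h.pi_cel hp (hc.2 v hv)).2]
        have := hlt v hv
        have : v.2 ≠ u.2 := fun h4 => hvu (huniq v hv h4)
        omega
      · intro h1; exact absurd hu h1
    have hdv : h.dv X = u.2 := by
      apply le_antisymm
      · rw [IsCoord.dv, hpi]
        refine Polynomial.natDegree_sum_le_of_forall_le _ _ fun v hv => ?_
        refine (Polynomial.natDegree_smul_le _ _).trans ?_
        rw [(h.pi_cel hp (hc.2 v hv)).2]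
        exact hlt v hv
      · apply Polynomial.le_natDegree_of_ne_zero
        rw [hcoef]; exact Finsupp.mem_support_iff.mp hu
    have hu' : u = (0, h.dv X) := Prod.ext hu1 hdv.symm
    rw [hdv]
    refine ⟨hlt, fun _ => ⟨?_, ?_⟩⟩
    · rw [← hdv, ← hu']; exact hu
    · intro v hv h2; rw [huniq v hv h2]; exact Prod.ext hu1 rfl

theorem smax (h : IsCoord p x y z) (hp : Good p d) {X : B} (hX : XType p X) {c : ℕ × ℕ →₀ ℂ}
    (hc : CRep d x y z X c) : (∀ u ∈ c.support, u.1 ≤ h.du X) ∧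
      (1 ≤ h.du X → (h.du X, 0) ∈ c.support ∧ ∀ u ∈ c.support, u.1 = h.du X → u = (h.du X, 0)) := by
  obtain ⟨h1, h2⟩ := tmax h.swap hp hX hc.swap
  refine ⟨fun u hu => ?_, fun h3 => ⟨?_, fun u hu hu1 => ?_⟩⟩
  · exact h1 u.swap (mem_swap_supp.mpr (by simpa using hu))
  · exact mem_swap_supp.mp (h2 h3).1
  · have := (h2 h3).2 u.swap (mem_swap_supp.mpr (by simpa using hu)) hu1
    exact congrArg Prod.swap this

theorem dvd_dv (h : IsCoord p x y z) (hp : Good p d) {X : B} (hX : XType p X) : d ∣ h.dv X := by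
  obtain ⟨c, hc⟩ := h.exists_rep hp X
  rcases Nat.eq_zero_or_pos (h.dv X) with h0 | h0
  · rw [h0]; exact dvd_zero _
  · have := hc.2 _ ((tmax h hp hX hc).2 h0).1
    simp only [lat, Set.mem_setOf_eq] at this
    have h2 : (d : ℤ) ∣ (h.dv X : ℤ) := by
      have := (dvd_neg.mpr this)
      simpa using this
    exact_mod_cast h2

theorem dv_zero (h : IsCoord p x y z) (hp : Good p d) {X : B} (hX : XType p X) (h0 : h.dv X = 0) :
    ∃ g : Polynomial ℂ, X = Polynomial.aeval x g := by
  have hd : 0 < d := by have := hp.two; omega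
  obtain ⟨c, hc⟩ := h.exists_rep hp X
  have h1 := (tmax h hp hX hc).1
  have : X ∈ Algebra.adjoin ℂ {x} := by
    rw [hc.1, Finsupp.sum]
    refine Subalgebra.sum_mem _ fun u hu => Subalgebra.smul_mem _ ?_ _
    have h2 := h1 u hu
    rw [h0] at h2
    have h3 : u.2 = 0 := by omega
    simp only [cel, h3, Nat.zero_sub, Nat.zero_div, pow_zero, mul_one, Nat.min_zero]
    exact Subalgebra.pow_mem _ (Algebra.subset_adjoin (by simp)) _
  rw [Algebra.adjoin_singleton_eq_range_aeval] at this
  obtain ⟨g, hg⟩ := this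
  exact ⟨g, hg.symm⟩

theorem lt_rep (h : IsCoord p x y z) (hp : Good p d) {X : B} (hX : XType p X) {c : ℕ × ℕ →₀ ℂ}
    (hc : CRep d x y z X c) (hlt : h.du X < h.dv X) :
    ∀ u ∈ c.support, u ≠ (0, h.dv X) → u.1 + u.2 < h.dv X := by
  have hc0 : c ≠ 0 := by rintro rfl; exact hX.ne_zero hp (by rw [hc.1]; simp)
  obtain ⟨s1, -⟩ := smax h hp hX hc
  obtain ⟨t1, t2⟩ := tmax h hp hX hc
  obtain ⟨t2, -⟩ := t2 (by omega)
  -- weights N(s+t)+s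
  set N := h.du X + 1 with hN
  obtain ⟨u, hu, hmax⟩ := CRep.exists_max hc0 (N + 1) N
  have hle : ∀ v ∈ c.support, v.1 + v.2 ≤ u.1 + u.2 := by
    intro v hv
    have h1 := hmax v hv
    have h2 := s1 u hu
    by_contra hcon
    have : N * (u.1 + u.2 + 1) ≤ N * (v.1 + v.2) := Nat.mul_le_mul_left _ (by omega)
    nlinarith
  have hle2 : ∀ v ∈ c.support, v.1 + v.2 = u.1 + u.2 → v.1 ≤ u.1 := by
    intro v hv hvu
    have h1 := hmax v hv
    have : N * (v.1 + v.2) = N * (u.1 + u.2) := by rw [hvu]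
    nlinarith
  have hpure := pure_lex h hp hX hc (a := 1) (b := 1) (α := 1) (β := 0) (by omega) (by omega) hu (by
    intro v hv hvu
    rcases lt_or_eq_of_le (hle v hv) with h3 | h3
    · left; omega
    · right
      have := hle2 v hv h3
      refine ⟨by omega, ?_⟩
      have : v.1 ≠ u.1 := fun h4 => hvu (Prod.ext h4 (by omega))
      omega)
  have h3 := hle _ t2
  have h4 := s1 u hu
  have h5 := t1 u hu
  simp only at h3
  have h6 : u.1 = 0 := by omega
  intro v hv hv0
  have h7 := hle v hv
  rcases lt_or_eq_of_le h7 with h8 | h8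
  · omega
  · exfalso
    have := hle2 v hv h8
    apply hv0
    exact Prod.ext (by simp; omega) (by simp; omega)

theorem lead_lt (h : IsCoord p x y z) (hp : Good p d) {X : B} (hX : XType p X) (hlt : h.du X < h.dv X) :
    ∃ c : ℂ, c ≠ 0 ∧ Lead (h.iota d 1 1 X) (h.dv X) (c • Polynomial.X ^ (h.dv X)) := by
  obtain ⟨c, hc⟩ := h.exists_rep hp X
  have h1 := lt_rep h hp hX hc hlt
  have hmem := ((tmax h hp hX hc).2 (by omega)).1
  have h2 := hc.lead h hp 1 1 le_rfl (h.dv X) (by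
    intro u hu
    by_cases hu0 : u = (0, h.dv X)
    · rw [hu0]; simp
    · have := h1 u hu hu0; omega)
  have h3 := edge_single (c := c) (a := 1) (b := 1) (u := (0, h.dv X)) (by
    intro v hv hv0
    have := h1 v hv hv0
    simp only; omega)
  simp only [mul_zero, one_mul, zero_add] at h3
  rw [h3] at h2
  exact ⟨_, Finsupp.mem_support_iff.mp hmem, h2⟩

theorem lead_gt (h : IsCoord p x y z) (hp : Good p d) {X : B} (hX : XType p X) (hlt : h.dv X < h.du X) :
    ∃ c : ℂ, c ≠ 0 ∧ Lead (h.iota d 1 1 X) (h.du X) (Polynomial.C c) := by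
  obtain ⟨c, hc⟩ := h.exists_rep hp X
  have h0 := lt_rep h.swap hp hX hc.swap hlt
  have h1 : ∀ u ∈ c.support, u ≠ (h.du X, 0) → u.1 + u.2 < h.du X := by
    intro u hu hu0
    have := h0 u.swap (mem_swap_supp.mpr (by simpa using hu)) (by
      intro h2; apply hu0; exact congrArg Prod.swap h2)
    simp only [Prod.fst_swap, Prod.snd_swap] at this
    rw [add_comm]; exact this
  have hmem := ((smax h hp hX hc).2 (by omega)).1
  have h2 := hc.lead h hp 1 1 le_rfl (h.du X) (by
    intro u hu
    by_cases hu0 : u = (h.du X, 0)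
    · rw [hu0]; simp
    · have := h1 u hu hu0; omega)
  have h3 := edge_single (c := c) (a := 1) (b := 1) (u := (h.du X, 0)) (by
    intro v hv hv0
    have := h1 v hv hv0
    simp only; omega)
  simp only [mul_zero, one_mul, add_zero] at h3
  rw [h3] at h2
  exact ⟨_, Finsupp.mem_support_iff.mp hmem, by simpa [Polynomial.smul_eq_C_mul] using h2⟩

end P5

open MvPolynomial
open scoped TensorProduct

section P6
set_option linter.all false
set_option linter.unusedSectionVars false

variable {p : Polynomial ℂ} {d : ℕ} {B : Type} [CommRing B] [Algebra ℂ B] {x y z : B}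

noncomputable def LT1 : LRˣ := ⟨LaurentPolynomial.T 1, LaurentPolynomial.T (-1),
  by rw [← LaurentPolynomial.T_add]; simp, by rw [← LaurentPolynomial.T_add]; simp⟩

theorem LT1_zpow (n : ℤ) : ((LT1 ^ n : LRˣ) : LR) = LaurentPolynomial.T n := by
  have h1 : ∀ n : ℕ, ((LT1 ^ n : LRˣ) : LR) = LaurentPolynomial.T n := by
    intro n
    rw [Units.val_pow_eq_pow_val]
    change (LaurentPolynomial.T 1 : LR) ^ n = _
    rw [LaurentPolynomial.T_pow]; simp
  have h2 : ∀ n : ℕ, ((LT1⁻¹ ^ n : LRˣ) : LR) = LaurentPolynomial.T (-n) := by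
    intro n
    rw [Units.val_pow_eq_pow_val]
    change (LaurentPolynomial.T (-1) : LR) ^ n = _
    rw [LaurentPolynomial.T_pow]; simp
  obtain ⟨k, rfl | rfl⟩ := n.eq_nat_or_neg
  · rw [zpow_natCast, h1]
  · rw [zpow_neg, zpow_natCast, ← inv_pow, h2]

noncomputable def LMap (θ : Polynomial ℂ →+* Polynomial ℂ) : LR →+* LR :=
  LaurentPolynomial.eval₂ ((LaurentPolynomial.C : Polynomial ℂ →+* LR).comp θ) LT1

theorem LMap_C (θ : Polynomial ℂ →+* Polynomial ℂ) (φ : Polynomial ℂ) :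
    LMap θ (LaurentPolynomial.C φ) = LaurentPolynomial.C (θ φ) := by
  rw [LMap, LaurentPolynomial.eval₂_C]; rfl

theorem LMap_T (θ : Polynomial ℂ →+* Polynomial ℂ) (n : ℤ) :
    LMap θ (LaurentPolynomial.T n) = LaurentPolynomial.T n := by
  rw [LMap, LaurentPolynomial.eval₂_T, LT1_zpow]

theorem LMap_toLaurent (θ : Polynomial ℂ →+* Polynomial ℂ) (g : Polynomial (Polynomial ℂ)) :
    LMap θ (Polynomial.toLaurent g) = Polynomial.toLaurent (g.map θ) := by
  induction g using Polynomial.induction_on' with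
  | add f g hf hg => simp [hf, hg]
  | monomial n a =>
    rw [← Polynomial.C_mul_X_pow_eq_monomial]
    simp [LMap_C, LMap_T, Polynomial.toLaurent_X_pow]

theorem Lead.lmap {r : LR} {N : ℤ} {φ : Polynomial ℂ} (h : Lead r N φ) (θ : Polynomial ℂ →+* Polynomial ℂ) :
    Lead (LMap θ r) N (θ φ) := by
  obtain ⟨g, rfl, rfl⟩ := h
  exact ⟨g.map θ, by rw [map_mul, LMap_T, LMap_toLaurent], by simp⟩

theorem IsCoord.ext_dom (h : IsCoord p x y z) {T : Type} [CommRing T] [IsDomain T] {F G : B →+* T}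
    (hc : ∀ c : ℂ, F (algebraMap ℂ B c) = G (algebraMap ℂ B c))
    (hx : F x = G x) (hx0 : G x ≠ 0) (hz : F z = G z) (b : B) : F b = G b := by
  refine h.ext_ring hc hx ?_ hz b
  apply mul_left_cancel₀ hx0
  rw [← map_mul, ← hx, ← map_mul, h.rel, Polynomial.aeval_def, Polynomial.hom_eval₂, Polynomial.hom_eval₂, hz]
  congr 1
  ext c
  exact hc c

theorem one_root {φ : Polynomial ℂ} {J : ℕ} (hJ : 1 ≤ J) (hdeg : φ.natDegree = J)
    (hr : ∀ ρ (n : ℕ) (φ₁ : Polynomial ℂ), 1 ≤ n → φ = (Polynomial.X - Polynomial.C ρ) ^ n * φ₁ → φ₁.eval ρ ≠ 0 → J < 2 * n) :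
    ∃ ρ lam : ℂ, lam ≠ 0 ∧ φ = Polynomial.C lam * (Polynomial.X - Polynomial.C ρ) ^ J := by
  have hφ : φ ≠ 0 := by rintro rfl; simp at hdeg; omega
  have hs : φ.Splits := IsAlgClosed.splits φ
  have hcard := hs.natDegree_eq_card_roots
  have hroot : ∀ ρ ∈ φ.roots, J < 2 * φ.roots.count ρ := by
    intro ρ hρ
    obtain ⟨g, hg, hnd⟩ := Polynomial.exists_eq_pow_rootMultiplicity_mul_and_not_dvd φ hφ ρ
    rw [Polynomial.count_roots]
    refine hr ρ _ g ?_ hg ?_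
    · exact (Polynomial.rootMultiplicity_pos hφ).mpr (Polynomial.isRoot_of_mem_roots hρ)
    · intro h0; exact hnd (Polynomial.dvd_iff_isRoot.mpr h0)
  obtain ⟨ρ, hρ⟩ := Multiset.card_pos_iff_exists_mem.mp (by omega : 0 < φ.roots.card)
  have hall : ∀ τ ∈ φ.roots, τ = ρ := by
    intro τ hτ
    by_contra hne
    have h1 := hroot _ hρ
    have h2 := hroot _ hτ
    have h3 : Multiset.count ρ φ.roots + Multiset.count τ φ.roots ≤ φ.roots.card := by
      have : Multiset.replicate (Multiset.count ρ φ.roots) ρ + Multiset.replicate (Multiset.count τ φ.roots) τ ≤ φ.roots := by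
        rw [Multiset.le_iff_count]
        intro a
        rw [Multiset.count_add, Multiset.count_replicate, Multiset.count_replicate]
        split_ifs with h4 h5 h6
        · exact absurd (h5.trans h4.symm) hne
        · rw [h4]; omega
        · rw [h6]; omega
        · omega
      have := Multiset.card_le_card this
      simpa using this
    omega
  refine ⟨ρ, φ.leadingCoeff, by simpa using hφ, ?_⟩
  have h1 := hs.eq_prod_roots
  rw [Multiset.eq_replicate_card.mpr hall, ← hcard, hdeg] at h1
  nth_rewrite 1 [h1]
  simp

theorem IsCoord.dv_shift (h : IsCoord p x y z) (ρ : ℂ) (l : ℕ) {y' : B} (h' : IsCoord p x y' (z - ρ • x ^ l)) (X : B) :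
    h'.dv X = h.dv X := by
  have e : h.pi X = (h'.pi X).comp (Polynomial.X - Polynomial.C ρ) := by
    have := h'.ext_dom (F := h.pi.toRingHom) (G := (Polynomial.compRingHom (Polynomial.X - Polynomial.C ρ)).comp h'.pi.toRingHom)
      (by intro c; simp) (by simp [h.pi_x, h'.pi_x]) (by simp [h'.pi_x]) (by
        have := h'.pi_z
        simp [h.pi_x, h.pi_z, this, -map_sub, Polynomial.smul_eq_C_mul]
        simp [h.pi_x, h.pi_z, Polynomial.smul_eq_C_mul]) X
    simpa using this
  rw [IsCoord.dv, IsCoord.dv, e, Polynomial.natDegree_comp]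
  simp

theorem reduce (h : IsCoord p x y z) (hp : Good p d) {X : B} (hX : XType p X) (hJ : 1 ≤ h.dv X) (hle : h.dv X ≤ h.du X) :
    ∃ (l e : ℕ) (ρ lam : ℂ), lam ≠ 0 ∧ ρ ≠ 0 ∧ d * l = 1 + e ∧ h.du X = h.dv X * e ∧
      Lead (h.iota d 1 e X) (h.du X) (Polynomial.C lam * (Polynomial.X - Polynomial.C ρ) ^ (h.dv X)) ∧
      ∀ y' (h' : IsCoord p x y' (z - ρ • x ^ l)), h'.dv X = h.dv X ∧ h'.du X < h.du X := by
  obtain ⟨c, hc⟩ := h.exists_rep hp X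
  have hc0 : c ≠ 0 := by rintro rfl; exact hX.ne_zero hp (by rw [hc.1]; simp)
  obtain ⟨s1, s2⟩ := smax h hp hX hc
  obtain ⟨t1, t2⟩ := tmax h hp hX hc
  obtain ⟨t2, t3⟩ := t2 hJ
  obtain ⟨s2, s3⟩ := s2 (by omega)
  have hdJ := dvd_dv h hp hX
  set J := h.dv X with hJdef
  set I := h.du X with hIdef
  -- lex max
  set N := J + 1 with hN
  obtain ⟨u, hu, hmax⟩ := CRep.exists_max hc0 (N * J) (N * I + 1)
  have hle1 : ∀ v ∈ c.support, J * v.1 + I * v.2 ≤ J * u.1 + I * u.2 := by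
    intro v hv
    have h1 := hmax v hv
    have h2 := t1 u hu
    by_contra hcon
    have : N * (J * u.1 + I * u.2 + 1) ≤ N * (J * v.1 + I * v.2) := Nat.mul_le_mul_left _ (by omega)
    nlinarith
  have hle2 : ∀ v ∈ c.support, J * v.1 + I * v.2 = J * u.1 + I * u.2 → v.2 ≤ u.2 := by
    intro v hv hvu
    have h1 := hmax v hv
    have : N * (J * v.1 + I * v.2) = N * (J * u.1 + I * u.2) := by rw [hvu]
    nlinarith
  have hpure := pure_lex h hp hX hc (a := J) (b := I) (α := 0) (β := 1) (by omega) (by omega) hu (by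
    intro v hv hvu
    rcases lt_or_eq_of_le (hle1 v hv) with h3 | h3
    · left; exact h3
    · right
      have h4 := hle2 v hv h3
      refine ⟨h3, ?_⟩
      have : v.2 ≠ u.2 := fun h5 => hvu (Prod.ext (by rw [h5] at h3; exact Nat.eq_of_mul_eq_mul_left hJ (by omega)) h5)
      omega)
  have hM : ∀ v ∈ c.support, J * v.1 + I * v.2 ≤ I * J := by
    intro v hv
    refine (hle1 v hv).trans ?_
    rcases hpure with h1 | h1
    · rw [h1]; have := Nat.mul_le_mul_left I (t1 u hu); omega
    · rw [h1]; have := Nat.mul_le_mul_left J (s1 u hu); rw [mul_comm I J]; omega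
  have hlead := hc.lead h hp J I hJ (I * J) hM
  set φ := edge c J I (I * J) with hφ
  have k0 : φ.coeff 0 ≠ 0 := by
    rw [hφ, edge_coeff hJ (I, 0) (by simp; ring)]; exact Finsupp.mem_support_iff.mp s2
  have kJ : φ.coeff J ≠ 0 := by
    rw [hφ, edge_coeff hJ (0, J) (by simp)]; exact Finsupp.mem_support_iff.mp t2
  have hdeg : φ.natDegree = J := by
    apply le_antisymm
    · rw [Polynomial.natDegree_le_iff_coeff_eq_zero]
      intro k hk
      by_contra h0
      obtain ⟨v, hv, -, h2⟩ := edge_coeff_ne h0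
      have := t1 v hv
      omega
    · exact Polynomial.le_natDegree_of_ne_zero kJ
  obtain ⟨ρ, lam, hlam, hφ'⟩ := one_root hJ hdeg (by
    intro ρ n φ₁ hn h1 h2
    have h3 := root_lemma h hp hX J I hJ hlead ρ n hn h1 h2
    have h4 : I * J < n * (J + I) := by exact_mod_cast h3
    have h5 : I * J < I * (2 * n) := by nlinarith
    exact Nat.lt_of_mul_lt_mul_left h5)
  have hρ : ρ ≠ 0 := by
    rintro rfl
    apply k0
    rw [hφ']
    have : (0 : ℕ) ≠ J := by omega
    simp [this]
  have k1 : φ.coeff 1 ≠ 0 := by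
    rw [hφ', Polynomial.coeff_C_mul, sub_eq_add_neg, ← Polynomial.C_neg, Polynomial.coeff_X_add_C_pow]
    refine mul_ne_zero hlam (mul_ne_zero (pow_ne_zero _ (neg_ne_zero.mpr hρ)) ?_)
    simp; omega
  obtain ⟨⟨s, t⟩, hv, hv1, hv2⟩ := edge_coeff_ne k1
  simp only at hv1 hv2
  subst hv2
  have hsI := s1 _ hv
  simp only at hsI
  obtain ⟨e, he⟩ : ∃ e, I = s + e := ⟨I - s, by omega⟩
  have hIe : I = J * e := by
    have : J * s + I = (s + e) * J := by rw [← he]; simpa using hv1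
    nlinarith
  have hlat := hc.2 _ hv
  obtain ⟨l, hl⟩ : d ∣ 1 + e := by
    have h1 : (d : ℤ) ∣ (s : ℤ) - 1 := by simpa [lat] using hlat
    have h2 : (d : ℤ) ∣ (J : ℤ) * e := Dvd.dvd.mul_right (by exact_mod_cast hdJ) _
    have h3 : (d : ℤ) ∣ ((1 + e : ℕ) : ℤ) := by
      have h4 : ((1 + e : ℕ) : ℤ) = (J : ℤ) * e - (s - 1) := by
        have : (I : ℤ) = s + e := by exact_mod_cast he
        have h6 : (I : ℤ) = J * e := by exact_mod_cast hIe
        push_cast; linarith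
      rw [h4]; exact dvd_sub h2 h1
    exact_mod_cast h3
  have hM' : ∀ v ∈ c.support, 1 * v.1 + e * v.2 ≤ I := by
    intro v hv
    have h1 := hM v hv
    rw [hIe] at h1 ⊢
    have : J * (1 * v.1 + e * v.2) ≤ J * (J * e) := by nlinarith
    exact Nat.le_of_mul_le_mul_left this hJ
  have hedge : edge c 1 e I = φ := by
    rw [hφ, edge, edge]
    refine Finset.sum_congr rfl fun v _ => ?_
    have : (1 * v.1 + e * v.2 = I) ↔ (J * v.1 + I * v.2 = I * J) := by
      constructor
      · intro h1; rw [hIe] at h1 ⊢; nlinarith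
      · intro h1
        apply Nat.eq_of_mul_eq_mul_left hJ
        rw [mul_comm J I, ← h1]; rw [hIe]; ring
    simp only [this]
  have hlead' := hc.lead h hp 1 e le_rfl I hM'
  rw [hedge, hφ'] at hlead'
  refine ⟨l, e, ρ, lam, hlam, hρ, hl.symm, hIe, hlead', fun y' h' => ⟨h.dv_shift ρ l h' X, ?_⟩⟩
  -- new lead
  set θ : Polynomial ℂ →+* Polynomial ℂ := Polynomial.compRingHom (Polynomial.X + Polynomial.C ρ) with hθ
  have hcomp : LMap θ (h.iota d 1 e X) = h'.iota d 1 e X := by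
    have := h'.ext_dom (F := (LMap θ).comp (h.iota d 1 e).toRingHom) (G := (h'.iota d 1 e).toRingHom)
      (by
        intro a
        simp [LMap_C, hθ]) (by simp [h.iota_x, h'.iota_x, LMap_T]) (by
        simp [h'.iota_x]
        intro h0
        exact (LT1 ^ (-(d:ℤ))).ne_zero ((LT1_zpow _).trans h0)) (by
        have e1 := h'.iota_z d 1 e
        change LMap θ (h.iota d 1 e (z - ρ • x ^ l)) = h'.iota d 1 e (z - ρ • x ^ l)
        rw [e1, map_sub, map_smul, map_pow, h.iota_z, h.iota_x, LaurentPolynomial.T_pow, Algebra.smul_def]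
        have e2 : (l : ℤ) * -((d * 1 : ℕ) : ℤ) = -((1 + e : ℕ) : ℤ) := by
          rw [hl]; push_cast; ring
        rw [e2]
        have e3 : (algebraMap ℂ LR ρ) = LaurentPolynomial.C (Polynomial.C ρ) := by simp
        rw [e3, map_sub, map_mul, map_mul, LMap_C, LMap_C, LMap_T, ← sub_mul, ← map_sub]
        simp [hθ]) X
    exact this
  have hl2 := hlead'.lmap θ
  rw [hcomp] at hl2
  have e4 : θ (Polynomial.C lam * (Polynomial.X - Polynomial.C ρ) ^ J) = lam • Polynomial.X ^ J := by
    simp [hθ, Polynomial.smul_eq_C_mul]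
  rw [e4] at hl2
  obtain ⟨c', hc'⟩ := h'.exists_rep hp X
  have h3 := hc'.of_lead h' hp 1 e le_rfl hl2
  have h3' : ∀ v ∈ c'.support, 1 * v.1 + e * v.2 ≤ I := by
    intro v hv; exact_mod_cast h3 v hv
  have h4 := (hc'.lead h' hp 1 e le_rfl I h3').unique hl2
  rcases Nat.eq_zero_or_pos (h'.du X) with h0 | h0
  · omega
  have h5 := ((smax h' hp hX hc').2 h0).1
  have h6 := h3' _ h5
  simp only [one_mul, mul_zero, add_zero] at h6
  rcases lt_or_eq_of_le h6 with h7 | h7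
  · exact h7
  · exfalso
    have h8 := edge_coeff (c := c') (a := 1) (b := e) (M := I) le_rfl (h'.du X, 0) (by simpa using h7)
    rw [h4] at h8
    have h9 := Finsupp.mem_support_iff.mp h5
    rw [← h8] at h9
    apply h9
    have : (0 : ℕ) ≠ J := by omega
    simp [Polynomial.coeff_X_pow, this]

end P6

open MvPolynomial
open scoped TensorProduct

section P7
set_option linter.all false
set_option linter.unusedSectionVars false

variable {p : Polynomial ℂ} {d : ℕ} {B : Type} [CommRing B] [Algebra ℂ B] {x y z : B} {X Y Z : B}

theorem IsCoord.sub_mem (h : IsCoord p x y z) (b : B) :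
    b - Polynomial.aeval z (h.pi b) ∈ Ideal.span {x - 1} := by
  set Q := Ideal.span {x - 1} with hQ
  have hx : (Ideal.Quotient.mkₐ ℂ Q) x = 1 := by
    rw [← map_one (Ideal.Quotient.mkₐ ℂ Q)]
    exact Ideal.Quotient.eq.mpr (Ideal.subset_span rfl)
  have := h.ext_alg (F := Ideal.Quotient.mkₐ ℂ Q) (G := ((Ideal.Quotient.mkₐ ℂ Q).comp (Polynomial.aeval z)).comp h.pi)
    (by simp only [AlgHom.comp_apply, h.pi_x, hx, map_one]) (by
      simp only [AlgHom.comp_apply, h.pi_y]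
      rw [← h.rel, map_mul, hx, one_mul]) (by simp only [AlgHom.comp_apply, h.pi_z, Polynomial.aeval_X]) b
  exact Ideal.Quotient.eq.mp this

theorem IsCoord.finrank_dv (h : IsCoord p x y z) (X : B) :
    Module.finrank ℂ (B ⧸ (Ideal.span {x - 1, X - 1} : Ideal B)) = h.dv X := by
  set K : Ideal (Polynomial ℂ) := Ideal.span {h.pi X - Polynomial.C 1} with hK
  set F : B →ₐ[ℂ] (Polynomial ℂ ⧸ K) := (Ideal.Quotient.mkₐ ℂ K).comp h.pi with hF
  have hs : Function.Surjective F := by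
    intro q
    obtain ⟨g, rfl⟩ := Ideal.Quotient.mk_surjective q
    refine ⟨Polynomial.aeval z g, ?_⟩
    have : h.pi (Polynomial.aeval z g) = g := by
      rw [← Polynomial.aeval_algHom_apply, h.pi_z, Polynomial.aeval_X_left_apply]
    simp [hF, this]
  have hker : RingHom.ker F = Ideal.span {x - 1, X - 1} := by
    apply le_antisymm
    · intro b hb
      have hb' : h.pi b ∈ K := Ideal.Quotient.eq_zero_iff_mem.mp hb
      obtain ⟨r, hr⟩ := Ideal.mem_span_singleton'.mp hb'
      have h1 := h.sub_mem b
      have h2 := h.sub_mem (Polynomial.aeval z r * (X - 1) - b)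
      have h3 : h.pi (Polynomial.aeval z r * (X - 1) - b) = 0 := by
        rw [map_sub, map_mul, ← Polynomial.aeval_algHom_apply, h.pi_z, Polynomial.aeval_X_left_apply, ← hr]
        simp
      rw [h3, map_zero, sub_zero] at h2
      have h4 : b = Polynomial.aeval z r * (X - 1) - (Polynomial.aeval z r * (X - 1) - b) := by ring
      rw [h4]
      refine Ideal.sub_mem _ (Ideal.mul_mem_left _ _ (Ideal.subset_span (by simp))) ?_
      exact Ideal.span_mono (by simp) h2
    · rw [Ideal.span_le]
      rintro b (rfl | rfl)
      · simp [RingHom.mem_ker, hF, h.pi_x]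
      · change F _ = 0
        have : h.pi (X - 1) ∈ K := Ideal.subset_span (by simp)
        exact Ideal.Quotient.eq_zero_iff_mem.mpr this
  rw [← hker, (Ideal.quotientKerAlgEquivOfSurjective hs).toLinearEquiv.finrank_eq, finrank_quotient_span_eq_natDegree,
    Polynomial.natDegree_sub_C]
  rfl

theorem IsCoord.dv_symm (h : IsCoord p x y z) (h' : IsCoord p X Y Z) : h.dv X = h'.dv x := by
  rw [← h.finrank_dv, ← h'.finrank_dv, Set.pair_comm]

variable {σ : B ≃+* B}

structure SemiInv (σ : B ≃+* B) : Prop where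
  conj : ∀ c : ℂ, σ (algebraMap ℂ B c) = algebraMap ℂ B (starRingEnd ℂ c)
  inv : ∀ b, σ (σ b) = b

theorem IsCoord.dv_semi (h : IsCoord p x y z) (hpr : p.map (starRingEnd ℂ) = p) (hσ : SemiInv σ)
    (b : B) : (h.semi hpr σ hσ.conj).dv (σ b) = h.dv b := by
  have : (h.semi hpr σ hσ.conj).pi (σ b) = (h.pi b).map (starRingEnd ℂ) := by
    have := h.ext_dom (F := ((h.semi hpr σ hσ.conj).pi.toRingHom.comp (σ : B →+* B))) (G := (Polynomial.mapRingHom (starRingEnd ℂ)).comp h.pi.toRingHom)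
      (by intro c; simp [hσ.conj]) (by simp [h.pi_x, (h.semi hpr σ hσ.conj).pi_x]) (by simp [h.pi_x])
      (by simp [h.pi_z, (h.semi hpr σ hσ.conj).pi_z]) b
    exact this
  rw [IsCoord.dv, this, Polynomial.natDegree_map_eq_of_injective (starRingEnd ℂ).injective]; rfl

theorem IsCoord.dv_du (h : IsCoord p x y z) (hpr : p.map (starRingEnd ℂ) = p) (hσ : SemiInv σ) :
    h.dv (σ y) = h.du (σ x) := by
  rw [h.dv_symm (h.semi hpr σ hσ.conj).swap]
  have := h.swap.dv_semi hpr hσ (σ x)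
  rw [hσ.inv] at this
  exact this

theorem dvd_du (h : IsCoord p x y z) (hp : Good p d) (hX : XType p X) : d ∣ h.du X := dvd_dv h.swap hp hX

theorem IsCoord.shift (h : IsCoord p x y z) (ρ : ℂ) (l : ℕ) (hl : 1 ≤ l) : ∃ y', IsCoord p x y' (z - ρ • x ^ l) := by
  obtain ⟨l, rfl⟩ : ∃ k, l = k + 1 := ⟨l - 1, by omega⟩
  obtain ⟨y', hy⟩ := h.tri (-(Polynomial.C ρ * Polynomial.X ^ l))
  refine ⟨y', ?_⟩
  convert hy using 1
  simp [Algebra.smul_def]; ring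

theorem lead_prod (h : IsCoord p x y z) (hp : Good p d) (h' : IsCoord p X Y Z)
    (h1 : h.du X < h.dv X) (h2 : h.dv Y < h.du Y) : h.dv X + h.du Y < d ∨ h.dv X + h.du Y = 2 * d := by
  have hd := hp.two
  have hX : XType p X := ⟨_, _, h'⟩
  have hY : XType p Y := ⟨_, _, h'.swap⟩
  obtain ⟨c1, hc1, l1⟩ := lead_lt h hp hX h1
  obtain ⟨c2, hc2, l2⟩ := lead_gt h hp hY h2
  obtain ⟨j, hj, -, hbr⟩ := h.jac h' hp
  have hb : h.ad X Y = j • dz p Z := by rw [hbr, h'.ad_xx, h'.Dx_y]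
  have lb := h.lead_ad hp 1 1 le_rfl l1 l2
  rw [hb, map_smul] at lb
  have lb2 := lb.smul j⁻¹
  rw [smul_smul, inv_mul_cancel₀ hj, one_smul] at lb2
  have lp := l1.mul l2
  rw [← map_mul, h'.rel] at lp
  set J := h.dv X
  set I := h.du Y
  have hZ0 : Z ≠ 0 := by
    intro h0
    have e1 := h'.pi_z
    have e2 := congrArg h'.pi h0
    rw [map_zero] at e2
    exact Polynomial.X_ne_zero (e1.symm.trans e2)
  obtain ⟨M, φ, hφ, hM⟩ := h.exists_lead hp 1 1 le_rfl hZ0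
  have hpn : (c1 • Polynomial.X ^ J * Polynomial.C c2 : Polynomial ℂ) ≠ 0 := by
    refine mul_ne_zero (smul_ne_zero hc1 (pow_ne_zero _ Polynomial.X_ne_zero)) (by simpa using hc2)
  have hpd : p.natDegree = d := hp.deg
  rcases Nat.eq_zero_or_pos M with hM0 | hM0
  · left
    subst hM0
    have h3 := (hM.of_lt (N' := 1) (by simp)).aeval (by norm_num) p
    rw [hpd, zero_pow (by omega), smul_zero, Polynomial.aeval_algHom_apply] at h3
    by_contra hcon
    have h5 := lp.le_of_ne h3 hpn
    have h6 : ((J : ℤ) + I) = (d : ℤ) * 1 := by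
      have : (d : ℤ) ≤ J + I := by exact_mod_cast not_lt.mp hcon
      omega
    rw [h6] at lp
    exact hpn (lp.unique h3)
  · right
    have h3 := hM.aeval (by exact_mod_cast hM0) p
    rw [Polynomial.aeval_algHom_apply, hpd, hp.monic.leadingCoeff, one_smul] at h3
    have h4 := lp.eq_of_ne h3 hpn (pow_ne_zero _ hφ)
    have h5 := hM.aeval (by exact_mod_cast hM0) (Polynomial.derivative p)
    have hdd : (Polynomial.derivative p).natDegree = d - 1 := by rw [Polynomial.natDegree_derivative, hpd]
    rw [Polynomial.aeval_algHom_apply, hdd] at h5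
    have hlc : (Polynomial.derivative p).leadingCoeff ≠ 0 := by
      rw [Polynomial.leadingCoeff_ne_zero]; rintro h0; rw [h0] at hdd; simp at hdd; omega
    have h6 := lb2.eq_of_ne h5 (by
      refine smul_ne_zero (inv_ne_zero hj) (smul_ne_zero (inv_ne_zero (by simp; omega)) ?_)
      simp only [Polynomial.derivative_C, mul_zero, smul_zero, zero_sub, Polynomial.derivative_smul, Polynomial.derivative_X_pow]
      refine neg_ne_zero.mpr (smul_ne_zero (by simp; omega) (mul_ne_zero (smul_ne_zero hc1 (mul_ne_zero ?_ (pow_ne_zero _ Polynomial.X_ne_zero))) (by simpa using hc2)))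
      simp; omega) (smul_ne_zero hlc (pow_ne_zero _ hφ))
    obtain ⟨d', rfl⟩ : ∃ d', d = d' + 1 := ⟨d - 1, by omega⟩
    rw [Nat.add_sub_cancel] at h6
    push_cast at h4 h6
    have : (M : ℤ) = 2 := by linarith
    rw [this] at h4
    have : (J : ℤ) + I = 2 * (d' + 1) := by linarith
    exact_mod_cast this

theorem fix_coord (h0 : IsCoord p X Y Z) (hp : Good p d) (hpr : p.map (starRingEnd ℂ) = p) (hσ : SemiInv σ) :
    ∃ x y z, IsCoord p x y z ∧ ((∃ g : Polynomial ℂ, σ x = Polynomial.aeval x g) ∨ (∃ g : Polynomial ℂ, σ x = Polynomial.aeval y g)) := by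
  classical
  have hd := hp.two
  let P : ℕ → Prop := fun n => ∃ (x y z : B) (h : IsCoord p x y z), h.dv (σ x) = n
  have hP : ∃ n, P n := ⟨_, _, _, _, h0, rfl⟩
  let P2 : ℕ → Prop := fun k => ∃ (x y z : B) (h : IsCoord p x y z), h.dv (σ x) = Nat.find hP ∧ h.du (σ x) = k
  have hP2 : ∃ n, P2 n := by
    obtain ⟨x, y, z, h, h1⟩ := Nat.find_spec hP
    exact ⟨_, x, y, z, h, h1, rfl⟩
  obtain ⟨x, y, z, h, h1, h2⟩ := Nat.find_spec hP2
  have hs := h.semi hpr σ hσ.conj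
  have hX : XType p (σ x) := ⟨_, _, hs⟩
  refine ⟨x, y, z, h, ?_⟩
  rcases Nat.eq_zero_or_pos (h.dv (σ x)) with hJ | hJ
  · left; exact dv_zero h hp hX hJ
  rcases Nat.eq_zero_or_pos (h.du (σ x)) with hI | hI
  · right; exact dv_zero h.swap hp hX hI
  exfalso
  rcases le_or_gt (h.dv (σ x)) (h.du (σ x)) with hle | hlt
  · obtain ⟨l, e, ρ, lam, -, -, hl, -, -, hr⟩ := reduce h hp hX hJ hle
    obtain ⟨y', h'⟩ := h.shift ρ l (by rcases l with _ | l <;> omega)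
    obtain ⟨r1, r2⟩ := hr y' h'
    have := Nat.find_min hP2 (m := h'.du (σ x)) (by omega)
    exact this ⟨_, _, _, h', by omega, rfl⟩
  · have hI2 : h.dv (σ x) ≤ h.du (σ y) := by
      rw [h1]; exact Nat.find_min' hP ⟨_, _, _, h.swap, rfl⟩
    have h3 := h.dv_du hpr hσ
    have h4 := lead_prod h hp hs hlt (by omega)
    obtain ⟨k, hk⟩ := dvd_dv h hp hX
    obtain ⟨k', hk'⟩ := dvd_du h hp hX
    have : 2 * d ≤ h.dv (σ x) := by
      rw [hk] at hlt ⊢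
      rw [hk'] at hlt hI
      have h5 : k' < k := Nat.lt_of_mul_lt_mul_left hlt
      have h6 : 0 < k' := Nat.pos_of_mul_pos_left hI
      nlinarith
    omega

end P7

open MvPolynomial
open scoped TensorProduct

section P8
set_option linter.all false
set_option linter.unusedSectionVars false

variable {p : Polynomial ℂ} {d : ℕ} {B : Type} [CommRing B] [Algebra ℂ B] {x y z : B} {X Y Z : B}

theorem aeval_eq_comp' (g q : Polynomial ℂ) : Polynomial.aeval q g = g.comp q := rfl

theorem affine_p (hp : Good p d) {γ g : ℂ} (hγ : γ ≠ 0)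
    (hdvd : p ∣ p.comp (Polynomial.C γ * Polynomial.X + Polynomial.C g)) :
    g = 0 ∧ p.comp (Polynomial.C γ * Polynomial.X) = Polynomial.C (γ ^ d) * p := by
  have hd := hp.two
  set L := Polynomial.C γ * Polynomial.X + Polynomial.C g with hL
  have hLd : L.natDegree = 1 := Polynomial.natDegree_linear hγ
  have hLl : L.leadingCoeff = γ := Polynomial.leadingCoeff_linear hγ
  have h1 := Polynomial.eq_leadingCoeff_mul_of_monic_of_dvd_of_natDegree_le hp.monic hdvd (by
    rw [Polynomial.natDegree_comp, hLd, mul_one])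
  rw [Polynomial.leadingCoeff_comp (by omega), hLl, hp.monic.leadingCoeff, hp.deg, one_mul] at h1
  have h2 : p.comp L = (Polynomial.taylor g p).comp (Polynomial.C γ * Polynomial.X) := by
    rw [Polynomial.taylor_apply, Polynomial.comp_assoc]; congr 1; simp [hL]
  have h3 : Polynomial.hasseDeriv (d - 1) p = Polynomial.C (d : ℂ) * Polynomial.X := by
    ext k
    rw [Polynomial.hasseDeriv_coeff, Polynomial.coeff_C_mul]
    rcases k with _ | _ | k
    · simp [hp.red]
    · have e : 0 + 1 + (d - 1) = d := by omega
      have e2 : p.coeff d = 1 := by rw [← hp.deg]; exact hp.monic.coeff_natDegree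
      rw [e, e2]
      have : d.choose (d - 1) = d := by
        rw [Nat.choose_symm (by omega : 1 ≤ d), Nat.choose_one_right]
      rw [this]; simp
    · rw [Polynomial.coeff_eq_zero_of_natDegree_lt (by rw [hp.deg]; omega)]
      simp [Polynomial.coeff_X]
  have h4 := congrArg (fun f => Polynomial.coeff f (d - 1)) h1
  simp only [h2, Polynomial.comp_C_mul_X_coeff, Polynomial.taylor_coeff, h3, Polynomial.coeff_C_mul, hp.red] at h4
  have hg : g = 0 := by
    have hd0 : (d : ℂ) ≠ 0 := by simp; omega
    simpa [hγ, hd0] using h4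
  refine ⟨hg, ?_⟩
  rw [← h1, hL, hg]; simp

theorem IsCoord.aeval_x_inj (h : IsCoord p x y z) (hp : Good p d) : Function.Injective (Polynomial.aeval x : Polynomial ℂ →ₐ[ℂ] B) := by
  rw [injective_iff_map_eq_zero]
  intro g hg
  have h1 := congrArg h.swap.pi hg
  rw [map_zero, ← Polynomial.aeval_algHom_apply, h.swap.pi_y] at h1
  have h2 : g.comp p = 0 := by rw [← aeval_eq_comp'] ; exact h1
  rcases Polynomial.comp_eq_zero_iff.mp h2 with h3 | ⟨-, h3⟩
  · exact h3
  · have := hp.deg; rw [h3] at this; simp at this; have := hp.two; omega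

theorem IsCoord.ker_Dx (h : IsCoord p x y z) (hp : Good p d) {W : B} (hW : h.Dx W = 0) :
    ∃ g : Polynomial ℂ, W = Polynomial.aeval x g := by
  by_cases hW0 : W = 0
  · exact ⟨0, by simp [hW0]⟩
  have hd : 0 < d := by have := hp.two; omega
  obtain ⟨c, hc⟩ := h.exists_rep hp W
  have hc0 : c ≠ 0 := by rintro rfl; exact hW0 (by rw [hc.1]; simp)
  obtain ⟨N, hN⟩ : ∃ N, ∀ v ∈ c.support, v.1 < N :=
    ⟨c.support.sup (fun v => v.1) + 1, fun v hv =>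
      Nat.lt_succ_of_le (Finset.le_sup (f := fun v : ℕ × ℕ => v.1) hv)⟩
  obtain ⟨u, hu, hmax⟩ := CRep.exists_max hc0 1 N
  have hlt : ∀ v ∈ c.support, v.2 ≤ u.2 := by
    intro v hv
    have h1 := hmax v hv
    have h2 := hN u hu
    by_contra hcon
    have : N * (u.2 + 1) ≤ N * v.2 := Nat.mul_le_mul_left _ (by omega)
    nlinarith
  have hl := hc.lead h hp 1 N le_rfl _ hmax
  have h1 := h.lead_ad hp 1 N le_rfl (h.lead_x d 1 N) hl
  rw [h.ad_xx, hW, map_zero] at h1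
  have h2 := h1.unique (Lead.zero _)
  have hdc : ((d * 1 : ℕ) : ℂ) ≠ 0 := by simp; omega
  have h3 : Polynomial.derivative (edge c 1 N (1 * u.1 + N * u.2)) = 0 := by
    rcases smul_eq_zero.mp h2 with h3 | h3
    · exact absurd h3 (inv_ne_zero hdc)
    · simp only [one_mul, Polynomial.derivative_one, zero_mul, smul_zero, sub_zero] at h3
      rcases smul_eq_zero.mp h3 with h4 | h4
      · exact absurd h4 (by exact_mod_cast hdc)
      · simpa using h4
  have h4 := Polynomial.natDegree_eq_zero_of_derivative_eq_zero h3
  have h5 : u.2 = 0 := by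
    have := Polynomial.le_natDegree_of_ne_zero (p := edge c 1 N (1 * u.1 + N * u.2)) (n := u.2) (by
      rw [edge_coeff le_rfl u rfl]; exact Finsupp.mem_support_iff.mp hu)
    omega
  have : W ∈ Algebra.adjoin ℂ {x} := by
    rw [hc.1, Finsupp.sum]
    refine Subalgebra.sum_mem _ fun u hu => Subalgebra.smul_mem _ ?_ _
    have h2 := hlt u hu
    have h3 : u.2 = 0 := by omega
    simp only [cel, h3, Nat.zero_sub, Nat.zero_div, pow_zero, mul_one, Nat.min_zero]
    exact Subalgebra.pow_mem _ (Algebra.subset_adjoin (by simp)) _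
  rw [Algebra.adjoin_singleton_eq_range_aeval] at this
  obtain ⟨g, hg⟩ := this
  exact ⟨g, hg.symm⟩

theorem endA (h : IsCoord p x y z) (h' : IsCoord p X Y Z) (hp : Good p d) {g₀ : Polynomial ℂ}
    (hX : X = Polynomial.aeval x g₀) : ∃ (α γ : ℂ) (G : Polynomial ℂ), α ≠ 0 ∧ γ ≠ 0 ∧ X = α • x ∧
      Z = γ • z + x * Polynomial.aeval x G ∧ p.comp (Polynomial.C γ * Polynomial.X) = Polynomial.C (γ ^ d) * p := by
  have hd := hp.two
  have hdom := h.isDomain hp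
  have hXT : XType p X := ⟨_, _, h'⟩
  have hxT : XType p x := ⟨_, _, h⟩
  have h1 : h.dv X = 0 := by
    have : h.pi X = Polynomial.C (g₀.eval 1) := by
      rw [hX, ← Polynomial.aeval_algHom_apply, h.pi_x, ← map_one (algebraMap ℂ (Polynomial ℂ)), Polynomial.aeval_algebraMap_apply]
      simp [Polynomial.aeval_def]
    rw [IsCoord.dv, this]; simp
  rw [h.dv_symm h'] at h1
  obtain ⟨g₁, hg₁⟩ := dv_zero h' hp hxT h1
  have h2 : g₁.comp g₀ = Polynomial.X := by
    apply h.aeval_x_inj hp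
    rw [Polynomial.aeval_comp, ← hX, ← hg₁]; simp
  have h3 : g₀.natDegree = 1 := by
    have := congrArg Polynomial.natDegree h2
    rw [Polynomial.natDegree_comp, Polynomial.natDegree_X] at this
    exact Nat.eq_one_of_mul_eq_one_left this
  obtain ⟨α, hα, β, hg₀⟩ := Polynomial.natDegree_eq_one.mp h3
  have hX' : X = α • x + algebraMap ℂ B β := by
    rw [hX, ← hg₀]; simp [Algebra.smul_def]
  -- hom to AdjoinRoot
  have hroot : ∀ {x y z : B} (h : IsCoord p x y z), ∃ F : B →ₐ[ℂ] AdjoinRoot p, F x = 0 ∧ F z = AdjoinRoot.root p := by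
    intro x y z h
    obtain ⟨F, f1, f2, f3⟩ := h.lift (AdjoinRoot p) 0 0 (AdjoinRoot.root p) (by
      rw [AdjoinRoot.aeval_eq, AdjoinRoot.mk_self, zero_mul])
    exact ⟨F, f1, f3⟩
  have hβ : β = 0 := by
    by_contra hβ
    set μ := -β / α with hμ
    have hμ0 : μ ≠ 0 := div_ne_zero (neg_ne_zero.mpr hβ) hα
    have hsc := h.scale (inv_ne_zero hμ0)
    have e1 : X = (-β) • (μ⁻¹ • x - 1) := by
      rw [hX', smul_sub, smul_smul, sub_eq_add_neg, ← neg_smul, Algebra.algebraMap_eq_smul_one]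
      congr 2
      · rw [hμ]; field_simp
      · ring
    have e2 : hsc.pi X = 0 := by rw [e1, map_smul, map_sub, hsc.pi_x]; simp
    have e3 : p.comp (hsc.pi Z) = 0 := by
      rw [← aeval_eq_comp', Polynomial.aeval_algHom_apply, ← h'.rel, map_mul, e2, zero_mul]
    rcases Polynomial.comp_eq_zero_iff.mp e3 with e4 | ⟨-, e4⟩
    · exact hp.monic.ne_zero e4
    · have e5 := hsc.sub_mem Z
      rw [e4] at e5
      obtain ⟨b, hb⟩ := Ideal.mem_span_singleton'.mp e5
      obtain ⟨F, f1, f2⟩ := hroot h'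
      have e6 := congrArg F hb
      have e7 : F (μ⁻¹ • x - 1) = 0 := by
        rw [e1, map_smul] at f1
        exact (smul_eq_zero.mp f1).resolve_left (neg_ne_zero.mpr hβ)
      rw [map_mul, e7, mul_zero, map_sub, f2, Polynomial.aeval_C, AlgHom.commutes] at e6
      have e8 : AdjoinRoot.mk p (Polynomial.X - Polynomial.C ((hsc.pi Z).coeff 0)) = 0 := by
        rw [map_sub, AdjoinRoot.mk_X, AdjoinRoot.mk_C]; exact e6.symm
      have e9 := Polynomial.natDegree_le_of_dvd (AdjoinRoot.mk_eq_zero.mp e8) (Polynomial.X_sub_C_ne_zero _)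
      rw [Polynomial.natDegree_X_sub_C, hp.deg] at e9
      omega
  have hXx : X = α • x := by rw [hX', hβ]; simp
  obtain ⟨j, hj, hD, -⟩ := h.jac h' hp
  have h4 : h.Dx Z = j • x := by
    have e1 := hD Z
    rw [h'.Dx_z, h.ad_antisymm hp, hXx, Derivation.map_smul, ← smul_neg, ← h.ad_antisymm hp, h.ad_xx, smul_comm] at e1
    exact smul_right_injective _ hα e1
  have h5 : h.Dx (Z - j • z) = 0 := by rw [map_sub, Derivation.map_smul, h.Dx_z, h4, sub_self]
  obtain ⟨G, hG⟩ := h.ker_Dx hp h5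
  have hZ : Z = j • z + Polynomial.aeval x G := by rw [← hG]; ring
  obtain ⟨F, f1, f2⟩ := hroot h
  have h6 : F Z = AdjoinRoot.mk p (Polynomial.C j * Polynomial.X + Polynomial.C (G.coeff 0)) := by
    rw [hZ, map_add, map_smul, f2, ← Polynomial.aeval_algHom_apply, f1, map_add, map_mul, AdjoinRoot.mk_C, AdjoinRoot.mk_X, AdjoinRoot.mk_C, Algebra.smul_def]
    congr 1
    rw [← Polynomial.coeff_zero_eq_aeval_zero']; rfl
  have h7 : p ∣ p.comp (Polynomial.C j * Polynomial.X + Polynomial.C (G.coeff 0)) := by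
    rw [← AdjoinRoot.mk_eq_zero]
    have e1 := congrArg F h'.rel
    rw [map_mul, hXx, map_smul, f1, smul_zero, zero_mul, ← Polynomial.aeval_algHom_apply, h6] at e1
    rw [← aeval_eq_comp', e1]
    exact (Polynomial.aeval_algHom_apply (AdjoinRoot.mkₐ p) _ p).symm
  obtain ⟨h8, h9⟩ := affine_p hp hj h7
  refine ⟨α, j, G.divX, hα, hj, hXx, ?_, h9⟩
  nth_rewrite 1 [hZ]
  nth_rewrite 1 [← Polynomial.divX_mul_X_add G]
  rw [h8]
  simp; ring

variable {σ : B ≃+* B}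

theorem SemiInv.smul (hσ : SemiInv σ) (c : ℂ) (b : B) : σ (c • b) = starRingEnd ℂ c • σ b := by
  rw [Algebra.smul_def, map_mul, hσ.conj, ← Algebra.smul_def]

theorem SemiInv.aeval (hσ : SemiInv σ) (b : B) (g : Polynomial ℂ) :
    σ (Polynomial.aeval b g) = Polynomial.aeval (σ b) (g.map (starRingEnd ℂ)) := by
  have := Polynomial.hom_eval₂ g (algebraMap ℂ B) (σ : B →+* B) b
  rw [Polynomial.aeval_def, Polynomial.aeval_def, Polynomial.eval₂_map]
  refine this.trans ?_
  congr 1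
  ext c; exact hσ.conj c

theorem conj_mul_one {w : ℂ} (h : (starRingEnd ℂ w) * w * ((starRingEnd ℂ w) * w) = 1) : (starRingEnd ℂ w) * w = 1 := by
  rw [← Complex.normSq_eq_conj_mul_self] at h ⊢
  have h1 : Complex.normSq w * Complex.normSq w = 1 := by exact_mod_cast h
  have h2 := Complex.normSq_nonneg w
  have : Complex.normSq w = 1 := by nlinarith
  rw [this]; simp

def T1 (p : Polynomial ℂ) (σ : B ≃+* B) (x y z : B) (γ : ℂ) : Prop := IsCoord p x y z ∧ σ x = x ∧ σ z = γ • z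
def T0 (p : Polynomial ℂ) (σ : B ≃+* B) (x y z : B) (γ α : ℂ) : Prop := IsCoord p x y z ∧ σ x = α • y ∧ σ z = γ • z

theorem endB (h₀ : IsCoord p X Y Z) (hp : Good p d) (hpr : p.map (starRingEnd ℂ) = p) (hσ : SemiInv σ) :
    (∃ x y z γ, T1 p σ x y z γ) ∨ (∃ x y z γ α, T0 p σ x y z γ α) := by
  obtain ⟨x, y, z, h, h1⟩ := fix_coord h₀ hp hpr hσ
  have hd := hp.two
  rcases h1 with ⟨g, hg⟩ | ⟨g, hg⟩
  · left
    obtain ⟨α, -, -, hα, -, h1, -, -⟩ := endA h (h.semi hpr σ hσ.conj) hp hg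
    obtain ⟨w, hw⟩ : ∃ w : ℂ, w * w = α := by
      obtain ⟨w, hw⟩ := IsAlgClosed.exists_pow_nat_eq α (n := 2) (by norm_num)
      exact ⟨w, by rw [← hw]; ring⟩
    have hw0 : w ≠ 0 := by rintro rfl; simp at hw; exact hα hw.symm
    have hαα : starRingEnd ℂ α * α = 1 := by
      have e1 := hσ.inv x
      rw [h1, hσ.smul, h1, smul_smul] at e1
      have e2 := congrArg h.pi e1
      rw [map_smul, h.pi_x] at e2
      have := congrArg (fun f => Polynomial.eval 0 f) e2
      simpa using this
    have hww : starRingEnd ℂ w * w = 1 := by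
      apply conj_mul_one
      rw [← hαα, ← hw, map_mul]; ring
    have hx : σ (w • x) = w • x := by
      rw [hσ.smul, h1, smul_smul, ← hw, ← mul_assoc, hww, one_mul]
    have h2 := h.scale hw0
    generalize w • x = x' at hx h2
    generalize w⁻¹ • y = y' at h2
    obtain ⟨-, γ, G, -, hγ, -, hz, -⟩ := endA h2 (h2.semi hpr σ hσ.conj) hp (g₀ := Polynomial.X) (by simp [hx])
    have hγγ : starRingEnd ℂ γ * γ = 1 := by
      have e1 := hσ.inv z
      rw [hz, map_add, hσ.smul, hz, map_mul, hx, hσ.aeval, hx, smul_add, smul_smul] at e1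
      have e2 := congrArg h2.pi e1
      simp only [map_add, map_smul, map_mul, h2.pi_x, h2.pi_z, ← Polynomial.aeval_algHom_apply, one_mul] at e2
      have e3 : ∀ g : Polynomial ℂ, Polynomial.aeval (1 : Polynomial ℂ) g = Polynomial.C (g.eval 1) := by
        intro g
        rw [← map_one (algebraMap ℂ (Polynomial ℂ)), Polynomial.aeval_algebraMap_apply]
        simp [Polynomial.aeval_def]
      rw [e3, e3] at e2
      have := congrArg (fun f => Polynomial.coeff f 1) e2
      simpa [Polynomial.coeff_one, Polynomial.coeff_C] using this
    obtain ⟨y'', h3⟩ := h2.tri (Polynomial.C (γ⁻¹ / 2) * G)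
    refine ⟨x', y'', _, γ, h3, hx, ?_⟩
    have e : z + x' * Polynomial.aeval x' (Polynomial.C (γ⁻¹ / 2) * G) = (2⁻¹ : ℂ) • z + (γ⁻¹ / 2) • σ z := by
      rw [hz, smul_add, smul_smul, div_mul_eq_mul_div, inv_mul_cancel₀ hγ, ← add_assoc, ← add_smul]
      norm_num
      rw [Algebra.smul_def]; ring
    rw [e, map_add, hσ.smul, hσ.smul, hσ.inv, smul_add, smul_smul, smul_smul, add_comm]
    have e1 : starRingEnd ℂ γ = γ⁻¹ := eq_inv_of_mul_eq_one_left hγγ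
    congr 2
    · rw [map_div₀, map_inv₀, e1, inv_inv, map_ofNat]; ring
    · rw [map_inv₀, map_ofNat]; field_simp
  · right
    obtain ⟨α, γ, G, hα, hγ, h1, hz, -⟩ := endA h.swap (h.semi hpr σ hσ.conj) hp hg
    have hα' : starRingEnd ℂ α ≠ 0 := by simpa using hα
    have hy : σ y = (starRingEnd ℂ α)⁻¹ • x := by
      have e1 := hσ.inv x
      rw [h1, hσ.smul] at e1
      rw [← e1, smul_smul, inv_mul_cancel₀ hα', one_smul]
    have hG : G = 0 := by
      by_contra hG
      have e1 := hσ.inv z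
      rw [hz, map_add, hσ.smul, hz, map_mul, hσ.aeval, hy, smul_add, smul_smul] at e1
      have e2 := congrArg h.pi e1
      simp only [map_add, map_smul, map_mul, h.pi_x, h.pi_y, h.pi_z, ← Polynomial.aeval_algHom_apply] at e2
      have e3 : ∀ (g : Polynomial ℂ) (c : ℂ), Polynomial.aeval (c • 1 : Polynomial ℂ) g = Polynomial.C (g.eval c) := by
        intro g c
        rw [← Algebra.algebraMap_eq_smul_one, Polynomial.aeval_algebraMap_apply]
        simp [Polynomial.aeval_def]
      rw [e3, aeval_eq_comp'] at e2
      have e4 : p * G.comp p = Polynomial.C (starRingEnd ℂ γ)⁻¹ * (Polynomial.C (1 - starRingEnd ℂ γ * γ) * Polynomial.X - Polynomial.C ((starRingEnd ℂ α)⁻¹ * (G.map (starRingEnd ℂ)).eval (starRingEnd ℂ α)⁻¹)) := by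
        have hγ' : starRingEnd ℂ γ ≠ 0 := by simpa using hγ
        have : Polynomial.C (starRingEnd ℂ γ) * (p * G.comp p) = (Polynomial.C (1 - starRingEnd ℂ γ * γ) * Polynomial.X - Polynomial.C ((starRingEnd ℂ α)⁻¹ * (G.map (starRingEnd ℂ)).eval (starRingEnd ℂ α)⁻¹)) := by
          simp only [Polynomial.smul_eq_C_mul, mul_one] at e2
          rw [map_sub, map_mul, map_mul, map_one]
          rw [map_mul] at e2
          linear_combination e2
        rw [← this, ← mul_assoc, ← Polynomial.C_mul, inv_mul_cancel₀ hγ']; simp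
      have e5 : (p * G.comp p).natDegree ≤ 1 := by
        rw [e4]; compute_degree
      have hGp : G.comp p ≠ 0 := by
        intro h0
        rcases Polynomial.comp_eq_zero_iff.mp h0 with h3 | ⟨-, h3⟩
        · exact hG h3
        · have := hp.deg; rw [h3] at this; simp at this; omega
      rw [Polynomial.natDegree_mul hp.monic.ne_zero hGp, hp.deg] at e5
      omega
    rw [hG] at hz
    exact ⟨x, y, z, γ, α, h, h1, by simpa using hz⟩

end P8

open MvPolynomial
open scoped TensorProduct

section P9
set_option linter.all false
set_option linter.unusedSectionVars false

variable {p : Polynomial ℂ} {d : ℕ} {B : Type} [CommRing B] [Algebra ℂ B] {x y z : B} {X Y Z : B} {σ : B ≃+* B}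

theorem IsCoord.dv_smul (h : IsCoord p x y z) {a : ℂ} (ha : a ≠ 0) (b : B) : h.dv (a • b) = h.dv b := by
  rw [IsCoord.dv, map_smul, Polynomial.smul_eq_C_mul, Polynomial.natDegree_C_mul ha]; rfl

/-- p(γ z) = γ^d p(z) from σ z = γ z -/
theorem sig_xy (h : IsCoord p x y z) (hpr : p.map (starRingEnd ℂ) = p) (hσ : SemiInv σ) {γ : ℂ} (hz : σ z = γ • z) :
    σ x * σ y = Polynomial.aeval z (p.comp (Polynomial.C γ * Polynomial.X)) := by
  rw [← map_mul, h.rel, hσ.aeval, hpr, hz, Polynomial.aeval_comp]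
  simp [Algebra.smul_def]

theorem pi_aeval_x (h : IsCoord p x y z) (g : Polynomial ℂ) : h.pi (Polynomial.aeval x g) = Polynomial.C (g.eval 1) := by
  rw [← Polynomial.aeval_algHom_apply, h.pi_x, ← map_one (algebraMap ℂ (Polynomial ℂ)), Polynomial.aeval_algebraMap_apply]
  simp [Polynomial.aeval_def]

theorem smul_x_inj (h : IsCoord p x y z) {a b : ℂ} (hab : a • x = b • x) : a = b := by
  have := congrArg h.pi hab
  rw [map_smul, map_smul, h.pi_x] at this
  have := congrArg (fun f => Polynomial.eval 0 f) this
  simpa using this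

theorem smul_z_inj (h : IsCoord p x y z) {a b : ℂ} (hab : a • z = b • z) : a = b := by
  have := congrArg h.pi hab
  rw [map_smul, map_smul, h.pi_z] at this
  have := congrArg (fun f => Polynomial.eval 1 f) this
  simpa using this

theorem z_unit (h : IsCoord p x y z) (hσ : SemiInv σ) {γ : ℂ} (hz : σ z = γ • z) : starRingEnd ℂ γ * γ = 1 := by
  have e := hσ.inv z
  rw [hz, hσ.smul, hz, smul_smul] at e
  exact smul_z_inj h (e.trans (one_smul _ _).symm)

/-- z-scaling -/
theorem z_hom (h : IsCoord p x y z) (hp : Good p d) (hpr : p.map (starRingEnd ℂ) = p) (hσ : SemiInv σ) {γ : ℂ}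
    (hz : σ z = γ • z) (hx : (∃ α : ℂ, σ x = α • x) ∨ ∃ α : ℂ, σ x = α • y) :
    p.comp (Polynomial.C γ * Polynomial.X) = Polynomial.C (γ ^ d) * p := by
  have hs := h.semi hpr σ hσ.conj
  have h1 : ∃ c : ℂ, σ z = γ • z := ⟨0, hz⟩
  have key : ∀ {x y : B} (h : IsCoord p x y z) (α : ℂ), σ x = α • x → p.comp (Polynomial.C γ * Polynomial.X) = Polynomial.C (γ ^ d) * p ∨ True := fun _ _ _ => Or.inr trivial
  rcases hx with ⟨α, hα⟩ | ⟨α, hα⟩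
  · obtain ⟨a, δ, G, ha, hδ, e1, e2, e3⟩ := endA h hs hp (g₀ := Polynomial.C α * Polynomial.X) (by rw [hα]; simp [Algebra.smul_def])
    have : γ = δ := by
      rw [hz] at e2
      have e4 := congrArg h.pi e2
      rw [map_add, map_smul, map_smul, h.pi_z, map_mul, h.pi_x, one_mul, pi_aeval_x] at e4
      have := congrArg (fun f => Polynomial.coeff f 1) e4
      simpa [Polynomial.coeff_C] using this
    rw [this]; exact e3
  · obtain ⟨a, δ, G, ha, hδ, e1, e2, e3⟩ := endA h.swap hs hp (g₀ := Polynomial.C α * Polynomial.X) (by rw [hα]; simp [Algebra.smul_def])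
    have : γ = δ := by
      rw [hz] at e2
      have e4 := congrArg h.swap.pi e2
      rw [map_add, map_smul, map_smul, h.swap.pi_z, map_mul, h.swap.pi_x, one_mul, pi_aeval_x h.swap] at e4
      have := congrArg (fun f => Polynomial.coeff f 1) e4
      simpa [Polynomial.coeff_C] using this
    rw [this]; exact e3

theorem T1_y (h : IsCoord p x y z) (hp : Good p d) (hpr : p.map (starRingEnd ℂ) = p) (hσ : SemiInv σ) {γ : ℂ}
    (hx : σ x = x) (hz : σ z = γ • z) : σ y = γ ^ d • y := by
  have hdom := h.isDomain hp
  have e1 := sig_xy h hpr hσ hz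
  rw [z_hom h hp hpr hσ hz (Or.inl ⟨1, by rw [hx, one_smul]⟩), hx, map_mul, ← h.rel, Polynomial.aeval_C] at e1
  apply mul_left_cancel₀ (h.x_ne hp)
  rw [e1, Algebra.smul_def]; ring

theorem fix_scale (hσ : SemiInv σ) {α : ℂ} (hα : starRingEnd ℂ α * α = 1) {b : B} (hb : σ b = α • b) :
    ∃ w : ℂ, w ≠ 0 ∧ σ (w • b) = w • b := by
  obtain ⟨w, hw⟩ : ∃ w : ℂ, w * w = α := by
    obtain ⟨w, hw⟩ := IsAlgClosed.exists_pow_nat_eq α (n := 2) (by norm_num)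
    exact ⟨w, by rw [← hw]; ring⟩
  have hww : starRingEnd ℂ w * w = 1 := by
    apply conj_mul_one
    rw [← hα, ← hw, map_mul]; ring
  refine ⟨w, right_ne_zero_of_mul_eq_one hww, ?_⟩
  rw [hσ.smul, hb, smul_smul, ← hw, ← mul_assoc, hww, one_mul]

theorem T1_swap (h : IsCoord p x y z) (hp : Good p d) (hpr : p.map (starRingEnd ℂ) = p) (hσ : SemiInv σ) {γ : ℂ}
    (hx : σ x = x) (hz : σ z = γ • z) : ∃ w : ℂ, w ≠ 0 ∧ IsCoord p (w • y) (w⁻¹ • x) z ∧ σ (w • y) = w • y := by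
  obtain ⟨w, hw, h1⟩ := fix_scale hσ (α := γ ^ d) (by
    rw [map_pow, ← mul_pow, z_unit h hσ hz, one_pow]) (T1_y h hp hpr hσ hx hz)
  exact ⟨w, hw, h.swap.scale hw, h1⟩

theorem T1_T1_aux (hp : Good p d) (hpr : p.map (starRingEnd ℂ) = p) (hσ : SemiInv σ) {γ' : ℂ}
    (h' : IsCoord p X Y Z) (hX : σ X = X) (hZ : σ Z = γ' • Z) (N : ℕ) : ∀ {x y z : B} {γ : ℂ} 
    (h : IsCoord p x y z) (hx : σ x = x) (hz : σ z = γ • z) (hN : h.dv X + h.du X = N),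
    ∃ δ : ℂ, δ ≠ 0 ∧ starRingEnd ℂ δ * γ = γ' * δ ∧ p.comp (Polynomial.C δ * Polynomial.X) = Polynomial.C (δ ^ d) * p := by
  have hd := hp.two
  have hXT : XType p X := ⟨_, _, h'⟩
  induction N using Nat.strong_induction_on with
  | _ N ih =>
  have main : ∀ {x y z : B} {γ : ℂ} 
    (h : IsCoord p x y z) (hx : σ x = x) (hz : σ z = γ • z) (hN : h.dv X + h.du X = N) (hle : h.dv X ≤ h.du X),
    ∃ δ : ℂ, δ ≠ 0 ∧ starRingEnd ℂ δ * γ = γ' * δ ∧ p.comp (Polynomial.C δ * Polynomial.X) = Polynomial.C (δ ^ d) * p := by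
    intro x y z γ h hx hz hN hle
    rcases Nat.eq_zero_or_pos (h.dv X) with h0 | h0
    · obtain ⟨g, hg⟩ := dv_zero h hp hXT h0
      obtain ⟨a, δ, G, ha, hδ, e1, e2, e3⟩ := endA h h' hp hg
      refine ⟨δ, hδ, ?_, e3⟩
      have e4 := congrArg h.pi hZ
      rw [e2, map_add, hσ.smul, hz, map_mul, hσ.aeval, hx] at e4
      simp only [map_add, map_smul, map_mul, h.pi_x, h.pi_z, pi_aeval_x] at e4
      have := congrArg (fun f => Polynomial.coeff f 1) e4
      simpa [Polynomial.coeff_C] using this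
    · obtain ⟨l, e, ρ, lam, hlam, hρ, hl, hI, hlead, hred⟩ := reduce h hp hXT h0 hle
      set θ : Polynomial ℂ →+* Polynomial ℂ := (Polynomial.compRingHom (Polynomial.C γ * Polynomial.X)).comp (Polynomial.mapRingHom (starRingEnd ℂ)) with hθ
      have hcomp : h.iota d 1 e (σ X) = LMap θ (h.iota d 1 e X) := by
        have := h.ext_dom (F := (h.iota d 1 e).toRingHom.comp (σ : B →+* B)) (G := (LMap θ).comp (h.iota d 1 e).toRingHom)
          (by
            intro a
            simp [LMap_C, hθ, hσ.conj]) (by simp [h.iota_x, hx, LMap_T]) (by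
            simp [h.iota_x, LMap_T]
            intro h0
            exact (LT1 ^ (-(d:ℤ))).ne_zero ((LT1_zpow _).trans h0)) (by
            change h.iota d 1 e (σ z) = LMap θ (h.iota d 1 e z)
            rw [hz, map_smul, h.iota_z, Algebra.smul_def]
            have e3 : (algebraMap ℂ LR γ) = LaurentPolynomial.C (Polynomial.C γ) := by simp
            rw [e3, map_mul, LMap_C, LMap_T, ← mul_assoc, ← map_mul]
            simp [hθ]) X
        exact this
      have hl2 := hlead.lmap θ
      rw [← hcomp, hX] at hl2
      have hu := hlead.unique hl2
      have hργ : starRingEnd ℂ ρ = γ * ρ := by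
        have e4 := congrArg (fun f => Polynomial.eval ρ f) hu
        simp [hθ, h0.ne', hlam] at e4
        exact (sub_eq_zero.mp e4).symm
      obtain ⟨y', h1⟩ := h.shift ρ l (by rcases l with _ | l <;> omega)
      obtain ⟨r1, r2⟩ := hred y' h1
      refine ih _ (by omega) h1 hx ?_ rfl
      rw [map_sub, hz, hσ.smul, map_pow, hx, hργ, smul_sub, smul_smul]
  intro x y z γ h hx hz hN
  rcases le_total (h.dv X) (h.du X) with hle | hle
  · exact main h hx hz hN hle
  · obtain ⟨w, hw, h1, h2⟩ := T1_swap h hp hpr hσ hx hz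
    have e1 : h1.dv X = h.du X := by
      rw [h1.dv_symm h', h'.dv_smul hw, h'.dv_symm h.swap]; rfl
    have e2 : h1.du X = h.dv X := by
      have : h1.swap.dv X = h.dv X := by rw [h1.swap.dv_symm h', h'.dv_smul (inv_ne_zero hw), h'.dv_symm h]
      exact this
    exact main h1 h2 hz (by omega) (by omega)

theorem T1_T1 (hp : Good p d) (hpr : p.map (starRingEnd ℂ) = p) (hσ : SemiInv σ) {γ γ' : ℂ}
    (h : T1 p σ x y z γ) (h' : T1 p σ X Y Z γ') : 
    ∃ δ : ℂ, δ ≠ 0 ∧ starRingEnd ℂ δ * γ = γ' * δ ∧ p.comp (Polynomial.C δ * Polynomial.X) = Polynomial.C (δ ^ d) * p :=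
  T1_T1_aux hp hpr hσ h'.1 h'.2.1 h'.2.2 _ h.1 h.2.1 h.2.2 rfl

theorem T0_dv (h : IsCoord p x y z) (hp : Good p d) (hpr : p.map (starRingEnd ℂ) = p) (hσ : SemiInv σ) {α : ℂ} (hα : α ≠ 0)
    (hx : σ x = α • y) (hX : XType p X) : h.dv (σ X) = h.du X := by
  obtain ⟨Y, Z, h'⟩ := hX
  have hs := h.semi hpr σ hσ.conj
  have e1 := h.dv_semi hpr hσ (σ X)
  rw [hσ.inv, hs.dv_symm h', hx, h'.dv_smul hα, h'.dv_symm h.swap] at e1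
  exact e1.symm

theorem no_diag (h : IsCoord p x y z) (hp : Good p d) (hd : 3 ≤ d) (hX : XType p X) : h.dv X ≠ h.du X := by
  intro he
  rcases Nat.eq_zero_or_pos (h.dv X) with h0 | h0
  · obtain ⟨g, hg⟩ := dv_zero h hp hX h0
    obtain ⟨Y, Z, h'⟩ := hX
    obtain ⟨a, δ, G, ha, hδ, e1, e2, e3⟩ := endA h h' hp hg
    have : h.du X = d := by
      rw [e1]
      have := h.swap.dv_smul ha x
      refine this.trans ?_
      have e := h.swap.pi_y
      rw [IsCoord.dv, e, hp.deg]
    omega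
  · obtain ⟨l, e, ρ, lam, hlam, hρ, hl, hI, hlead, hred⟩ := reduce h hp hX h0 he.le
    have : e = 1 := by
      rw [he] at hI h0
      exact Nat.eq_of_mul_eq_mul_left h0 (by omega)
    subst this
    rcases l with _ | l
    · omega
    · nlinarith

theorem T0_ne (h : IsCoord p x y z) (hp : Good p d) (hσ : SemiInv σ) {α : ℂ} (hx : σ x = α • y) : α ≠ 0 := by
  rintro rfl
  rw [zero_smul] at hx
  exact h.x_ne hp (by simpa using hx)

theorem T0_y (h : IsCoord p x y z) (hp : Good p d) (hσ : SemiInv σ) {α : ℂ} (hx : σ x = α • y) :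
    σ y = (starRingEnd ℂ α)⁻¹ • x := by
  have hα := T0_ne h hp hσ hx
  have hα' : starRingEnd ℂ α ≠ 0 := by simpa using hα
  have e1 := hσ.inv x
  rw [hx, hσ.smul] at e1
  rw [← e1, smul_smul, inv_mul_cancel₀ hα', one_smul]

theorem T1_T0 (hp : Good p d) (hpr : p.map (starRingEnd ℂ) = p) (hσ : SemiInv σ) (hd : 3 ≤ d) {γ γ' α : ℂ}
    (h : T0 p σ x y z γ α) (h' : T1 p σ X Y Z γ') : False := by
  have hX : XType p X := ⟨_, _, h'.1⟩
  have e := T0_dv h.1 hp hpr hσ (T0_ne h.1 hp hσ h.2.1) h.2.1 hX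
  rw [h'.2.1] at e
  exact no_diag h.1 hp hd hX e

theorem T0_T0_aux (hp : Good p d) (hpr : p.map (starRingEnd ℂ) = p) (hσ : SemiInv σ) {γ γ' α α' : ℂ}
    (h : IsCoord p x y z) (hx : σ x = α • y) (hz : σ z = γ • z) (h' : IsCoord p X Y Z) (hX : σ X = α' • Y) (hZ : σ Z = γ' • Z)
    {g : Polynomial ℂ} (hg : X = Polynomial.aeval x g) : 
    ∃ (δ : ℂ) (r : ℝ), δ ≠ 0 ∧ 0 < r ∧ starRingEnd ℂ δ * γ = γ' * δ ∧ α' * δ ^ d = r * α ∧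
      p.comp (Polynomial.C δ * Polynomial.X) = Polynomial.C (δ ^ d) * p := by
  have hd := hp.two
  have hdom := h.isDomain hp
  have hα := T0_ne h hp hσ hx
  obtain ⟨a, δ, G, ha, hδ, e1, e2, e3⟩ := endA h h' hp hg
  have hG : G = 0 := by
    by_contra hG
    have e4 := congrArg h.pi hZ
    rw [e2, map_add, hσ.smul, hz, map_mul, hσ.aeval, hx] at e4
    simp only [map_add, map_smul, map_mul, h.pi_x, h.pi_z, h.pi_y, pi_aeval_x, ← Polynomial.aeval_algHom_apply] at e4
    set G' := G.map (starRingEnd ℂ) with hG'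
    have hG'0 : G' ≠ 0 := (Polynomial.map_ne_zero_iff (starRingEnd ℂ).injective).mpr hG
    have e3 : ∀ (g : Polynomial ℂ) (c : ℂ), Polynomial.aeval (1 : Polynomial ℂ) g = Polynomial.C (g.eval 1) := by
      intro g c
      rw [← map_one (algebraMap ℂ (Polynomial ℂ)), Polynomial.aeval_algebraMap_apply]
      simp [Polynomial.aeval_def]
    rw [e3 _ 0, aeval_eq_comp'] at e4
    have hap : (α • p).natDegree = d := by
      rw [Polynomial.smul_eq_C_mul, Polynomial.natDegree_C_mul hα, hp.deg]
    have hap0 : (α • p) ≠ 0 := smul_ne_zero hα hp.monic.ne_zero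
    have e5 : (α • p) * G'.comp (α • p) = Polynomial.C (γ' * δ - starRingEnd ℂ δ * γ) * Polynomial.X + Polynomial.C (γ' * G.eval 1) := by
      simp only [Polynomial.smul_eq_C_mul, one_mul] at e4 ⊢
      simp only [map_sub, map_mul]
      linear_combination e4
    have e6 : ((α • p) * G'.comp (α • p)).natDegree ≤ 1 := by rw [e5]; compute_degree
    have hGp : G'.comp (α • p) ≠ 0 := by
      intro h0
      rcases Polynomial.comp_eq_zero_iff.mp h0 with h3 | ⟨-, h3⟩
      · exact hG'0 h3
      · rw [h3, Polynomial.natDegree_C] at hap; omega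
    rw [Polynomial.natDegree_mul hap0 hGp, hap] at e6
    omega
  have hZz : Z = δ • z := by rw [e2, hG]; simp
  have hY : a • Y = δ ^ d • y := by
    apply mul_left_cancel₀ (h.x_ne hp)
    have e4 := h'.rel
    have e5 : Polynomial.aeval Z p = Polynomial.aeval z (p.comp (Polynomial.C δ * Polynomial.X)) := by
      rw [hZz, Polynomial.aeval_comp]; simp [Algebra.smul_def]
    rw [e5, e3, map_mul, ← h.rel, e1, Polynomial.aeval_C] at e4
    rw [Algebra.smul_def] at e4 ⊢
    rw [Algebra.smul_def]
    linear_combination e4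
  refine ⟨δ, Complex.normSq a, hδ, Complex.normSq_pos.mpr ha, ?_, ?_, e3⟩
  · rw [hZz, hσ.smul, hz, smul_smul, smul_smul] at hZ
    exact smul_z_inj h hZ
  · have e4 := congrArg (fun b => a • b) hX
    rw [e1, hσ.smul, hx, smul_comm a α', hY, smul_smul, smul_smul, smul_smul] at e4
    have := smul_x_inj h.swap e4
    rw [← this, ← Complex.mul_conj]

theorem T0_T0 (hp : Good p d) (hpr : p.map (starRingEnd ℂ) = p) (hσ : SemiInv σ) (hd : 3 ≤ d) {γ γ' α α' : ℂ}
    (h : T0 p σ x y z γ α) (h' : T0 p σ X Y Z γ' α') :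
    ∃ (δ : ℂ) (r : ℝ), δ ≠ 0 ∧ 0 < r ∧ starRingEnd ℂ δ * γ = γ' * δ ∧ α' * δ ^ d = r * α ∧
      p.comp (Polynomial.C δ * Polynomial.X) = Polynomial.C (δ ^ d) * p := by
  obtain ⟨h, hx, hz⟩ := h
  obtain ⟨h', hX, hZ⟩ := h'
  have hα := T0_ne h hp hσ hx
  have hα' : starRingEnd ℂ α ≠ 0 := by simpa using hα
  have hα1 := T0_ne h' hp hσ hX
  have hXT : XType p X := ⟨_, _, h'⟩
  have hy := T0_y h hp hσ hx
  have hne := no_diag h hp hd hXT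
  have key : ∀ {x y : B} {α : ℂ} (h : IsCoord p x y z) (hα : α ≠ 0) (hx : σ x = α • y), h.du X < h.dv X → h.du X = 0 := by
    intro x y α h hα hx hlt
    have hy := T0_y h hp hσ hx
    have hα' : starRingEnd ℂ α ≠ 0 := by simpa using hα
    have f1 := T0_dv h hp hpr hσ hα hx hXT
    rw [hX, h.dv_smul hα1] at f1
    have f2 : h.du (σ X) = h.dv X := T0_dv h.swap hp hpr hσ (inv_ne_zero hα') hy hXT
    have f3 : h.du (α' • Y) = h.du Y := h.swap.dv_smul hα1 Y
    rw [hX, f3] at f2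
    have f4 := lead_prod h hp h' hlt (by omega)
    obtain ⟨k, hk⟩ := dvd_dv h hp hXT
    obtain ⟨k', hk'⟩ := dvd_du h hp hXT
    have f5 : h.dv X ≤ d := by omega
    rw [hk] at f5 hlt
    rw [hk'] at hlt ⊢
    have f6 : k' < k := Nat.lt_of_mul_lt_mul_left hlt
    have f7 : k ≤ 1 := by
      by_contra hc
      have : d * 2 ≤ d * k := Nat.mul_le_mul_left _ (by omega)
      omega
    have : k' = 0 := by omega
    simp [this]
  rcases lt_or_gt_of_ne hne with hlt | hlt
  · have h0 : h.dv X = 0 := key h.swap (inv_ne_zero hα') hy hlt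
    obtain ⟨g, hg⟩ := dv_zero h hp hXT h0
    exact T0_T0_aux hp hpr hσ h hx hz h' hX hZ hg
  · have h0 := key h hα hx hlt
    obtain ⟨g, hg⟩ := dv_zero h.swap hp hXT h0
    obtain ⟨δ, r, h1, h2, h3, h4, h5⟩ := T0_T0_aux hp hpr hσ h.swap hy hz h' hX hZ hg
    refine ⟨δ, r / Complex.normSq α, h1, div_pos h2 (Complex.normSq_pos.mpr hα), h3, ?_, h5⟩
    rw [h4]
    push_cast
    rw [← Complex.mul_conj]
    field_simp

theorem gamma_lemma {p : Polynomial ℝ} {m n d : ℕ} {q : Polynomial ℝ} (hmonic : p.Monic) (hdeg : p.natDegree = d) (hn : 1 ≤ n) (hq0 : q.eval 0 ≠ 0)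
    (hpq : p = Polynomial.X ^ m * q.comp (Polynomial.X ^ n)) (hq1 : q ≠ 1)
    (hmax : ∀ (m' n' : ℕ) (q' : Polynomial ℝ), 1 ≤ n' → q'.eval 0 ≠ 0 →
      p = Polynomial.X ^ m' * q'.comp (Polynomial.X ^ n') → n' ≤ n) {δ : ℂ} (hδ : δ ≠ 0)
    (h : (p.map (algebraMap ℝ ℂ)).comp (Polynomial.C δ * Polynomial.X) = Polynomial.C (δ ^ d) * p.map (algebraMap ℝ ℂ)) :
    δ ^ n = 1 := by
  have hcoeff : ∀ k, p.coeff k ≠ 0 → δ ^ k = δ ^ d := by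
    intro k hk
    have h1 := congrArg (fun f => Polynomial.coeff f k) h
    simp only [Polynomial.comp_C_mul_X_coeff, Polynomial.coeff_C_mul, Polynomial.coeff_map] at h1
    have hk' : algebraMap ℝ ℂ (p.coeff k) ≠ 0 := by simpa using hk
    rw [mul_comm] at h1
    exact mul_right_cancel₀ hk' h1
  have hexp : q.comp (Polynomial.X ^ n) = Polynomial.expand ℝ n q := by
    rw [Polynomial.expand_eq_comp_X_pow]
  rw [hexp] at hpq
  have hc : ∀ k, p.coeff (k + m) = if n ∣ k then q.coeff (k / n) else 0 := by
    intro k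
    rw [hpq, Polynomial.coeff_X_pow_mul, Polynomial.coeff_expand (by omega)]
  have hlow : ∀ k, k < m → p.coeff k = 0 := by
    intro k hk
    rw [hpq, Polynomial.coeff_X_pow_mul', if_neg (by omega)]
  have hm : p.coeff m ≠ 0 := by
    have := hc 0
    rw [zero_add] at this
    rw [this]; simpa [Polynomial.coeff_zero_eq_eval_zero] using hq0
  have hqm : q.Monic := by
    have h1 : p.leadingCoeff = 1 := hmonic
    rw [hpq, Polynomial.leadingCoeff_mul, Polynomial.leadingCoeff_expand (by omega)] at h1
    rw [Polynomial.Monic]; simpa using h1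
  have hqd : 0 < q.natDegree := by
    rcases Nat.eq_zero_or_pos q.natDegree with h0 | h0
    · exact absurd (hqm.natDegree_eq_zero.mp h0) hq1
    · exact h0
  have htop : p.coeff (n * q.natDegree + m) ≠ 0 := by
    rw [hc, if_pos (dvd_mul_right _ _), Nat.mul_div_cancel_left _ (by omega)]
    have : q.coeff q.natDegree = 1 := hqm
    rw [this]; simp
  set g := p.support.gcd (fun k => k - m) with hg
  have hgd : ∀ k ∈ p.support, g ∣ k - m := fun k hk => Finset.gcd_dvd hk
  have hkm : ∀ k ∈ p.support, m ≤ k := fun k hk => by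
    by_contra hcon
    exact Polynomial.mem_support_iff.mp hk (hlow k (by omega))
  have hng : n ∣ g := by
    refine Finset.dvd_gcd fun k hk => ?_
    have h1 := Polynomial.mem_support_iff.mp hk
    obtain ⟨j, rfl⟩ := Nat.exists_eq_add_of_le (hkm k hk)
    rw [add_comm, hc] at h1
    by_contra hcon
    rw [if_neg (by simpa using hcon)] at h1
    exact h1 rfl
  have hδg : δ ^ g = 1 := by
    apply orderOf_dvd_iff_pow_eq_one.mp
    refine Finset.dvd_gcd fun k hk => ?_
    apply orderOf_dvd_iff_pow_eq_one.mpr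
    have h1 := hcoeff k (Polynomial.mem_support_iff.mp hk)
    rw [← hcoeff m hm] at h1
    have h2 : δ ^ (k - m) * δ ^ m = 1 * δ ^ m := by rw [← pow_add, Nat.sub_add_cancel (hkm k hk), h1, one_mul]
    exact mul_right_cancel₀ (pow_ne_zero _ hδ) h2
  have hg1 : 1 ≤ g := by
    have h1 := hgd _ (Polynomial.mem_support_iff.mpr htop)
    rw [Nat.add_sub_cancel] at h1
    exact Nat.pos_of_dvd_of_pos h1 (Nat.mul_pos (by omega) hqd)
  set q' : Polynomial ℝ := ∑ k ∈ p.support, Polynomial.C (p.coeff k) * Polynomial.X ^ ((k - m) / g) with hq'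
  have hpq' : p = Polynomial.X ^ m * q'.comp (Polynomial.X ^ g) := by
    conv_lhs => rw [p.as_sum_support_C_mul_X_pow]
    rw [hq', Polynomial.sum_comp, Finset.mul_sum]
    refine Finset.sum_congr rfl fun k hk => ?_
    rw [Polynomial.mul_comp, Polynomial.C_comp, Polynomial.X_pow_comp, ← pow_mul, Nat.mul_div_cancel' (hgd k hk), mul_left_comm, ← pow_add,
      Nat.add_sub_cancel' (hkm k hk)]
  have hq'0 : q'.eval 0 ≠ 0 := by
    have h1 : p.coeff m = q'.eval 0 := by
      have := congrArg (fun f => Polynomial.coeff f m) hpq'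
      rw [this, ← Polynomial.expand_eq_comp_X_pow, Polynomial.coeff_X_pow_mul', if_pos le_rfl, Nat.sub_self, Polynomial.coeff_expand (by omega)]
      simp [Polynomial.coeff_zero_eq_eval_zero]
    rw [← h1]; exact hm
  have h1 := hmax m g q' hg1 hq'0 hpq'
  have : g = n := le_antisymm h1 (Nat.le_of_dvd hg1 hng)
  rw [← this]; exact hδg

end P9

open MvPolynomial
open scoped TensorProduct

section P10
set_option linter.all false
set_option linter.unusedSectionVars false

def FW (n : ℕ) (q : Polynomial ℝ) (w : ℂ) (c : Fin 2) : Prop := w ^ n = (-1) ^ (c : ℕ) ∨ q = 1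

noncomputable def kap (m : ℕ) (b : Fin 2) (w : ℂ) : ℂ := -(-1) ^ (b : ℕ) * w ^ m

theorem kap_ne {m : ℕ} {b : Fin 2} {w : ℂ} (hw : w ≠ 0) : kap m b w ≠ 0 :=
  mul_ne_zero (neg_ne_zero.mpr (pow_ne_zero _ (by norm_num))) (pow_ne_zero _ hw)

noncomputable abbrev toC (p : Polynomial ℝ) : Polynomial ℂ := p.map (algebraMap ℝ ℂ)

/-- the defining relation of `S_{abc}` -/
def SRel (m n : ℕ) (q : Polynomial ℝ) (a b c : Fin 2) {S : Type} [CommRing S] [Algebra ℝ S] (s t u : S) : Prop :=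
  s ^ 2 + (-1) ^ (a : ℕ) * t ^ 2 + (-1) ^ (b : ℕ) * (u ^ m * Polynomial.aeval ((-1) ^ (c : ℕ) * u ^ n) q) = 0

/-- abstract presentation of `S_{abc}` -/
structure IsS (m n : ℕ) (q : Polynomial ℝ) (a b c : Fin 2) {S : Type} [CommRing S] [Algebra ℝ S] (s t u : S) : Prop where
  rel : SRel m n q a b c s t u
  gen : Algebra.adjoin ℝ {s, t, u} = ⊤
  lift : ∀ (T : Type) [CommRing T] [Algebra ℝ T] (s' t' u' : T), SRel m n q a b c s' t' u' →
    ∃ Φ : S →ₐ[ℝ] T, Φ s = s' ∧ Φ t = t' ∧ Φ u = u'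

variable {p : Polynomial ℝ} {d m n : ℕ} {q : Polynomial ℝ}

theorem neg_one_sq_pow (R : Type) [CommRing R] (c : ℕ) : ((-1 : R) ^ c) * (-1) ^ c = 1 := by
  rw [← mul_pow]; simp

theorem fw_rel (hpq : p = Polynomial.X ^ m * q.comp (Polynomial.X ^ n)) {w : ℂ} {c : Fin 2} (hw : FW n q w c)
    {T : Type} [CommRing T] [Algebra ℂ T] [Algebra ℝ T] [IsScalarTower ℝ ℂ T] (z : T) :
    (w • z) ^ m * Polynomial.aeval ((-1 : T) ^ (c : ℕ) * (w • z) ^ n) q = w ^ m • Polynomial.aeval z (toC p) := by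
  have e0 : Polynomial.aeval z (toC p) = Polynomial.aeval z p := by
    rw [toC, Polynomial.aeval_map_algebraMap]
  rw [e0, hpq, map_mul, map_pow, Polynomial.aeval_X, Polynomial.aeval_comp, map_pow, Polynomial.aeval_X, smul_pow, smul_mul_assoc]
  rcases hw with hw | hw
  · have : (-1 : T) ^ (c : ℕ) * (w • z) ^ n = z ^ n := by
      rw [smul_pow, hw, Algebra.smul_def, map_pow, map_neg, map_one, ← mul_assoc, neg_one_sq_pow, one_mul]
    rw [this]
  · subst hw; simp

theorem isS_S (a b c : Fin 2) : IsS m n q a b c (S := SAlg m n q (a, b, c)) (Ideal.Quotient.mk _ (X 0)) (Ideal.Quotient.mk _ (X 1))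
    (Ideal.Quotient.mk _ (X 2)) := by
  constructor
  · have h1 : Ideal.Quotient.mkₐ ℝ (Ideal.span {sPoly m n q a b c}) (sPoly m n q a b c) = 0 :=
      Ideal.Quotient.eq_zero_iff_mem.mpr (Ideal.subset_span rfl)
    have h2 : ∀ f, f = sPoly m n q a b c → Ideal.Quotient.mkₐ ℝ (Ideal.span {sPoly m n q a b c}) f = 0 := by
      rintro f rfl; exact h1
    have h3 := h2 _ (sPoly.eq_def m n q a b c).symm
    simp only [map_add, map_mul, map_pow, map_neg, map_one, ← Polynomial.aeval_algHom_apply] at h3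
    exact h3
  · have := congrArg (Subalgebra.map (Ideal.Quotient.mkₐ ℝ (Ideal.span {sPoly m n q a b c}))) (MvPolynomial.adjoin_range_X (R := ℝ) (σ := Fin 3))
    rw [AlgHom.map_adjoin, Algebra.map_top, (AlgHom.range_eq_top _).mpr (Ideal.Quotient.mkₐ_surjective _ _)] at this
    rw [eq_top_iff, ← this]
    apply Algebra.adjoin_mono
    rintro _ ⟨_, ⟨i, rfl⟩, rfl⟩
    fin_cases i
    · exact Or.inl rfl
    · exact Or.inr (Or.inl rfl)
    · exact Or.inr (Or.inr rfl)
  · intro T _ _ s t u hr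
    refine ⟨Ideal.Quotient.liftₐ _ (MvPolynomial.aeval ![s, t, u]) ?_, ?_, ?_, ?_⟩
    · intro f hf
      obtain ⟨g, rfl⟩ := Ideal.mem_span_singleton'.mp hf
      rw [map_mul]
      have : (MvPolynomial.aeval ![s, t, u]) (sPoly m n q a b c) = 0 := by
        rw [← hr, sPoly]
        simp [← Polynomial.aeval_algHom_apply]
      rw [this, mul_zero]
    · exact MvPolynomial.aeval_X _ _
    · exact MvPolynomial.aeval_X _ _
    · exact MvPolynomial.aeval_X _ _

theorem half_inv {T : Type} [CommRing T] [Algebra ℂ T] : ∀ {κ : ℂ}, κ ≠ 0 → algebraMap ℂ T κ⁻¹ * algebraMap ℂ T κ = 1 := by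
  intro κ h; rw [← map_mul, inv_mul_cancel₀ h, map_one]

variable {S : Type} [CommRing S] [Algebra ℝ S] {a b c : Fin 2} {s t u : S} {w ι : ℂ}

/-- the relation, both directions -/
theorem rel_iff (hpq : p = Polynomial.X ^ m * q.comp (Polynomial.X ^ n)) (hw0 : w ≠ 0) (hw : FW n q w c)
    (hι : ι * ι = -(-1) ^ (a : ℕ)) {T : Type} [CommRing T] [Algebra ℂ T] [Algebra ℝ T] [IsScalarTower ℝ ℂ T] (s t u : T) :
    SRel m n q a b c s t u ↔
    (s + ι • t) * ((kap m b w)⁻¹ • (s - ι • t)) = Polynomial.aeval (w⁻¹ • u) (toC p) := by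
  have e1 := fw_rel hpq hw (w⁻¹ • u)
  rw [smul_smul, mul_inv_cancel₀ hw0, one_smul] at e1
  have hκ0 : kap m b w ≠ 0 := kap_ne hw0
  rw [SRel, e1, mul_smul_comm _ (s + ι • t), inv_smul_eq_iff₀ hκ0]
  generalize Polynomial.aeval (w⁻¹ • u) (toC p) = P
  have e4 := congrArg (algebraMap ℂ T) hι
  rw [kap]
  simp only [Algebra.smul_def, map_mul, map_neg, map_pow, map_one] at e4 ⊢
  constructor
  · intro h; linear_combination h - t ^ 2 * e4
  · intro h; linear_combination h + t ^ 2 * e4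

theorem ι_ne (hι : ι * ι = -(-1) ^ (a : ℕ)) : ι ≠ 0 := by
  rintro rfl
  rw [mul_zero] at hι
  exact neg_ne_zero.mpr (pow_ne_zero _ (by norm_num)) hι.symm

theorem solve_st {T : Type} [CommRing T] [Algebra ℂ T] (hι0 : ι ≠ 0) {κ : ℂ} (hκ0 : κ ≠ 0) (x y : T) :
    (2⁻¹ : ℂ) • (x + κ • y) + ι • ((ι⁻¹ * 2⁻¹ : ℂ) • (x - κ • y)) = x ∧
    κ⁻¹ • ((2⁻¹ : ℂ) • (x + κ • y) - ι • ((ι⁻¹ * 2⁻¹ : ℂ) • (x - κ • y))) = y := by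
  rw [smul_smul ι, mul_inv_cancel_left₀ hι0]
  constructor
  · module
  · rw [inv_smul_eq_iff₀ hκ0]; module

theorem solve_st' {T : Type} [CommRing T] [Algebra ℂ T] (hι0 : ι ≠ 0) {κ : ℂ} (hκ0 : κ ≠ 0) (s t : T) :
    (2⁻¹ : ℂ) • ((s + ι • t) + κ • (κ⁻¹ • (s - ι • t))) = s ∧
    (ι⁻¹ * 2⁻¹ : ℂ) • ((s + ι • t) - κ • (κ⁻¹ • (s - ι • t))) = t := by
  rw [smul_inv_smul₀ hκ0]
  constructor
  · module
  · rw [mul_smul, inv_smul_eq_iff₀ hι0]; module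

theorem SRel.map {T T' : Type} [CommRing T] [Algebra ℝ T] [CommRing T'] [Algebra ℝ T'] {s t u : T} (h : SRel m n q a b c s t u)
    (f : T →ₐ[ℝ] T') : SRel m n q a b c (f s) (f t) (f u) := by
  have := congrArg f h
  simpa only [SRel, map_add, map_mul, map_pow, map_neg, map_one, map_zero, ← Polynomial.aeval_algHom_apply] using this

theorem SRel.of_map {T T' : Type} [CommRing T] [Algebra ℝ T] [CommRing T'] [Algebra ℝ T'] {s t u : T} 
    (f : T →ₐ[ℝ] T') (hf : Function.Injective f) (h : SRel m n q a b c (f s) (f t) (f u)) : SRel m n q a b c s t u := by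
  apply hf
  rw [map_zero]
  simpa only [SRel, map_add, map_mul, map_pow, map_neg, map_one, map_zero, ← Polynomial.aeval_algHom_apply] using h

theorem IsS.gen_top (h : IsS m n q a b c s t u) {N : Subalgebra ℂ (ℂ ⊗[ℝ] S)}
    (hs : (1 : ℂ) ⊗ₜ[ℝ] s ∈ N) (ht : (1 : ℂ) ⊗ₜ[ℝ] t ∈ N) (hu : (1 : ℂ) ⊗ₜ[ℝ] u ∈ N) : N = ⊤ := by
  have key : ∀ v : S, (1 : ℂ) ⊗ₜ[ℝ] v ∈ N := by
    intro v
    have hv : v ∈ Algebra.adjoin ℝ {s, t, u} := by rw [h.gen]; trivial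
    have : Algebra.adjoin ℝ {s, t, u} ≤ (N.restrictScalars ℝ).comap (Algebra.TensorProduct.includeRight : S →ₐ[ℝ] ℂ ⊗[ℝ] S) := by
      rw [Algebra.adjoin_le_iff]
      rintro _ (rfl | rfl | rfl)
      · exact hs
      · exact ht
      · exact hu
    exact this hv
  rw [eq_top_iff]
  rintro v -
  induction v using TensorProduct.induction_on with
  | zero => exact N.zero_mem
  | tmul r v =>
    have : r ⊗ₜ[ℝ] v = r • ((1 : ℂ) ⊗ₜ[ℝ] v) := by rw [TensorProduct.smul_tmul']; simp
    rw [this]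
    exact N.smul_mem (key v) _
  | add f g hf hg => exact N.add_mem hf hg

theorem IsS.coord (h : IsS m n q a b c s t u) (hpq : p = Polynomial.X ^ m * q.comp (Polynomial.X ^ n)) (hw0 : w ≠ 0) (hw : FW n q w c)
    (hι : ι * ι = -(-1) ^ (a : ℕ)) : IsCoord (toC p) 
      ((1 : ℂ) ⊗ₜ[ℝ] s + ι • ((1 : ℂ) ⊗ₜ[ℝ] t)) ((kap m b w)⁻¹ • ((1 : ℂ) ⊗ₜ[ℝ] s - ι • ((1 : ℂ) ⊗ₜ[ℝ] t))) (w⁻¹ • ((1 : ℂ) ⊗ₜ[ℝ] u)) := by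
  have hκ0 : kap m b w ≠ 0 := kap_ne hw0
  have hι0 := ι_ne hι
  constructor
  · exact (rel_iff hpq hw0 hw hι _ _ _).mp (h.rel.map (Algebra.TensorProduct.includeRight : S →ₐ[ℝ] ℂ ⊗[ℝ] S))
  · obtain ⟨e1, e2⟩ := solve_st' hι0 hκ0 ((1 : ℂ) ⊗ₜ[ℝ] s) ((1 : ℂ) ⊗ₜ[ℝ] t)
    have e3 : w • (w⁻¹ • ((1 : ℂ) ⊗ₜ[ℝ] u)) = (1 : ℂ) ⊗ₜ[ℝ] u := smul_inv_smul₀ hw0 _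
    generalize hx' : (1 : ℂ) ⊗ₜ[ℝ] s + ι • ((1 : ℂ) ⊗ₜ[ℝ] t) = x' at *
    generalize hy' : (kap m b w)⁻¹ • ((1 : ℂ) ⊗ₜ[ℝ] s - ι • ((1 : ℂ) ⊗ₜ[ℝ] t)) = y' at *
    generalize hz' : w⁻¹ • ((1 : ℂ) ⊗ₜ[ℝ] u) = z' at *
    have hx : x' ∈ Algebra.adjoin ℂ {x', y', z'} := Algebra.subset_adjoin (by simp)
    have hy : y' ∈ Algebra.adjoin ℂ {x', y', z'} := Algebra.subset_adjoin (by simp)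
    have hz : z' ∈ Algebra.adjoin ℂ {x', y', z'} := Algebra.subset_adjoin (by simp)
    apply h.gen_top
    · rw [← e1]
      exact Subalgebra.smul_mem _ (Subalgebra.add_mem _ hx (Subalgebra.smul_mem _ hy _)) _
    · rw [← e2]
      exact Subalgebra.smul_mem _ (Subalgebra.sub_mem _ hx (Subalgebra.smul_mem _ hy _)) _
    · rw [← e3]
      exact Subalgebra.smul_mem _ hz _
  · intro T _ f x' y' z' hxy
    letI : Algebra ℂ T := f.toAlgebra
    letI : Algebra ℝ T := (f.comp (algebraMap ℝ ℂ)).toAlgebra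
    haveI : IsScalarTower ℝ ℂ T := IsScalarTower.of_algebraMap_eq fun _ => rfl
    have hxy' : x' * y' = Polynomial.aeval z' (toC p) := hxy
    obtain ⟨e1, e2⟩ := solve_st hι0 hκ0 x' y'
    obtain ⟨Φ, f1, f2, f3⟩ := h.lift T ((2⁻¹ : ℂ) • (x' + kap m b w • y')) ((ι⁻¹ * 2⁻¹ : ℂ) • (x' - kap m b w • y')) (w • z') (by
      rw [rel_iff hpq hw0 hw hι, e1, e2, inv_smul_smul₀ hw0, hxy'])
    let Ψ : ℂ ⊗[ℝ] S →ₐ[ℂ] T := Algebra.TensorProduct.lift (Algebra.ofId ℂ T) Φ (fun _ _ => Commute.all _ _)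
    have hΨ : ∀ v : S, Ψ ((1 : ℂ) ⊗ₜ[ℝ] v) = Φ v := by
      intro v
      rw [Algebra.TensorProduct.lift_tmul, map_one, one_mul]
    refine ⟨Ψ.toRingHom, fun r => AlgHom.commutes _ r, ?_, ?_, ?_⟩
    · change Ψ _ = _
      rw [map_add, map_smul, hΨ, hΨ, f1, f2, e1]
    · change Ψ _ = _
      rw [map_smul, map_sub, map_smul, hΨ, hΨ, f1, f2, e2]
    · change Ψ _ = _
      rw [map_smul, hΨ, f3, inv_smul_smul₀ hw0]

theorem IsS.map {S' : Type} [CommRing S'] [Algebra ℝ S'] (h : IsS m n q a b c s t u) (e : S ≃ₐ[ℝ] S') : IsS m n q a b c (e s) (e t) (e u) := by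
  refine ⟨h.rel.map e.toAlgHom, ?_, ?_⟩
  · have := congrArg (Subalgebra.map e.toAlgHom) h.gen
    rw [AlgHom.map_adjoin, Algebra.map_top, (AlgHom.range_eq_top _).mpr e.surjective] at this
    rw [← this]
    simp [Set.image_insert_eq]
  · intro T _ _ s' t' u' hr
    obtain ⟨Φ, f1, f2, f3⟩ := h.lift T s' t' u' hr
    exact ⟨Φ.comp e.symm.toAlgHom, by simpa using f1, by simpa using f2, by simpa using f3⟩

theorem isS_of_equiv {A : Type} [CommRing A] [Algebra ℝ A] (e : SAlg m n q (a, b, c) ≃ₐ[ℝ] A) : ∃ s t u : A, IsS m n q a b c s t u :=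
  ⟨_, _, _, (isS_S a b c).map e⟩

theorem isoS (hpq : p = Polynomial.X ^ m * q.comp (Polynomial.X ^ n)) (hw0 : w ≠ 0) (hw : FW n q w c)
    (hι : ι * ι = -(-1) ^ (a : ℕ)) {A : Type} [CommRing A] [Algebra ℝ A] {s t u : A}
    (h : IsCoord (toC p) 
      ((1 : ℂ) ⊗ₜ[ℝ] s + ι • ((1 : ℂ) ⊗ₜ[ℝ] t)) ((kap m b w)⁻¹ • ((1 : ℂ) ⊗ₜ[ℝ] s - ι • ((1 : ℂ) ⊗ₜ[ℝ] t))) (w⁻¹ • ((1 : ℂ) ⊗ₜ[ℝ] u))) :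
    Nonempty (A ≃ₐ[ℝ] SAlg m n q (a, b, c)) := by
  have hrel : SRel m n q a b c s t u := by
    apply SRel.of_map (Algebra.TensorProduct.includeRight : A →ₐ[ℝ] ℂ ⊗[ℝ] A) 
    · exact Algebra.TensorProduct.includeRight_injective (R := ℝ) (A := ℂ) (B := A) (algebraMap ℝ ℂ).injective
    · exact (rel_iff hpq hw0 hw hι _ _ _).mpr h.rel
  have hS := isS_S (m := m) (n := n) (q := q) a b c
  obtain ⟨Φ, f1, f2, f3⟩ := hS.lift A s t u hrel
  have h0 := hS.coord hpq hw0 hw hι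
  generalize (Ideal.Quotient.mk _ (X 0) : SAlg m n q (a, b, c)) = s0 at *
  generalize (Ideal.Quotient.mk _ (X 1) : SAlg m n q (a, b, c)) = t0 at *
  generalize (Ideal.Quotient.mk _ (X 2) : SAlg m n q (a, b, c)) = u0 at *
  let Ψ : ℂ ⊗[ℝ] SAlg m n q (a, b, c) →ₐ[ℂ] ℂ ⊗[ℝ] A := Algebra.TensorProduct.map (AlgHom.id ℂ ℂ) Φ
  have hΨ : ∀ v, Ψ ((1 : ℂ) ⊗ₜ[ℝ] v) = (1 : ℂ) ⊗ₜ[ℝ] (Φ v) := fun v => Algebra.TensorProduct.map_tmul _ _ _ _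
  have hb := h0.bijective h Ψ (by rw [map_add, map_smul, hΨ, hΨ, f1, f2]) (by rw [map_smul, map_sub, map_smul, hΨ, hΨ, f1, f2]) (by rw [map_smul, hΨ, f3])
  have h1 : Function.Bijective (Φ.toLinearMap.lTensor ℂ) := hb
  have h2 : Function.Bijective Φ := ⟨(Module.FaithfullyFlat.lTensor_injective_iff_injective ℝ ℂ Φ.toLinearMap).mp h1.1,
    (Module.FaithfullyFlat.lTensor_surjective_iff_surjective ℝ ℂ Φ.toLinearMap).mp h1.2⟩
  exact ⟨(AlgEquiv.ofBijective Φ h2).symm⟩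

end P10

open MvPolynomial
open scoped TensorProduct

section P11
set_option linter.all false
set_option linter.unusedSectionVars false

noncomputable def cσ (A : Type) [CommRing A] [Algebra ℝ A] : (ℂ ⊗[ℝ] A) ≃+* (ℂ ⊗[ℝ] A) :=
  (Algebra.TensorProduct.congr Complex.conjAe (AlgEquiv.refl : A ≃ₐ[ℝ] A)).toRingEquiv

variable {A : Type} [CommRing A] [Algebra ℝ A]

theorem cσ_tmul (r : ℂ) (v : A) : cσ A (r ⊗ₜ[ℝ] v) = (starRingEnd ℂ r) ⊗ₜ[ℝ] v := by
  change Algebra.TensorProduct.congr Complex.conjAe (AlgEquiv.refl : A ≃ₐ[ℝ] A) (r ⊗ₜ[ℝ] v) = _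
  rw [Algebra.TensorProduct.congr_apply, Algebra.TensorProduct.map_tmul]
  rfl

theorem cσ_semi : SemiInv (cσ A) := by
  constructor
  · intro c
    rw [Algebra.TensorProduct.algebraMap_apply, Algebra.TensorProduct.algebraMap_apply, cσ_tmul]; rfl
  · intro b
    induction b using TensorProduct.induction_on with
    | zero => simp
    | tmul r v => rw [cσ_tmul, cσ_tmul]; simp
    | add f g hf hg => rw [map_add, map_add, hf, hg]

theorem cσ_smul (r : ℂ) (v : ℂ ⊗[ℝ] A) : cσ A (r • v) = starRingEnd ℂ r • cσ A v := cσ_semi.smul r v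

theorem cσ_one (v : A) : cσ A ((1 : ℂ) ⊗ₜ[ℝ] v) = (1 : ℂ) ⊗ₜ[ℝ] v := by rw [cσ_tmul, map_one]

theorem cσ_fix {v : ℂ ⊗[ℝ] A} (hv : cσ A v = v) : ∃ a : A, v = (1 : ℂ) ⊗ₜ[ℝ] a := by
  have key : ∀ v : ℂ ⊗[ℝ] A, ∃ a : A, v + cσ A v = (1 : ℂ) ⊗ₜ[ℝ] a := by
    intro v
    induction v using TensorProduct.induction_on with
    | zero => exact ⟨0, by simp⟩
    | tmul r v =>
      refine ⟨(2 * r.re) • v, ?_⟩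
      rw [cσ_tmul, ← TensorProduct.add_tmul, Complex.add_conj, TensorProduct.tmul_smul, TensorProduct.smul_tmul']
      congr 1
      rw [Complex.real_smul, mul_one]
    | add f g hf hg =>
      obtain ⟨a, ha⟩ := hf
      obtain ⟨b, hb⟩ := hg
      refine ⟨a + b, ?_⟩
      rw [TensorProduct.tmul_add, ← ha, ← hb, map_add]; abel
  obtain ⟨a, ha⟩ := key v
  refine ⟨(2⁻¹ : ℝ) • a, ?_⟩
  rw [TensorProduct.tmul_smul, ← ha, hv, ← two_smul ℝ, smul_smul]; norm_num

variable {p : Polynomial ℝ} {d m n : ℕ} {q : Polynomial ℝ} {a b c : Fin 2} {w ι : ℂ} {x y z : ℂ ⊗[ℝ] A}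

theorem toC_conj : (toC p).map (starRingEnd ℂ) = toC p := by
  rw [toC, Polynomial.map_map]; congr 1; ext r; exact Complex.conj_ofReal r

theorem finish (hpq : p = Polynomial.X ^ m * q.comp (Polynomial.X ^ n)) (hw0 : w ≠ 0) (hw : FW n q w c)
    (hι : ι * ι = -(-1) ^ (a : ℕ)) (h : IsCoord (toC p) x y z) 
    (h1 : cσ A ((2⁻¹ : ℂ) • (x + kap m b w • y)) = (2⁻¹ : ℂ) • (x + kap m b w • y))
    (h2 : cσ A ((ι⁻¹ * 2⁻¹ : ℂ) • (x - kap m b w • y)) = (ι⁻¹ * 2⁻¹ : ℂ) • (x - kap m b w • y))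
    (h3 : cσ A (w • z) = w • z) : Nonempty (A ≃ₐ[ℝ] SAlg m n q (a, b, c)) := by
  obtain ⟨s, hs⟩ := cσ_fix h1
  obtain ⟨t, ht⟩ := cσ_fix h2
  obtain ⟨u, hu⟩ := cσ_fix h3
  obtain ⟨e1, e2⟩ := solve_st (ι_ne hι) (kap_ne (m := m) (b := b) hw0) x y
  apply isoS (p := p) (ι := ι) (s := s) (t := t) (u := u) hpq hw0 hw hι
  rw [← hs, ← ht, ← hu, e1, e2, inv_smul_smul₀ hw0]
  exact h

theorem isCoord_Bp : IsCoord (toC p) (Ideal.Quotient.mk _ (X 0) : BpC p) (Ideal.Quotient.mk _ (X 1)) (Ideal.Quotient.mk _ (X 2)) := by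
  constructor
  · have h1 : Ideal.Quotient.mkₐ ℂ (Ideal.span {(X 0 * X 1 : MvPolynomial (Fin 3) ℂ) -
      Polynomial.aeval (X 2) (p.map (algebraMap ℝ ℂ))}) ((X 0 * X 1 : MvPolynomial (Fin 3) ℂ) -
      Polynomial.aeval (X 2) (p.map (algebraMap ℝ ℂ))) = 0 := Ideal.Quotient.eq_zero_iff_mem.mpr (Ideal.subset_span rfl)
    rw [map_sub, map_mul, ← Polynomial.aeval_algHom_apply, sub_eq_zero] at h1
    exact h1
  · have := congrArg (Subalgebra.map (Ideal.Quotient.mkₐ ℂ (Ideal.span {(X 0 * X 1 : MvPolynomial (Fin 3) ℂ) -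
      Polynomial.aeval (X 2) (p.map (algebraMap ℝ ℂ))}))) (MvPolynomial.adjoin_range_X (R := ℂ) (σ := Fin 3))
    rw [AlgHom.map_adjoin, Algebra.map_top, (AlgHom.range_eq_top _).mpr (Ideal.Quotient.mkₐ_surjective _ _)] at this
    rw [eq_top_iff, ← this]
    apply Algebra.adjoin_mono
    rintro _ ⟨_, ⟨i, rfl⟩, rfl⟩
    fin_cases i
    · exact Or.inl rfl
    · exact Or.inr (Or.inl rfl)
    · exact Or.inr (Or.inr rfl)
  · intro T _ f x y z hxy
    letI : Algebra ℂ T := f.toAlgebra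
    have hxy' : x * y = Polynomial.aeval z (toC p) := hxy
    refine ⟨(Ideal.Quotient.liftₐ _ (MvPolynomial.aeval ![x, y, z] : _ →ₐ[ℂ] T) ?_).toRingHom, fun r => AlgHom.commutes _ r, ?_, ?_, ?_⟩
    · intro g hg
      obtain ⟨g, rfl⟩ := Ideal.mem_span_singleton'.mp hg
      rw [map_mul]
      have : (MvPolynomial.aeval ![x, y, z] : _ →ₐ[ℂ] T) ((X 0 * X 1 : MvPolynomial (Fin 3) ℂ) -
          Polynomial.aeval (X 2) (p.map (algebraMap ℝ ℂ))) = 0 := by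
        rw [map_sub, map_mul, ← Polynomial.aeval_algHom_apply, sub_eq_zero]
        simpa using hxy'
      rw [this, mul_zero]
    · exact MvPolynomial.aeval_X _ _
    · exact MvPolynomial.aeval_X _ _
    · exact MvPolynomial.aeval_X _ _

theorem exists_w (hn : 1 ≤ n) (c : Fin 2) : ∃ w : ℂ, w ^ n = (-1) ^ (c : ℕ) ∧ starRingEnd ℂ w * w = 1 ∧ w ≠ 0 := by
  have key : ∀ v : ℂ, v ^ n = (-1) ^ (c : ℕ) → ‖v‖ = 1 := by
    intro v hv
    have := congrArg norm hv
    rw [norm_pow, norm_pow, norm_neg, norm_one, one_pow] at this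
    exact (pow_eq_one_iff_of_nonneg (norm_nonneg _) (by omega)).mp this
  obtain ⟨w, hw⟩ := IsAlgClosed.exists_pow_nat_eq ((-1 : ℂ) ^ (c : ℕ)) (n := n) (by omega)
  have h1 := key w hw
  refine ⟨w, hw, ?_, ?_⟩
  · rw [← Complex.normSq_eq_conj_mul_self, Complex.normSq_eq_norm_sq, h1]; simp
  · rintro rfl; simp at h1

theorem exists_ι (a : Fin 2) : ∃ ι : ℂ, ι * ι = -(-1) ^ (a : ℕ) := by
  fin_cases a
  · exact ⟨Complex.I, by simp⟩
  · exact ⟨1, by simp⟩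

theorem real_form_S (hn : 1 ≤ n) (hpq : p = Polynomial.X ^ m * q.comp (Polynomial.X ^ n)) (i : Fin 2 × Fin 2 × Fin 2) :
    IsRealForm (SAlg m n q i) (BpC p) := by
  obtain ⟨a, b, c⟩ := i
  obtain ⟨w, hw, -, hw0⟩ := exists_w hn c
  obtain ⟨ι, hι⟩ := exists_ι a
  obtain ⟨e, -⟩ := ((isS_S (m := m) (n := n) (q := q) a b c).coord hpq hw0 (Or.inl hw) hι).exists_equiv isCoord_Bp
  exact ⟨e⟩

theorem conj_unit (hw1 : starRingEnd ℂ w * w = 1) : starRingEnd ℂ w⁻¹ = w := by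
  rw [map_inv₀]; exact inv_eq_of_mul_eq_one_right hw1

variable {s t u : A}

theorem IsS.T1 (h : IsS m n q 1 b c s t u) (hpq : p = Polynomial.X ^ m * q.comp (Polynomial.X ^ n)) (hw0 : w ≠ 0) (hw : FW n q w c)
    (hw1 : starRingEnd ℂ w * w = 1) : ∃ x y z, T1 (toC p) (cσ A) x y z (w ^ 2) := by
  refine ⟨_, _, _, h.coord (ι := 1) hpq hw0 hw (by simp), ?_, ?_⟩
  · rw [map_add, cσ_smul, cσ_one, cσ_one, map_one]
  · rw [cσ_smul, cσ_one, conj_unit hw1, smul_smul]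
    congr 1; field_simp

theorem IsS.T0 (h : IsS m n q 0 b c s t u) (hpq : p = Polynomial.X ^ m * q.comp (Polynomial.X ^ n)) (hw0 : w ≠ 0) (hw : FW n q w c)
    (hw1 : starRingEnd ℂ w * w = 1) : ∃ x y z, T0 (toC p) (cσ A) x y z (w ^ 2) (kap m b w) := by
  refine ⟨_, _, _, h.coord (ι := Complex.I) hpq hw0 hw (by simp), ?_, ?_⟩
  · rw [map_add, cσ_smul, cσ_one, cσ_one, Complex.conj_I, smul_inv_smul₀ (kap_ne hw0), neg_smul, sub_eq_add_neg]
  · rw [cσ_smul, cσ_one, conj_unit hw1, smul_smul]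
    congr 1; field_simp

theorem good_toC (hd : 2 ≤ d) (hdeg : p.natDegree = d) (hmonic : p.Monic) (hred : p.coeff (d - 1) = 0) : Good (toC p) d := by
  refine ⟨hmonic.map _, ?_, hd, ?_⟩
  · rw [toC, Polynomial.natDegree_map, hdeg]
  · rw [toC, Polynomial.coeff_map, hred, map_zero]

end P11

open MvPolynomial
open scoped TensorProduct

section P12
set_option linter.all false
set_option linter.unusedSectionVars false

variable {A : Type} [CommRing A] [Algebra ℝ A]
variable {p : Polynomial ℝ} {d m n : ℕ} {q : Polynomial ℝ} {a b c : Fin 2} {w ι : ℂ} {x y z : ℂ ⊗[ℝ] A}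

theorem smul_zero_dom {B : Type} [CommRing B] [IsDomain B] [Algebra ℂ B] {r : ℂ} {v : B} (h : r • v = 0) : r = 0 ∨ v = 0 := by
  rw [Algebra.smul_def, mul_eq_zero] at h
  exact h.imp (fun h => (map_eq_zero_iff _ (FaithfulSMul.algebraMap_injective ℂ B)).mp h) id

theorem conj_two : starRingEnd ℂ 2 = 2 := map_ofNat _ 2

theorem unit_sqrt {γ : ℂ} (hγ : starRingEnd ℂ γ * γ = 1) : ∃ w : ℂ, w ^ 2 = γ ∧ starRingEnd ℂ w * w = 1 ∧ w ≠ 0 := by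
  obtain ⟨w, hw⟩ := IsAlgClosed.exists_pow_nat_eq γ (n := 2) (by omega)
  have h1 : ‖w‖ = 1 := by
    rw [← Complex.normSq_eq_conj_mul_self, Complex.normSq_eq_norm_sq] at hγ
    have h2 : ‖γ‖ ^ 2 = 1 := by exact_mod_cast hγ
    rw [← hw, norm_pow, ← pow_mul] at h2
    exact (pow_eq_one_iff_of_nonneg (norm_nonneg _) (by omega)).mp h2
  refine ⟨w, hw, ?_, ?_⟩
  · rw [← Complex.normSq_eq_conj_mul_self, Complex.normSq_eq_norm_sq, h1]; simp
  · rintro rfl; simp at h1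

theorem choose_c {γ : ℂ} (hw2 : w ^ 2 = γ) (hγ : q ≠ 1 → γ ^ n = 1) : ∃ c : Fin 2, FW n q w c ∧ (q = 1 → c = 0) := by
  by_cases hq : q = 1
  · exact ⟨0, Or.inr hq, fun _ => rfl⟩
  · have h1 := hγ hq
    rw [← hw2, ← pow_mul, mul_comm, pow_mul, sq_eq_one_iff] at h1
    rcases h1 with h1 | h1
    · exact ⟨0, Or.inl (by simpa using h1), fun h => absurd h hq⟩
    · exact ⟨1, Or.inl (by simpa using h1), fun h => absurd h hq⟩

theorem F_fix (hpq : p = Polynomial.X ^ m * q.comp (Polynomial.X ^ n)) (hw : FW n q w c) (h3 : cσ A (w • z) = w • z) :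
    cσ A (w ^ m • Polynomial.aeval z (toC p)) = w ^ m • Polynomial.aeval z (toC p) := by
  obtain ⟨u, hu⟩ := cσ_fix h3
  rw [← fw_rel hpq hw, hu]
  have : ((1 : ℂ) ⊗ₜ[ℝ] u) ^ m * Polynomial.aeval ((-1 : ℂ ⊗[ℝ] A) ^ (c : ℕ) * ((1 : ℂ) ⊗ₜ[ℝ] u) ^ n) q =
      (Algebra.TensorProduct.includeRight : A →ₐ[ℝ] ℂ ⊗[ℝ] A) (u ^ m * Polynomial.aeval ((-1 : A) ^ (c : ℕ) * u ^ n) q) := by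
    simp only [map_mul, map_pow, map_neg, map_one, ← Polynomial.aeval_algHom_apply]; rfl
  rw [this]
  exact cσ_one _

theorem complete {X Y Z : ℂ ⊗[ℝ] A} (hd : 2 ≤ d) (hdeg : p.natDegree = d) (hmonic : p.Monic) (hred : p.coeff (d - 1) = 0)
    (hn : 1 ≤ n) (hq0 : q.eval 0 ≠ 0)
    (hpq : p = Polynomial.X ^ m * q.comp (Polynomial.X ^ n))
    (hmax : q ≠ 1 → ∀ (m' n' : ℕ) (q' : Polynomial ℝ), 1 ≤ n' → q'.eval 0 ≠ 0 →
      p = Polynomial.X ^ m' * q'.comp (Polynomial.X ^ n') → n' ≤ n) 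
    (h₀ : IsCoord (toC p) X Y Z) : ∃ a b c : Fin 2, (a = 0 ∨ b = 1) ∧ (q = 1 → c = 0) ∧ Nonempty (A ≃ₐ[ℝ] SAlg m n q (a, b, c)) := by
  have hp := good_toC hd hdeg hmonic hred
  have hσ := cσ_semi (A := A)
  rcases endB h₀ hp toC_conj hσ with ⟨x, y, z, γ, h, hx, hz⟩ | ⟨x, y, z, γ, α, h, hx, hz⟩
  · obtain ⟨w, hw2, hw1, hw0⟩ := unit_sqrt (z_unit h hσ hz)
    obtain ⟨c, hc, hc0⟩ := choose_c (n := n) (q := q) hw2 (fun hq => by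
      have h1 := z_hom h hp toC_conj hσ hz (Or.inl ⟨1, by rw [hx, one_smul]⟩)
      refine gamma_lemma hmonic hdeg hn hq0 hpq hq (hmax hq) ?_ h1
      rw [← hw2]; exact pow_ne_zero _ hw0)
    have h3 : cσ A (w • z) = w • z := by
      rw [cσ_smul, hz, smul_smul, ← hw2, pow_two, ← mul_assoc, hw1, one_mul]
    refine ⟨1, 1, c, Or.inr rfl, hc0, ?_⟩
    have hk : kap m 1 w = w ^ m := by simp [kap]
    have hy : cσ A (kap m 1 w • y) = kap m 1 w • y := by
      haveI := h.isDomain hp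
      apply mul_left_cancel₀ (h.x_ne hp)
      have := F_fix hpq hc h3
      rw [← h.rel, ← mul_smul_comm, map_mul, hx] at this
      rw [hk, this]
    refine finish (ι := 1) hpq hw0 hc (by simp) h ?_ ?_ h3
    · rw [cσ_smul, map_add, hx, hy]; simp [conj_two]
    · rw [cσ_smul, map_sub, hx, hy]; simp [conj_two]
  · obtain ⟨w, hw2, hw1, hw0⟩ := unit_sqrt (z_unit h hσ hz)
    obtain ⟨c, hc, hc0⟩ := choose_c (n := n) (q := q) hw2 (fun hq => by
      have h1 := z_hom h hp toC_conj hσ hz (Or.inr ⟨α, hx⟩)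
      refine gamma_lemma hmonic hdeg hn hq0 hpq hq (hmax hq) ?_ h1
      rw [← hw2]; exact pow_ne_zero _ hw0)
    have h3 : cσ A (w • z) = w • z := by
      rw [cσ_smul, hz, smul_smul, ← hw2, pow_two, ← mul_assoc, hw1, one_mul]
    have hα := T0_ne h hp hσ hx
    have hwm : w ^ m ≠ 0 := pow_ne_zero _ hw0
    obtain ⟨r, hr⟩ : ∃ r : ℝ, α = r * w ^ m := by
      have hF := F_fix hpq hc h3
      haveI := h.isDomain hp
      have hy0 := h.swap.x_ne hp
      have hF0 : w ^ m • Polynomial.aeval z (toC p) ≠ 0 := by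
        rw [← h.rel]
        intro h0
        rcases smul_zero_dom (B := ℂ ⊗[ℝ] A) h0 with h0 | h0
        · exact hwm h0
        · exact mul_ne_zero (h.x_ne hp) hy0 h0
      have e1 : x * cσ A x = (α * (w ^ m)⁻¹) • (w ^ m • Polynomial.aeval z (toC p)) := by
        rw [hx, mul_smul_comm, h.rel, smul_smul, inv_mul_cancel_right₀ hwm]
      have e2 := congrArg (cσ A) e1
      rw [map_mul, hσ.inv, mul_comm, e1, cσ_smul, hF, ← sub_eq_zero, ← sub_smul] at e2
      have e4 := (smul_zero_dom e2).resolve_right hF0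
      obtain ⟨r, hr⟩ := Complex.conj_eq_iff_real.mp (sub_eq_zero.mp e4).symm
      exact ⟨r, by rw [← hr, inv_mul_cancel_right₀ hwm]⟩
    have hr0 : r ≠ 0 := by rintro rfl; simp at hr; exact hα hr
    obtain ⟨b, μ, hμ, hb⟩ : ∃ (b : Fin 2) (μ : ℝ), μ ≠ 0 ∧ μ * μ * r = -(-1) ^ (b : ℕ) := by
      rcases lt_or_gt_of_ne hr0 with h | h
      · refine ⟨0, (Real.sqrt (-r))⁻¹, inv_ne_zero (Real.sqrt_ne_zero'.mpr (by linarith)), ?_⟩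
        rw [← mul_inv, Real.mul_self_sqrt (by linarith)]; simp; field_simp
      · refine ⟨1, (Real.sqrt r)⁻¹, inv_ne_zero (Real.sqrt_ne_zero'.mpr h), ?_⟩
        rw [← mul_inv, Real.mul_self_sqrt h.le]; simp; field_simp
    have hμ' : (μ : ℂ) ≠ 0 := by exact_mod_cast hμ
    have h' := h.scale hμ'
    have hx' : cσ A ((μ : ℂ) • x) = kap m b w • ((μ : ℂ)⁻¹ • y) := by
      rw [cσ_smul, hx, smul_smul, smul_smul, Complex.conj_ofReal]
      congr 1
      rw [hr, kap, eq_mul_inv_iff_mul_eq₀ hμ']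
      have hb' : (μ : ℂ) * μ * r = -(-1) ^ (b : ℕ) := by exact_mod_cast hb
      rw [← hb']; ring
    have hx'' : cσ A (kap m b w • ((μ : ℂ)⁻¹ • y)) = (μ : ℂ) • x := by rw [← hx', hσ.inv]
    refine ⟨0, b, c, Or.inl rfl, hc0, ?_⟩
    refine finish (ι := Complex.I) hpq hw0 hc (by simp) h' ?_ ?_ h3
    · rw [cσ_smul, map_add, hx', hx'', add_comm]; simp [conj_two]
    · rw [cσ_smul, map_sub, hx', hx'', ← neg_sub, smul_neg, ← neg_smul]; simp [conj_two]

/-! equivalences -/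

theorem S_iso {a' b' c' : Fin 2} {s t u : SAlg m n q (a', b', c')} {s' t' u' : SAlg m n q (a, b, c)}
    (h : SRel m n q a b c s t u) (h' : SRel m n q a' b' c' s' t' u')
    (key : ∀ (Φ : SAlg m n q (a, b, c) →ₐ[ℝ] SAlg m n q (a', b', c')) (Ψ : SAlg m n q (a', b', c') →ₐ[ℝ] SAlg m n q (a, b, c)),
      Φ (Ideal.Quotient.mk _ (X 0)) = s → Φ (Ideal.Quotient.mk _ (X 1)) = t → Φ (Ideal.Quotient.mk _ (X 2)) = u →
      Ψ (Ideal.Quotient.mk _ (X 0)) = s' → Ψ (Ideal.Quotient.mk _ (X 1)) = t' → Ψ (Ideal.Quotient.mk _ (X 2)) = u' →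
      (Φ s' = Ideal.Quotient.mk _ (X 0) ∧ Φ t' = Ideal.Quotient.mk _ (X 1) ∧ Φ u' = Ideal.Quotient.mk _ (X 2)) ∧
      (Ψ s = Ideal.Quotient.mk _ (X 0) ∧ Ψ t = Ideal.Quotient.mk _ (X 1) ∧ Ψ u = Ideal.Quotient.mk _ (X 2))) :
    Nonempty (SAlg m n q (a, b, c) ≃ₐ[ℝ] SAlg m n q (a', b', c')) := by
  have hS := isS_S (m := m) (n := n) (q := q) a b c
  have hS' := isS_S (m := m) (n := n) (q := q) a' b' c'
  obtain ⟨Φ, f1, f2, f3⟩ := hS.lift _ s t u h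
  obtain ⟨Ψ, g1, g2, g3⟩ := hS'.lift _ s' t' u' h'
  obtain ⟨⟨k1, k2, k3⟩, l1, l2, l3⟩ := key Φ Ψ f1 f2 f3 g1 g2 g3
  refine ⟨AlgEquiv.ofAlgHom Φ Ψ ?_ ?_⟩
  · refine AlgHom.ext_of_adjoin_eq_top hS'.gen ?_
    rintro _ (rfl | rfl | rfl)
    · change Φ (Ψ _) = _; rw [g1, k1]; rfl
    · change Φ (Ψ _) = _; rw [g2, k2]; rfl
    · change Φ (Ψ _) = _; rw [g3, k3]; rfl
  · refine AlgHom.ext_of_adjoin_eq_top hS.gen ?_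
    rintro _ (rfl | rfl | rfl)
    · change Ψ (Φ _) = _; rw [f1, l1]; rfl
    · change Ψ (Φ _) = _; rw [f2, l2]; rfl
    · change Ψ (Φ _) = _; rw [f3, l3]; rfl

theorem S_swap01 (c : Fin 2) : Nonempty (SAlg m n q (1, 1, c) ≃ₐ[ℝ] SAlg m n q (1, 0, c)) := by
  refine S_iso (s := Ideal.Quotient.mk _ (X 1)) (t := Ideal.Quotient.mk _ (X 0)) (u := Ideal.Quotient.mk _ (X 2)) 
    (s' := Ideal.Quotient.mk _ (X 1)) (t' := Ideal.Quotient.mk _ (X 0)) (u' := Ideal.Quotient.mk _ (X 2)) ?_ ?_ ?_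
  · have := (isS_S (m := m) (n := n) (q := q) 1 0 c).rel
    simp only [SRel, Fin.isValue, Fin.val_one, Fin.val_zero, pow_one, pow_zero] at this ⊢
    linear_combination -this
  · have := (isS_S (m := m) (n := n) (q := q) 1 1 c).rel
    simp only [SRel, Fin.isValue, Fin.val_one, Fin.val_zero, pow_one, pow_zero] at this ⊢
    linear_combination -this
  · intro Φ Ψ f1 f2 f3 g1 g2 g3; exact ⟨⟨f2, f1, f3⟩, g2, g1, g3⟩

theorem neg_rel {T : Type} [CommRing T] [Algebra ℝ T] {s t u : T} {b' c' : Fin 2} (hb : (-1 : T) ^ (b' : ℕ) = (-1) ^ (b : ℕ) * (-1) ^ m) 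
    (hc : (-1 : T) ^ (c' : ℕ) = (-1) ^ (c : ℕ) * (-1) ^ n ∨ q = 1)
    (h : SRel m n q a b c s t u) : SRel m n q a b' c' s t (-u) := by
  rw [SRel] at h ⊢
  have e : Polynomial.aeval ((-1) ^ (c' : ℕ) * (-u) ^ n) q = Polynomial.aeval ((-1) ^ (c : ℕ) * u ^ n) q := by
    rcases hc with hc | rfl
    · rw [hc, neg_pow u, mul_assoc, ← mul_assoc _ _ (u ^ n), neg_one_sq_pow, one_mul]
    · simp
  rw [e, hb, neg_pow u, ← h]
  have := neg_one_sq_pow T m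
  linear_combination ((-1) ^ (b : ℕ) * (u ^ m * Polynomial.aeval ((-1) ^ (c : ℕ) * u ^ n) q)) * this

theorem S_neg {b' c' : Fin 2} (hb : Even ((b' : ℕ) + b + m))
    (hc : Even ((c' : ℕ) + c + n) ∨ q = 1) : Nonempty (SAlg m n q (a, b, c) ≃ₐ[ℝ] SAlg m n q (a, b', c')) := by
  have key : ∀ (T : Type) [CommRing T] (i j k : ℕ), Even (i + j + k) → (-1 : T) ^ i = (-1) ^ j * (-1) ^ k := by
    intro T _ i j k h
    have h1 : ((-1 : T) ^ i) * ((-1) ^ j * (-1) ^ k) = 1 := by rw [← pow_add, ← pow_add, ← add_assoc]; exact h.neg_one_pow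
    have h2 := neg_one_sq_pow T i
    calc (-1 : T) ^ i = (-1 : T) ^ i * (((-1 : T) ^ i) * ((-1) ^ j * (-1) ^ k)) := by rw [h1, mul_one]
      _ = _ := by rw [← mul_assoc, h2, one_mul]
  have hb' : Even ((b : ℕ) + b' + m) := by rwa [add_comm (b : ℕ)]
  have hc' : Even ((c : ℕ) + c' + n) ∨ q = 1 := by rwa [add_comm (c : ℕ)]
  refine S_iso (s := Ideal.Quotient.mk _ (X 0)) (t := Ideal.Quotient.mk _ (X 1)) (u := -Ideal.Quotient.mk _ (X 2)) 
    (s' := Ideal.Quotient.mk _ (X 0)) (t' := Ideal.Quotient.mk _ (X 1)) (u' := -Ideal.Quotient.mk _ (X 2)) ?_ ?_ ?_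
  · exact neg_rel (key _ _ _ _ hb') (hc'.imp (key _ _ _ _) id) (isS_S (m := m) (n := n) (q := q) a b' c').rel
  · exact neg_rel (key _ _ _ _ hb) (hc.imp (key _ _ _ _) id) (isS_S (m := m) (n := n) (q := q) a b c).rel
  · intro Φ Ψ f1 f2 f3 g1 g2 g3; exact ⟨⟨f1, f2, by rw [map_neg, f3, neg_neg]⟩, g1, g2, by rw [map_neg, g3, neg_neg]⟩

/-- `q = 1`, `m = 2` -/
theorem S_swap02 : Nonempty (SAlg 2 n 1 (0, 1, 0) ≃ₐ[ℝ] SAlg 2 n 1 (1, 1, 0)) := by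
  refine S_iso (s := Ideal.Quotient.mk _ (X 2)) (t := Ideal.Quotient.mk _ (X 1)) (u := Ideal.Quotient.mk _ (X 0)) 
    (s' := Ideal.Quotient.mk _ (X 2)) (t' := Ideal.Quotient.mk _ (X 1)) (u' := Ideal.Quotient.mk _ (X 0)) ?_ ?_ ?_
  · have := (isS_S (m := 2) (n := n) (q := 1) 1 1 0).rel
    simp only [SRel, Fin.isValue, Fin.val_one, Fin.val_zero, pow_one, pow_zero, map_one] at this ⊢
    linear_combination -this
  · have := (isS_S (m := 2) (n := n) (q := 1) 0 1 0).rel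
    simp only [SRel, Fin.isValue, Fin.val_one, Fin.val_zero, pow_one, pow_zero, map_one] at this ⊢
    linear_combination -this
  · intro Φ Ψ f1 f2 f3 g1 g2 g3; exact ⟨⟨f3, f2, f1⟩, g3, g2, g1⟩

/-- `n = 2`, `m = 0`, `q = X + r` -/
theorem S_swap12 (r : ℝ) (b : Fin 2) : ∀ c c' a a' : Fin 2, a' = b + c → c' = a + b → 
  a = b + c' → c = a' + b →
    Nonempty (SAlg 0 2 (Polynomial.X + Polynomial.C r) (a, b, c) ≃ₐ[ℝ] SAlg 0 2 (Polynomial.X + Polynomial.C r) (a', b, c')) := by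
  intro c c' a a' h1 h2 h3 h4
  have key : ∀ (T : Type) [CommRing T] (b c : Fin 2), (-1 : T) ^ ((b + c : Fin 2) : ℕ) = (-1) ^ (b : ℕ) * (-1) ^ (c : ℕ) := by
    intro T _ b c
    fin_cases b <;> fin_cases c <;> simp
  have k2 : ∀ (T : Type) [CommRing T] [Algebra ℝ T] (s t u : T) (a a' c c' : Fin 2), a' = b + c → c' = a + b → 
     SRel 0 2 (Polynomial.X + Polynomial.C r) a b c s t u → SRel 0 2 (Polynomial.X + Polynomial.C r) a' b c' s u t := by
    intro T _ _ s t u a a' c c' h1 h2 h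
    subst h1 h2
    rw [SRel] at h ⊢
    rw [key, key, ← h]
    simp only [map_add, Polynomial.aeval_X, Polynomial.aeval_C]
    have := neg_one_sq_pow T b
    linear_combination t ^ 2 * (-1) ^ (a : ℕ) * this
  refine S_iso (s := Ideal.Quotient.mk _ (X 0)) (t := Ideal.Quotient.mk _ (X 2)) (u := Ideal.Quotient.mk _ (X 1)) 
    (s' := Ideal.Quotient.mk _ (X 0)) (t' := Ideal.Quotient.mk _ (X 2)) (u' := Ideal.Quotient.mk _ (X 1)) ?_ ?_ ?_
  · exact k2 _ _ _ _ _ _ _ _ h3 h4 (isS_S _ _ _).rel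
  · exact k2 _ _ _ _ _ _ _ _ h1 h2 (isS_S _ _ _).rel
  · intro Φ Ψ f1 f2 f3 g1 g2 g3; exact ⟨⟨f1, f3, f2⟩, g1, g3, g2⟩

end P12

open MvPolynomial
open scoped TensorProduct

section P13
set_option linter.all false
set_option linter.unusedSectionVars false

structure Hyp (p : Polynomial ℝ) (d m n : ℕ) (q : Polynomial ℝ) : Prop where
  hd : 2 ≤ d
  hdeg : p.natDegree = d
  hmonic : p.Monic
  hred : p.coeff (d - 1) = 0
  hn : 1 ≤ n
  hq0 : q.eval 0 ≠ 0
  hpq : p = Polynomial.X ^ m * q.comp (Polynomial.X ^ n)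
  hmax : q ≠ 1 → ∀ (m' n' : ℕ) (q' : Polynomial ℝ), 1 ≤ n' → q'.eval 0 ≠ 0 →
      p = Polynomial.X ^ m' * q'.comp (Polynomial.X ^ n') → n' ≤ n

variable {A : Type} [CommRing A] [Algebra ℝ A]
variable {p : Polynomial ℝ} {d m n : ℕ} {q : Polynomial ℝ} {a b c a' b' c' : Fin 2} {s t u s' t' u' : A}

theorem Hyp.good (H : Hyp p d m n q) : Good (toC p) d := good_toC H.hd H.hdeg H.hmonic H.hred

theorem fin2_pow {c c' : Fin 2} (h : (-1 : ℂ) ^ (c : ℕ) = (-1) ^ (c' : ℕ)) : c = c' := by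
  fin_cases c <;> fin_cases c' <;> first | rfl | (norm_num at h)

theorem Hyp.a_eq (H : Hyp p d m n q) (hd : 3 ≤ d) (h : IsS m n q 0 b c s t u) (h' : IsS m n q 1 b' c' s' t' u') : False := by
  obtain ⟨w, hw, hw1, hw0⟩ := exists_w H.hn c
  obtain ⟨w', hw', hw1', hw0'⟩ := exists_w H.hn c'
  obtain ⟨x, y, z, hT⟩ := h.T0 H.hpq hw0 (Or.inl hw) hw1
  obtain ⟨x', y', z', hT'⟩ := h'.T1 H.hpq hw0' (Or.inl hw') hw1'
  exact T1_T0 H.good toC_conj cσ_semi hd hT hT'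

theorem c_aux (hn : 1 ≤ n) (hev : Even n) {w w' δ : ℂ} (hw : w ^ n = (-1) ^ (c : ℕ)) (hw' : w' ^ n = (-1) ^ (c' : ℕ))
    (hδ : δ ^ n = 1) (h : starRingEnd ℂ δ * w ^ 2 = w' ^ 2 * δ) : c = c' := by
  have h1 : ‖δ‖ = 1 := by
    have := congrArg norm hδ
    rw [norm_pow, norm_one] at this
    exact (pow_eq_one_iff_of_nonneg (norm_nonneg _) (by omega)).mp this
  have h2 : δ * starRingEnd ℂ δ = 1 := by
    rw [mul_comm, ← Complex.normSq_eq_conj_mul_self, Complex.normSq_eq_norm_sq, h1]; simp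
  have h3 : w ^ 2 = (w' * δ) ^ 2 := by linear_combination δ * h - w ^ 2 * h2
  apply fin2_pow
  rw [← hw, ← hw']
  obtain ⟨k, rfl⟩ := hev
  rw [← two_mul] at hδ ⊢
  rw [pow_mul, h3, ← pow_mul, mul_pow, hδ, mul_one]

theorem Hyp.c_eq (H : Hyp p d m n q) (hq : q ≠ 1) (hev : Even n) (hd : a = 0 → 3 ≤ d) (h : IsS m n q a b c s t u) (h' : IsS m n q a b' c' s' t' u') : c = c' := by
  obtain ⟨w, hw, hw1, hw0⟩ := exists_w H.hn c
  obtain ⟨w', hw', hw1', hw0'⟩ := exists_w H.hn c'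
  obtain rfl | rfl : a = 0 ∨ a = 1 := by fin_cases a <;> simp
  · obtain ⟨x, y, z, hT⟩ := h.T0 H.hpq hw0 (Or.inl hw) hw1
    obtain ⟨x', y', z', hT'⟩ := h'.T0 H.hpq hw0' (Or.inl hw') hw1'
    obtain ⟨δ, r, hδ, hr, h1, h2, h3⟩ := T0_T0 H.good toC_conj cσ_semi (hd rfl) hT hT'
    exact c_aux H.hn hev hw hw' (gamma_lemma H.hmonic H.hdeg H.hn H.hq0 H.hpq hq (H.hmax hq) hδ h3) h1
  · obtain ⟨x, y, z, hT⟩ := h.T1 H.hpq hw0 (Or.inl hw) hw1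
    obtain ⟨x', y', z', hT'⟩ := h'.T1 H.hpq hw0' (Or.inl hw') hw1'
    obtain ⟨δ, hδ, h1, h3⟩ := T1_T1 H.good toC_conj cσ_semi hT hT'
    exact c_aux H.hn hev hw hw' (gamma_lemma H.hmonic H.hdeg H.hn H.hq0 H.hpq hq (H.hmax hq) hδ h3) h1

theorem Hyp.b_eq (H : Hyp p d m n q) (hd : 3 ≤ d) (hc : Even d ∨ (q ≠ 1 ∧ Odd n)) (h : IsS m n q 0 b c s t u) (h' : IsS m n q 0 b' c s' t' u') : b = b' := by
  obtain ⟨w, hw, hw1, hw0⟩ := exists_w H.hn c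
  obtain ⟨x, y, z, hT⟩ := h.T0 H.hpq hw0 (Or.inl hw) hw1
  obtain ⟨x', y', z', hT'⟩ := h'.T0 H.hpq hw0 (Or.inl hw) hw1
  obtain ⟨δ, r, hδ, hr, h1, h2, h3⟩ := T0_T0 H.good toC_conj cσ_semi hd hT hT'
  rw [mul_comm] at h1
  obtain ⟨ρ, rfl⟩ := Complex.conj_eq_iff_real.mp (mul_left_cancel₀ (pow_ne_zero 2 hw0) h1)
  have hρ : 0 < ρ ^ d := by
    rcases hc with hc | ⟨hq, hc⟩
    · exact hc.pow_pos (by exact_mod_cast hδ)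
    · have := gamma_lemma H.hmonic H.hdeg H.hn H.hq0 H.hpq hq (H.hmax hq) hδ h3
      have h4 : ρ ^ n = 1 := by exact_mod_cast this
      have h5 : 0 < ρ := hc.pow_pos_iff.mp (by rw [h4]; norm_num)
      positivity
  have h4 : (-1 : ℂ) ^ (b' : ℕ) * (ρ : ℂ) ^ d = r * (-1) ^ (b : ℕ) := by
    apply mul_right_cancel₀ (pow_ne_zero m hw0)
    simp only [kap] at h2
    linear_combination -h2
  have h5 : (-1 : ℝ) ^ (b' : ℕ) * ρ ^ d = r * (-1) ^ (b : ℕ) := by exact_mod_cast h4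
  obtain rfl | rfl : b = 0 ∨ b = 1 := by fin_cases b <;> simp
  · obtain rfl | rfl : b' = 0 ∨ b' = 1 := by fin_cases b' <;> simp
    · rfl
    · simp at h5; linarith
  · obtain rfl | rfl : b' = 0 ∨ b' = 1 := by fin_cases b' <;> simp
    · simp at h5; linarith
    · rfl

theorem bdd (hg : Algebra.adjoin ℝ {s, t, u} = ⊤) {R : ℝ} (hR : ∀ ψ : A →ₐ[ℝ] ℝ, (ψ s) ^ 2 + (ψ t) ^ 2 + (ψ u) ^ 2 = R) (f : A) :
    ∃ C, ∀ ψ : A →ₐ[ℝ] ℝ, |ψ f| ≤ C := by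
  have hf : f ∈ Algebra.adjoin ℝ {s, t, u} := by rw [hg]; trivial
  induction hf using Algebra.adjoin_induction with
  | mem f hf =>
    refine ⟨R + 1, fun ψ => ?_⟩
    have h1 := hR ψ
    have h2 : (ψ f) ^ 2 ≤ R := by
      have h3 : f = s ∨ f = t ∨ f = u := hf
      rcases h3 with h3 | h3 | h3 <;> rw [h3] <;> nlinarith [sq_nonneg (ψ s), sq_nonneg (ψ t), sq_nonneg (ψ u)]
    exact abs_le.mpr ⟨by nlinarith [sq_nonneg (ψ f + 1), sq_nonneg (ψ f)], by nlinarith [sq_nonneg (ψ f - 1), sq_nonneg (ψ f)]⟩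
  | algebraMap r => exact ⟨|r|, fun ψ => by rw [AlgHom.commutes]; rfl⟩
  | add f g _ _ hf hg =>
    obtain ⟨C, hC⟩ := hf
    obtain ⟨D, hD⟩ := hg
    exact ⟨C + D, fun ψ => by rw [map_add]; exact (abs_add_le _ _).trans (add_le_add (hC ψ) (hD ψ))⟩
  | mul f g _ _ hf hg =>
    obtain ⟨C, hC⟩ := hf
    obtain ⟨D, hD⟩ := hg
    exact ⟨C * D, fun ψ => by
      rw [map_mul, abs_mul]; exact mul_le_mul (hC ψ) (hD ψ) (abs_nonneg _) ((abs_nonneg _).trans (hC ψ))⟩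

theorem unbdd (h : IsS m n q 1 b c s t u) (C : ℝ) : ∃ ψ : A →ₐ[ℝ] ℝ, C < |ψ (s + t)| := by
  set R : ℝ := |C| + 1 with hR
  have hR0 : 0 < R := by positivity
  set K : ℝ := (-1) ^ (b : ℕ) * (0 ^ m * Polynomial.aeval ((-1) ^ (c : ℕ) * (0 : ℝ) ^ n) q) with hK
  obtain ⟨ψ, h1, h2, h3⟩ := h.lift ℝ ((R - K / R) / 2) ((R + K / R) / 2) 0 (by
    rw [SRel, ← hK]; simp; field_simp; ring)
  refine ⟨ψ, ?_⟩
  rw [map_add, h1, h2]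
  have : (R - K / R) / 2 + (R + K / R) / 2 = R := by ring
  rw [this, abs_of_pos hR0]
  linarith [le_abs_self C]

theorem bdd_unbdd (hg : Algebra.adjoin ℝ {s, t, u} = ⊤) {R : ℝ} (hR : ∀ ψ : A →ₐ[ℝ] ℝ, (ψ s) ^ 2 + (ψ t) ^ 2 + (ψ u) ^ 2 = R) 
    (h : IsS m n q 1 b c s' t' u') : False := by
  obtain ⟨C, hC⟩ := bdd hg hR (s' + t')
  obtain ⟨ψ, hψ⟩ := unbdd h C
  exact absurd (hC ψ) (not_le.mpr hψ)

theorem rel_real {s t u : ℝ} {r : ℝ} : SRel 0 2 (Polynomial.X + Polynomial.C r) 0 b b s t u ↔ s ^ 2 + t ^ 2 + u ^ 2 = -((-1) ^ (b : ℕ) * r) := by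
  rw [SRel]
  obtain rfl | rfl : b = 0 ∨ b = 1 := by fin_cases b <;> simp
  · simp; constructor <;> intro h <;> linarith
  · simp; constructor <;> intro h <;> linarith

theorem d2_a {r : ℝ} (h : IsS 0 2 (Polynomial.X + Polynomial.C r) 0 b b s t u) (h' : IsS 0 2 (Polynomial.X + Polynomial.C r) 1 b' c' s' t' u') : False :=
  bdd_unbdd h.gen (fun ψ => rel_real.mp (h.rel.map ψ)) h'

theorem d2_q {h0 : IsS 2 n 1 0 0 0 s t u} (h' : IsS 2 n 1 1 b' c' s' t' u') : False :=
  bdd_unbdd (R := 0) h0.gen (fun ψ => by have := h0.rel.map ψ; simpa [SRel] using this) h'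

theorem d2_b {r : ℝ} (hr : r ≠ 0) (h : IsS 0 2 (Polynomial.X + Polynomial.C r) 0 0 0 s t u) 
    (h' : IsS 0 2 (Polynomial.X + Polynomial.C r) 0 1 1 s' t' u') : False := by
  rcases lt_or_gt_of_ne hr with hr | hr
  · obtain ⟨ψ, -⟩ := h.lift ℝ (Real.sqrt (-r)) 0 0 (by rw [rel_real, Real.sq_sqrt (by linarith)]; simp)
    have := rel_real.mp (h'.rel.map ψ)
    simp at this
    nlinarith [sq_nonneg (ψ s'), sq_nonneg (ψ t'), sq_nonneg (ψ u')]
  · obtain ⟨ψ, -⟩ := h'.lift ℝ (Real.sqrt r) 0 0 (by rw [rel_real, Real.sq_sqrt (by linarith)]; simp)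
    have := rel_real.mp (h.rel.map ψ)
    simp at this
    nlinarith [sq_nonneg (ψ s), sq_nonneg (ψ t), sq_nonneg (ψ u)]

theorem two_pres (e : SAlg m n q (a, b, c) ≃ₐ[ℝ] SAlg m n q (a', b', c')) : ∃ s t u s' t' u' : SAlg m n q (a', b', c'), 
    IsS m n q a b c s t u ∧ IsS m n q a' b' c' s' t' u' :=
  ⟨_, _, _, _, _, _, (isS_S a b c).map e, isS_S a' b' c'⟩

theorem Hyp.deg (H : Hyp p d m n q) : d = m + q.natDegree * n := by
  have hq : q.comp (Polynomial.X ^ n) ≠ 0 := by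
    intro h; apply H.hmonic.ne_zero; rw [H.hpq, h, mul_zero]
  rw [← H.hdeg, H.hpq, Polynomial.natDegree_mul (pow_ne_zero _ Polynomial.X_ne_zero) hq, Polynomial.natDegree_comp]
  simp

theorem Hyp.qmonic (H : Hyp p d m n q) : q.Monic := by
  have h := H.hmonic
  rw [H.hpq] at h
  have h2 := (Polynomial.monic_X_pow m).of_mul_monic_left h
  rw [Polynomial.Monic, Polynomial.leadingCoeff_comp (by rw [Polynomial.natDegree_X_pow]; have := H.hn; omega)] at h2
  rw [Polynomial.Monic]; simpa using h2

theorem Hyp.d2 (H : Hyp p 2 m 2 q) (hq : q ≠ 1) : m = 0 ∧ ∃ r : ℝ, r ≠ 0 ∧ q = Polynomial.X + Polynomial.C r := by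
  have h1 := H.deg
  have h2 : q.natDegree ≠ 0 := fun h => hq (H.qmonic.natDegree_eq_zero.mp h)
  have h3 : q.natDegree = 1 := by omega
  refine ⟨by omega, q.coeff 0, ?_, ?_⟩
  · rw [Polynomial.coeff_zero_eq_eval_zero]; exact H.hq0
  · have h4 := Polynomial.eq_X_add_C_of_natDegree_le_one h3.le
    have h5 : q.coeff 1 = 1 := by have := H.qmonic; rwa [Polynomial.Monic, Polynomial.leadingCoeff, h3] at this
    rw [h5] at h4; simpa using h4

theorem Hyp.complete (H : Hyp p d m n q) {A : Type} [CommRing A] [Algebra ℝ A] (hA : IsRealForm A (BpC p)) :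
    ∃ i : Fin 2 × Fin 2 × Fin 2, (i = (0, 0, 0) ∨ i = (0, 1, 0) ∨ i = (1, 1, 0) ∨ (q ≠ 1 ∧ (i = (0, 0, 1) ∨ i = (0, 1, 1) ∨ i = (1, 1, 1)))) ∧
      Nonempty (A ≃ₐ[ℝ] SAlg m n q i) := by
  obtain ⟨e⟩ := hA
  obtain ⟨a, b, c, h1, h2, h3⟩ := _root_.complete H.hd H.hdeg H.hmonic H.hred H.hn H.hq0 H.hpq H.hmax (isCoord_Bp.map_equiv e.symm)
  refine ⟨(a, b, c), ?_, h3⟩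
  by_cases hq : q = 1
  · obtain rfl := h2 hq
    clear h3 h2
    simp only [ne_eq, hq, not_true_eq_false, false_and, or_false]
    clear hq
    revert a b; decide
  · clear h2 h3
    simp only [ne_eq, hq, not_false_eq_true, true_and]
    revert a b c; decide

end P13

open MvPolynomial
open scoped TensorProduct

section P14
set_option linter.all false
set_option linter.unusedSectionVars false

variable {p : Polynomial ℝ} {d m n : ℕ} {q : Polynomial ℝ} {a b c a' b' c' : Fin 2}

theorem ne_trans {A : Type} [CommRing A] [Algebra ℝ A] {i j : Fin 2 × Fin 2 × Fin 2} (h : Nonempty (A ≃ₐ[ℝ] SAlg m n q i)) 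
    (h' : Nonempty (SAlg m n q i ≃ₐ[ℝ] SAlg m n q j)) : Nonempty (A ≃ₐ[ℝ] SAlg m n q j) := by
  obtain ⟨e⟩ := h
  obtain ⟨e'⟩ := h'
  exact ⟨e.trans e'⟩

theorem Hyp.iso_a (H : Hyp p d m n q) (hd : 3 ≤ d) (e : SAlg m n q (a, b, c) ≃ₐ[ℝ] SAlg m n q (a', b', c')) : a = a' := by
  obtain ⟨s, t, u, s', t', u', h, h'⟩ := two_pres e
  obtain rfl | rfl : a = 0 ∨ a = 1 := by fin_cases a <;> simp
  · obtain rfl | rfl : a' = 0 ∨ a' = 1 := by fin_cases a' <;> simp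
    · rfl
    · exact (H.a_eq hd h h').elim
  · obtain rfl | rfl : a' = 0 ∨ a' = 1 := by fin_cases a' <;> simp
    · exact (H.a_eq hd h' h).elim
    · rfl

theorem Hyp.iso_c (H : Hyp p d m n q) (hq : q ≠ 1) (hev : Even n) (hd : 3 ≤ d) (e : SAlg m n q (a, b, c) ≃ₐ[ℝ] SAlg m n q (a', b', c')) : c = c' := by
  obtain rfl := H.iso_a hd e
  obtain ⟨s, t, u, s', t', u', h, h'⟩ := two_pres e
  exact H.c_eq hq hev (fun _ => hd) h h'

theorem Hyp.iso_b (H : Hyp p d m n q) (hd : 3 ≤ d) (hc : Even d ∨ (q ≠ 1 ∧ Odd n)) (e : SAlg m n q (0, b, c) ≃ₐ[ℝ] SAlg m n q (0, b', c)) : b = b' := by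
  obtain ⟨s, t, u, s', t', u', h, h'⟩ := two_pres e
  exact H.b_eq hd hc h h'

theorem Hyp.case1 (H : Hyp p d m n q) (hc : q = 1 ∧ (d = 2 ∨ (3 ≤ d ∧ Odd d))) : ClassifiedBy p m n q [(0, 0, 0), (1, 1, 0)] := by
  obtain ⟨rfl, hc⟩ := hc
  have hm : d = m := by simpa using H.deg
  subst hm
  have key : ∀ b b' : Fin 2, (SAlg d n 1 (0, 0, 0) ≃ₐ[ℝ] SAlg d n 1 (1, 1, 0)) → False := by
    intro b b' e
    rcases hc with rfl | ⟨hd, -⟩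
    · obtain ⟨s, t, u, s', t', u', h, h'⟩ := two_pres e
      exact d2_q (h0 := h) h'
    · exact absurd (H.iso_a hd e) (by decide)
  refine ⟨?_, ?_⟩
  · intro i hi j hj hij
    simp only [List.mem_cons, List.not_mem_nil, or_false] at hi hj
    refine ⟨fun e => ?_⟩
    rcases hi with rfl | rfl <;> rcases hj with rfl | rfl
    · exact hij rfl
    · exact key 0 0 e
    · exact key 0 0 e.symm
    · exact hij rfl
  · intro A _ _ hA
    obtain ⟨i, hi, h⟩ := H.complete hA
    rcases hi with rfl | rfl | rfl | ⟨hq, -⟩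
    · exact ⟨_, by simp, h⟩
    · rcases hc with rfl | ⟨-, hd⟩
      · exact ⟨(1, 1, 0), by simp, ne_trans h S_swap02⟩
      · refine ⟨(0, 0, 0), by simp, ne_trans h (S_neg ?_ (Or.inr rfl))⟩
        simpa using hd.one_add
    · exact ⟨_, by simp, h⟩
    · exact absurd rfl hq

theorem Hyp.case2 (H : Hyp p d m n q) (hc : (q = 1 ∧ 4 ≤ d ∧ Even d) ∨ (q ≠ 1 ∧ Odd n)) : ClassifiedBy p m n q [(0, 0, 0), (0, 1, 0), (1, 1, 0)] := by
  have hd : 3 ≤ d := by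
    rcases hc with ⟨-, h, -⟩ | ⟨hq, hn⟩
    · omega
    · by_contra h
      have h2 : d = 2 := by have := H.hd; omega
      subst h2
      have h1 := H.deg
      have h2 : q.natDegree ≠ 0 := fun h => hq (H.qmonic.natDegree_eq_zero.mp h)
      have hn1 := H.hn
      have hn2 : n = 1 := by
        have : n ≤ 2 := by nlinarith [Nat.pos_of_ne_zero h2]
        rcases hn with ⟨k, hk⟩; omega
      subst hn2
      have hp2 := Polynomial.eq_quadratic_of_degree_le_two (p := p) (Polynomial.degree_le_of_natDegree_le H.hdeg.le)
      have c2 : p.coeff 2 = 1 := by have := H.hmonic; rwa [Polynomial.Monic, Polynomial.leadingCoeff, H.hdeg] at this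
      have c1 : p.coeff 1 = 0 := H.hred
      rw [c2, c1] at hp2
      simp only [map_one, map_zero, one_mul, zero_mul, add_zero] at hp2
      by_cases c0 : p.coeff 0 = 0
      · have e := H.hpq
        rw [hp2, c0, pow_one, Polynomial.comp_X, map_zero, add_zero] at e
        have hm : m = 0 ∨ m = 1 := by omega
        have hq0 := H.hq0
        rcases hm with rfl | rfl
        · rw [pow_zero, one_mul] at e; rw [← e] at hq0; simp at hq0
        · rw [pow_one, pow_two] at e
          rw [← mul_left_cancel₀ Polynomial.X_ne_zero e] at hq0; simp at hq0
      · have := H.hmax hq 0 2 (Polynomial.X + Polynomial.C (p.coeff 0)) (by norm_num) (by simpa using c0) (by simpa using hp2)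
        omega
  have hc' : Even d ∨ (q ≠ 1 ∧ Odd n) := hc.imp (fun h => h.2.2) id
  refine ⟨?_, ?_⟩
  · intro i hi j hj hij
    simp only [List.mem_cons, List.not_mem_nil, or_false] at hi hj
    refine ⟨fun e => hij ?_⟩
    rcases hi with rfl | rfl | rfl <;> rcases hj with rfl | rfl | rfl <;> first
      | rfl
      | exact absurd (H.iso_a hd e) (by decide)
      | exact absurd (H.iso_b hd hc' e) (by decide)
  · intro A _ _ hA
    obtain ⟨i, hi, h⟩ := H.complete hA
    rcases hi with rfl | rfl | rfl | ⟨hq, hi⟩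
    · exact ⟨_, by simp, h⟩
    · exact ⟨_, by simp, h⟩
    · exact ⟨_, by simp, h⟩
    · have hn : Odd n := hc.elim (fun h => absurd h.1 hq) (fun h => h.2)
      have key : ∀ a b : Fin 2, Nonempty (A ≃ₐ[ℝ] SAlg m n q (a, b, 1)) → ∃ b' : Fin 2, Nonempty (A ≃ₐ[ℝ] SAlg m n q (a, b', 0)) := by
        intro a b h
        have e2 : Even (((0 : Fin 2) : ℕ) + ((1 : Fin 2) : ℕ) + n) := by simpa using hn.one_add
        rcases Nat.even_or_odd ((b : ℕ) + m) with hb | hb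
        · exact ⟨0, ne_trans h (S_neg (by simpa using hb) (Or.inl e2))⟩
        · exact ⟨1, ne_trans h (S_neg (by simpa [add_assoc] using hb.one_add) (Or.inl e2))⟩
      have key2 : ∃ a b' : Fin 2, Nonempty (A ≃ₐ[ℝ] SAlg m n q (a, b', 0)) := by
        rcases hi with rfl | rfl | rfl <;> exact ⟨_, key _ _ h⟩
      clear h hi
      obtain ⟨a, b, h⟩ := key2
      obtain rfl | rfl : a = 0 ∨ a = 1 := by fin_cases a <;> simp
      · obtain rfl | rfl : b = 0 ∨ b = 1 := by fin_cases b <;> simp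
        · exact ⟨_, by simp, h⟩
        · exact ⟨_, by simp, h⟩
      · obtain rfl | rfl : b = 0 ∨ b = 1 := by fin_cases b <;> simp
        · obtain ⟨e⟩ := S_swap01 (m := m) (n := n) (q := q) 0
          exact ⟨(1, 1, 0), by simp, ne_trans h ⟨e.symm⟩⟩
        · exact ⟨_, by simp, h⟩

theorem Hyp.case3 (H : Hyp p d m n q) (hc : q ≠ 1 ∧ ((Even n ∧ Odd d) ∨ (n = 2 ∧ d = 2))) :
    ClassifiedBy p m n q [(0, 0, 0), (0, 1, 1), (1, 0, 0), (1, 1, 1)] := by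
  obtain ⟨hq, hc⟩ := hc
  rcases hc with ⟨hn, hodd⟩ | ⟨rfl, rfl⟩
  · have hd : 3 ≤ d := by have := H.hd; rcases hodd with ⟨k, hk⟩; omega
    have hm : Odd m := by
      have := H.deg
      rw [this, Nat.odd_add] at hodd
      exact hodd.mpr (hn.mul_left _)
    refine ⟨?_, ?_⟩
    · intro i hi j hj hij
      simp only [List.mem_cons, List.not_mem_nil, or_false] at hi hj
      refine ⟨fun e => hij ?_⟩
      rcases hi with rfl | rfl | rfl | rfl <;> rcases hj with rfl | rfl | rfl | rfl <;> first
        | rfl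
        | exact absurd (H.iso_a hd e) (by decide)
        | exact absurd (H.iso_c hq hn hd e) (by decide)
    · intro A _ _ hA
      obtain ⟨i, hi, h⟩ := H.complete hA
      rcases hi with rfl | rfl | rfl | ⟨-, rfl | rfl | rfl⟩
      · exact ⟨_, by simp, h⟩
      · exact ⟨(0, 0, 0), by simp, ne_trans h (S_neg (by simpa using hm.one_add) (Or.inl (by simpa using hn)))⟩
      · exact ⟨(1, 0, 0), by simp, ne_trans h (S_swap01 0)⟩
      · exact ⟨(0, 1, 1), by simp, ne_trans h (S_neg (by simpa using hm.one_add) (Or.inl (by simpa using Even.add even_two hn)))⟩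
      · exact ⟨_, by simp, h⟩
      · exact ⟨_, by simp, h⟩
  · obtain ⟨rfl, r, hr, rfl⟩ := H.d2 hq
    have k1 : ∀ b b' : Fin 2, (SAlg 0 2 (Polynomial.X + Polynomial.C r) (0, b, b) ≃ₐ[ℝ] SAlg 0 2 (Polynomial.X + Polynomial.C r) (1, b', b')) → False := by
      intro b b' e
      obtain ⟨s, t, u, s', t', u', h, h'⟩ := two_pres e
      exact d2_a h h'
    have k2 : (SAlg 0 2 (Polynomial.X + Polynomial.C r) (0, 0, 0) ≃ₐ[ℝ] SAlg 0 2 (Polynomial.X + Polynomial.C r) (0, 1, 1)) → False := by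
      intro e
      obtain ⟨s, t, u, s', t', u', h, h'⟩ := two_pres e
      exact d2_b hr h h'
    have k3 : (SAlg 0 2 (Polynomial.X + Polynomial.C r) (1, 0, 0) ≃ₐ[ℝ] SAlg 0 2 (Polynomial.X + Polynomial.C r) (1, 1, 1)) → False := by
      intro e
      obtain ⟨s, t, u, s', t', u', h, h'⟩ := two_pres e
      exact absurd (H.c_eq hq even_two (by decide) h h') (by decide)
    refine ⟨?_, ?_⟩
    · intro i hi j hj hij
      simp only [List.mem_cons, List.not_mem_nil, or_false] at hi hj
      refine ⟨fun e => ?_⟩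
      rcases hi with rfl | rfl | rfl | rfl <;> rcases hj with rfl | rfl | rfl | rfl
      · exact hij rfl
      · exact k2 e
      · exact k1 0 0 e
      · exact k1 0 1 e
      · exact k2 e.symm
      · exact hij rfl
      · exact k1 1 0 e
      · exact k1 1 1 e
      · exact k1 0 0 e.symm
      · exact k1 1 0 e.symm
      · exact hij rfl
      · exact k3 e
      · exact k1 0 1 e.symm
      · exact k1 1 1 e.symm
      · exact k3 e.symm
      · exact hij rfl
    · intro A _ _ hA
      obtain ⟨i, hi, h⟩ := H.complete hA
      rcases hi with rfl | rfl | rfl | ⟨-, rfl | rfl | rfl⟩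
      · exact ⟨_, by simp, h⟩
      · exact ⟨(1, 1, 1), by simp, ne_trans h (S_swap12 r 1 _ _ _ _ (by decide) (by decide) (by decide) (by decide))⟩
      · exact ⟨(1, 0, 0), by simp, ne_trans h (S_swap01 0)⟩
      · exact ⟨(1, 0, 0), by simp, ne_trans h (S_swap12 r 0 _ _ _ _ (by decide) (by decide) (by decide) (by decide))⟩
      · exact ⟨_, by simp, h⟩
      · exact ⟨_, by simp, h⟩

theorem Hyp.case4 (H : Hyp p d m n q) (hc : q ≠ 1 ∧ Even n ∧ Even d ∧ ¬(n = 2 ∧ d = 2)) :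
    ClassifiedBy p m n q [(0, 0, 0), (0, 0, 1), (0, 1, 0), (0, 1, 1), (1, 1, 0), (1, 1, 1)] := by
  obtain ⟨hq, hn, hdd, hne⟩ := hc
  have hd : 3 ≤ d := by
    by_contra h
    have h2 : d = 2 := by have := H.hd; omega
    subst h2
    have h1 := H.deg
    have h2 : q.natDegree ≠ 0 := fun h => hq (H.qmonic.natDegree_eq_zero.mp h)
    have : n ≤ 2 := by nlinarith [Nat.pos_of_ne_zero h2]
    have hn1 := H.hn
    rcases hn with ⟨k, hk⟩
    apply hne; constructor <;> omega
  refine ⟨?_, ?_⟩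
  · intro i hi j hj hij
    simp only [List.mem_cons, List.not_mem_nil, or_false] at hi hj
    refine ⟨fun e => hij ?_⟩
    rcases hi with rfl | rfl | rfl | rfl | rfl | rfl <;> rcases hj with rfl | rfl | rfl | rfl | rfl | rfl <;> first
      | rfl
      | exact absurd (H.iso_a hd e) (by decide)
      | exact absurd (H.iso_c hq hn hd e) (by decide)
      | exact absurd (H.iso_b hd (Or.inl hdd) e) (by decide)
  · intro A _ _ hA
    obtain ⟨i, hi, h⟩ := H.complete hA
    exact ⟨i, by rcases hi with rfl | rfl | rfl | ⟨-, rfl | rfl | rfl⟩ <;> simp, h⟩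

end P14

theorem thmA_real_forms_Danielewski (p : Polynomial ℝ) (d : ℕ) (hd : 2 ≤ d)
    (hdeg : p.natDegree = d) (hmonic : p.Monic) (hred : p.coeff (d - 1) = 0)
    (m n : ℕ) (q : Polynomial ℝ) (hn : 1 ≤ n) (hq0 : q.eval 0 ≠ 0)
    (hpq : p = Polynomial.X ^ m * q.comp (Polynomial.X ^ n))
    (hmax : q ≠ 1 → ∀ (m' n' : ℕ) (q' : Polynomial ℝ), 1 ≤ n' → q'.eval 0 ≠ 0 →
      p = Polynomial.X ^ m' * q'.comp (Polynomial.X ^ n') → n' ≤ n) :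
    (∀ i : Fin 2 × Fin 2 × Fin 2, IsRealForm (SAlg m n q i) (BpC p)) ∧
    ((q = 1 ∧ (d = 2 ∨ (3 ≤ d ∧ Odd d))) →
      ClassifiedBy p m n q [(0, 0, 0), (1, 1, 0)]) ∧
    (((q = 1 ∧ 4 ≤ d ∧ Even d) ∨ (q ≠ 1 ∧ Odd n)) →
      ClassifiedBy p m n q [(0, 0, 0), (0, 1, 0), (1, 1, 0)]) ∧
    ((q ≠ 1 ∧ ((Even n ∧ Odd d) ∨ (n = 2 ∧ d = 2))) →
      ClassifiedBy p m n q [(0, 0, 0), (0, 1, 1), (1, 0, 0), (1, 1, 1)]) ∧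
    ((q ≠ 1 ∧ Even n ∧ Even d ∧ ¬(n = 2 ∧ d = 2)) →
      ClassifiedBy p m n q
        [(0, 0, 0), (0, 0, 1), (0, 1, 0), (0, 1, 1), (1, 1, 0), (1, 1, 1)]) := by
  have H : Hyp p d m n q := ⟨hd, hdeg, hmonic, hred, hn, hq0, hpq, hmax⟩
  exact ⟨real_form_S hn hpq, H.case1, H.case2, H.case3, H.case4⟩
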